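/- arXiv:0911.1652 — 2 statements merged into one kernel-verified Lean document; each statement's English description precedes it below -/
import Mathlib

section
/- Let φ, m ∈ C_0^∞(ℝ^{2d}) with φ real-valued and let a, b ≥ 0. Assume that the d×d matrix ∇_ξ(∇_η − ∇_ξ)φ is invertible and the vector (∇_η − ∇_ξ)φ is non-vanishing at every point of supp m. Then there exists a constant C such that for all λ ≠ 0 and all Schwartz functions f, g on ℝ^d, ‖B_λ(f,g)‖_{L^2(⟨x⟩^a)} ≤ C |λ|^{−d/2−b} ‖f‖_{L^2(⟨x⟩^{a+b})} ‖g‖_{L^1(⟨x⟩^{a+b})}. -/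
open MeasureTheory Filter Complex SchwartzMap
open scoped RealInnerProductSpace ENNReal

noncomputable section

/-- Euclidean space `ℝ^d`. -/
abbrev E (d : ℕ) : Type := EuclideanSpace ℝ (Fin d)

/-- The Fourier transform `(2π)^{-d/2} ∫ e^{-i x·ξ} f(x) dx`. -/
def FT {d : ℕ} (f : E d → ℂ) (ξ : E d) : ℂ :=
  (((2 * Real.pi) ^ (-(d : ℝ) / 2) : ℝ) : ℂ) *
    ∫ x : E d, Complex.exp (-(Complex.I * ((⟪x, ξ⟫ : ℝ) : ℂ))) * f x

/-- The bilinear oscillatory integral `B_λ(f,g)` with symbol `m` and phase `φ`. -/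
def Bop {d : ℕ} (m : E d × E d → ℂ) (φ : E d × E d → ℝ) (lam : ℝ)
    (f g : 𝓢(E d, ℂ)) (x : E d) : ℂ :=
  (((2 * Real.pi) ^ (-(d : ℝ) / 2) : ℝ) : ℂ) *
    ∫ p : E d × E d,
      Complex.exp (Complex.I * ((⟪x, p.1 + p.2⟫ + lam * φ p : ℝ) : ℂ)) *
        m p * FT (⇑f) p.1 * FT (⇑g) p.2

/-- Standard basis vector of `ℝ^d`. -/
def ev {d : ℕ} (i : Fin d) : E d := EuclideanSpace.single i 1

/-- The direction corresponding to `∂_{η_i}`. -/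
def etaV {d : ℕ} (i : Fin d) : E d × E d := (ev i, 0)

/-- The direction corresponding to `∂_{ξ_i}`. -/
def xiV {d : ℕ} (i : Fin d) : E d × E d := (0, ev i)

/-- Iterated (second) directional derivative: first in direction `u`, then in direction `v`. -/
def D2 {V : Type*} [NormedAddCommGroup V] [NormedSpace ℝ V]
    (φ : V → ℝ) (x u v : V) : ℝ :=
  fderiv ℝ (fun y => fderiv ℝ φ y u) x v

/-- The full `2d × 2d` Hessian matrix of `φ` at `x` in the variables `(η,ξ)`. -/
def hessMat {d : ℕ} (φ : E d × E d → ℝ) (x : E d × E d) :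
    Matrix (Fin d ⊕ Fin d) (Fin d ⊕ Fin d) ℝ :=
  Matrix.of fun i j => D2 φ x (Sum.elim etaV xiV j) (Sum.elim etaV xiV i)

/-- The `d × d` matrix `(A_i B_j φ)_{i,j}` for families of first-order directions `A`, `B`. -/
def derMat {d : ℕ} (φ : E d × E d → ℝ) (x : E d × E d)
    (A B : Fin d → E d × E d) : Matrix (Fin d) (Fin d) ℝ :=
  Matrix.of fun i j => D2 φ x (B j) (A i)

/-- Weighted Lebesgue norm `‖f‖_{L^p(⟨x⟩^a)} = ‖x ↦ ⟨x⟩^a f(x)‖_{L^p}`. -/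
def wLpNorm {d : ℕ} (p : ℝ≥0∞) (a : ℝ) (f : E d → ℂ) : ℝ≥0∞ :=
  eLpNorm (fun x => (((1 + ‖x‖ ^ 2) ^ (a / 2) : ℝ) : ℂ) * f x) p volume

section
open MeasureTheory Filter Complex SchwartzMap
open scoped RealInnerProductSpace ENNReal

open scoped ContDiff Topology

lemma cd_of_tsupport {X F : Type*} [NormedAddCommGroup X] [NormedSpace ℝ X]
    [NormedAddCommGroup F] [NormedSpace ℝ F] {f : X → F} {K : Set X} (hK : IsClosed K)
    (h0 : ∀ x ∉ K, f x = 0) (h : ∀ x ∈ K, ContDiffAt ℝ ∞ f x) : ContDiff ℝ ∞ f := by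
  rw [contDiff_iff_contDiffAt]
  intro x
  by_cases hx : x ∈ K
  · exact h x hx
  · have : f =ᶠ[𝓝 x] fun _ => 0 := by
      filter_upwards [hK.isOpen_compl.mem_nhds hx] with y hy using h0 y hy
    exact contDiffAt_const.congr_of_eventuallyEq this

section nsp
set_option linter.unusedSectionVars false
variable {Q V : Type*} [NormedAddCommGroup Q] [NormedSpace ℝ Q]
  [NormedAddCommGroup V] [NormedSpace ℝ V] [FiniteDimensional ℝ V]
  [MeasurableSpace V] [BorelSpace V] (μ : Measure V) [μ.IsAddHaarMeasure]

lemma slice_hasCompactSupport {F : Type*} [NormedAddCommGroup F] {a : Q × V → F}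
    (ha : HasCompactSupport a) (q : Q) : HasCompactSupport (fun x => a (q, x)) := by
  refine HasCompactSupport.of_support_subset_isCompact (ha.isCompact.image continuous_snd) ?_
  intro x hx
  exact ⟨(q, x), subset_tsupport _ hx, rfl⟩

/-- the integration by parts step -/
lemma nsp_step (ψ : Q × V → ℝ) (hψ : ContDiff ℝ ∞ ψ) (a : Q × V → ℂ)
    (ha : ContDiff ℝ ∞ a) (hac : HasCompactSupport a)
    (hg : ∀ z ∈ tsupport a, ∃ v : V, fderiv ℝ ψ z (0, v) ≠ 0) :
    ∃ a' : Q × V → ℂ, ContDiff ℝ ∞ a' ∧ HasCompactSupport a' ∧ tsupport a' ⊆ tsupport a ∧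
      ∀ (q : Q) (t : ℝ),
        ∫ x, Complex.exp (I * ((t * ψ (q, x) : ℝ) : ℂ)) * a' (q, x) ∂μ =
          - (I * t) * ∫ x, Complex.exp (I * ((t * ψ (q, x) : ℝ) : ℂ)) * a (q, x) ∂μ := by
  classical
  let b := Module.finBasis ℝ V
  let D : Fin (Module.finrank ℝ V) → Q × V → ℝ := fun j z => fderiv ℝ ψ z (0, b j)
  have hD : ∀ j, ContDiff ℝ ∞ (D j) := fun j =>
    (hψ.fderiv_right (m := ∞) (by simp)).clm_apply contDiff_const
  let G : Q × V → ℝ := fun z => ∑ j, D j z ^ 2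
  have hG : ContDiff ℝ ∞ G := ContDiff.sum fun j _ => (hD j).pow 2
  have hG0 : ∀ z ∈ tsupport a, G z ≠ 0 := by
    intro z hz h0
    obtain ⟨v, hv⟩ := hg z hz
    apply hv
    have hj : ∀ j, D j z = 0 := by
      intro j
      have := (Finset.sum_eq_zero_iff_of_nonneg (fun j _ => sq_nonneg (D j z))).1 h0 j
        (Finset.mem_univ j)
      simpa using this
    have : (fderiv ℝ ψ z).comp (ContinuousLinearMap.inr ℝ Q V) = 0 := by
      apply ContinuousLinearMap.coe_injective
      apply b.ext
      intro j
      simpa using hj j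
    have h2 := congrArg (fun L => L v) this
    simpa using h2
  let w : Fin (Module.finrank ℝ V) → Q × V → ℂ := fun j z => ((D j z / G z : ℝ) : ℂ) * a z
  have hw : ∀ j, ContDiff ℝ ∞ (w j) := by
    intro j
    refine cd_of_tsupport (isClosed_tsupport a) ?_ ?_
    · intro x hx
      simp [w, image_eq_zero_of_notMem_tsupport hx]
    · intro x hx
      refine ContDiffAt.mul ?_ ha.contDiffAt
      exact (Complex.ofRealCLM.contDiff.contDiffAt).comp x
        ((hD j).contDiffAt.div hG.contDiffAt (hG0 x hx))
  have hws : ∀ j, tsupport (w j) ⊆ tsupport a := fun j =>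
    closure_mono (Function.support_mul_subset_right _ _)
  have hwc : ∀ j, HasCompactSupport (w j) := fun j => hac.mono' ((subset_tsupport _).trans (hws j))
  have hsum : ∀ z, ∑ j, (D j z : ℂ) * w j z = a z := by
    intro z
    by_cases hz : z ∈ tsupport a
    · have h1 := hG0 z hz
      have : ∑ j, (D j z : ℂ) * w j z = ((∑ j, D j z * (D j z / G z) : ℝ) : ℂ) * a z := by
        push_cast
        rw [Finset.sum_mul]
        refine Finset.sum_congr rfl fun j _ => ?_
        simp only [w]; push_cast; ring
      rw [this]
      have h2 : ∑ j, D j z * (D j z / G z) = 1 := by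
        have : ∀ j, D j z * (D j z / G z) = D j z ^ 2 / G z := fun j => by ring
        simp_rw [this]
        rw [← Finset.sum_div]
        exact div_self h1
      simp [h2]
    · simp [w, image_eq_zero_of_notMem_tsupport hz]
  let a' : Q × V → ℂ := fun z => ∑ j, fderiv ℝ (w j) z (0, b j)
  have hterm : ∀ j, ContDiff ℝ ∞ (fun z => fderiv ℝ (w j) z (0, b j)) := fun j =>
    ((hw j).fderiv_right (m := ∞) (by simp)).clm_apply contDiff_const
  have ha's : tsupport a' ⊆ tsupport a := by
    refine closure_minimal ?_ (isClosed_tsupport a)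
    intro z hz
    by_contra hza
    apply hz
    refine Finset.sum_eq_zero fun j _ => ?_
    have : z ∉ tsupport (fun z => fderiv ℝ (w j) z (0, b j)) := fun h =>
      hza (hws j (tsupport_fderiv_apply_subset ℝ _ h))
    exact image_eq_zero_of_notMem_tsupport (f := fun z => fderiv ℝ (w j) z (0, b j)) this
  refine ⟨a', ContDiff.sum fun j _ => hterm j, ?_, ha's, ?_⟩
  · exact hac.mono' ((subset_tsupport _).trans ha's)
  intro q t
  let e : V → ℂ := fun x => Complex.exp (I * ((t * ψ (q, x) : ℝ) : ℂ))
  have hqx : ContDiff ℝ ∞ (fun x : V => (q, x)) := contDiff_prodMk_right q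
  have hψq : ContDiff ℝ ∞ (fun x => ψ (q, x)) := hψ.comp hqx
  have he : ContDiff ℝ ∞ e := by
    apply ContDiff.cexp
    refine contDiff_const.mul ?_
    exact Complex.ofRealCLM.contDiff.comp (contDiff_const.mul hψq)
  have hder : ∀ {F : Type} [NormedAddCommGroup F] [NormedSpace ℝ F] (f : Q × V → F),
      ContDiff ℝ ∞ f → ∀ x v, fderiv ℝ (fun x => f (q, x)) x v = fderiv ℝ f (q, x) (0, v) := by
    intro F _ _ f hf x v
    have h1 : HasFDerivAt (fun x => f (q, x))
        ((fderiv ℝ f (q, x)).comp (ContinuousLinearMap.inr ℝ Q V)) x :=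
      ((hf.differentiable (by simp)) (q, x)).hasFDerivAt.comp x (hasFDerivAt_prodMk_right q x)
    rw [h1.fderiv]; simp
  have hde : ∀ x v, fderiv ℝ e x v = I * t * (fderiv ℝ ψ (q, x) (0, v) : ℝ) * e x := by
    intro x v
    have h1 : HasFDerivAt (fun x => ψ (q, x)) (fderiv ℝ (fun x => ψ (q, x)) x) x :=
      ((hψq.differentiable (by simp)) x).hasFDerivAt
    have h2 := (((Complex.ofRealCLM.hasFDerivAt (x := t * ψ (q, x))).comp x
      (h1.const_mul t)).const_mul I).cexp
    have h3 : fderiv ℝ e x = _ := h2.fderiv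
    rw [h3]
    simp [hder ψ hψ x v, e]
    ring
  have hcont : ∀ j, ∫ x, e x * fderiv ℝ (w j) (q, x) (0, b j) ∂μ =
      - ∫ x, (I * t * (D j (q, x) : ℝ) * e x) * w j (q, x) ∂μ := by
    intro j
    have hwq : ContDiff ℝ ∞ (fun x => w j (q, x)) := (hw j).comp hqx
    have hwqc := slice_hasCompactSupport (hwc j) q
    have hDq : ContDiff ℝ ∞ (fun x => D j (q, x)) := (hD j).comp hqx
    have h1 := integral_mul_fderiv_eq_neg_fderiv_mul_of_integrable (μ := μ) (𝕜 := ℂ)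
      (f := e) (g := fun x => w j (q, x)) (v := b j) ?_ ?_ ?_
      (fun x _ => he.differentiable (by simp) x) (fun x _ => hwq.differentiable (by simp) x)
    · simp only [hde, hder (w j) (hw j)] at h1
      exact h1
    · refine Continuous.integrable_of_hasCompactSupport ?_ hwqc.mul_left
      exact ((he.continuous_fderiv (by simp)).clm_apply continuous_const).mul hwq.continuous
    · refine Continuous.integrable_of_hasCompactSupport ?_ ?_
      · exact he.continuous.mul ((hwq.continuous_fderiv (by simp)).clm_apply continuous_const)
      · exact (hwqc.fderiv_apply ℝ (b j)).mul_left
    · exact Continuous.integrable_of_hasCompactSupport (he.continuous.mul hwq.continuous)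
        hwqc.mul_left
  calc ∫ x, e x * a' (q, x) ∂μ
      = ∑ j, ∫ x, e x * fderiv ℝ (w j) (q, x) (0, b j) ∂μ := by
        simp only [a', Finset.mul_sum]
        rw [integral_finsetSum]
        intro j _
        refine Continuous.integrable_of_hasCompactSupport
          (he.continuous.mul ((hterm j).comp hqx).continuous) ?_
        refine HasCompactSupport.mul_left ?_
        exact slice_hasCompactSupport (a := fun z => fderiv ℝ (w j) z (0, b j))
          ((hwc j).fderiv_apply ℝ _) q
    _ = - ∑ j, ∫ x, (I * t * (D j (q, x) : ℝ) * e x) * w j (q, x) ∂μ := by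
        simp only [hcont]; rw [Finset.sum_neg_distrib]
    _ = - ∫ x, (I * t) * (e x * a (q, x)) ∂μ := by
        rw [← integral_finsetSum]
        · congr 1
          refine integral_congr_ae (Eventually.of_forall fun x => ?_)
          simp only
          rw [← hsum (q, x), Finset.mul_sum, Finset.mul_sum]
          refine Finset.sum_congr rfl fun j _ => ?_
          ring
        · intro j _
          have hDq : ContDiff ℝ ∞ (fun x => D j (q, x)) := (hD j).comp hqx
          have hwq : ContDiff ℝ ∞ (fun x => w j (q, x)) := (hw j).comp hqx
          refine Continuous.integrable_of_hasCompactSupport ?_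
            (slice_hasCompactSupport (hwc j) q).mul_left
          exact ((continuous_const.mul (Complex.continuous_ofReal.comp hDq.continuous)).mul
            he.continuous).mul hwq.continuous
    _ = _ := by rw [integral_const_mul]; simp [e]

/-- nonstationary phase with parameters -/
lemma nsp (ψ : Q × V → ℝ) (hψ : ContDiff ℝ ∞ ψ) (N : ℕ) : ∀ a : Q × V → ℂ,
    ContDiff ℝ ∞ a → HasCompactSupport a →
    (∀ z ∈ tsupport a, ∃ v : V, fderiv ℝ ψ z (0, v) ≠ 0) →
    ∃ C : ℝ, ∀ (q : Q) (t : ℝ),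
      |t| ^ N * ‖∫ x, Complex.exp (I * ((t * ψ (q, x) : ℝ) : ℂ)) * a (q, x) ∂μ‖ ≤ C := by
  induction N with
  | zero =>
    intro a ha hac _
    obtain ⟨B, hB⟩ := hac.exists_bound_of_continuous ha.continuous
    set K := Prod.snd '' tsupport a with hKdef
    have hK : IsCompact K := hac.isCompact.image continuous_snd
    refine ⟨B * μ.real K, fun q t => ?_⟩
    simp only [pow_zero, one_mul]
    rw [← setIntegral_eq_integral_of_forall_compl_eq_zero (s := K)]
    · refine norm_setIntegral_le_of_norm_le_const hK.measure_lt_top ?_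
      intro x _
      rw [norm_mul, mul_comm I, Complex.norm_exp_ofReal_mul_I, one_mul]
      exact hB _
    · intro x hx
      have : a (q, x) = 0 := by
        apply image_eq_zero_of_notMem_tsupport
        exact fun h => hx ⟨_, h, rfl⟩
      simp [this]
  | succ N ih =>
    intro a ha hac hg
    obtain ⟨a', h1, h2, h3, h4⟩ := nsp_step μ ψ hψ a ha hac hg
    obtain ⟨C, hC⟩ := ih a' h1 h2 (fun z hz => hg z (h3 hz))
    refine ⟨C, fun q t => ?_⟩
    have := hC q t
    rw [h4 q t] at this
    simpa [pow_succ, mul_assoc] using this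

end nsp

end

section
open MeasureTheory Filter Complex SchwartzMap
open scoped RealInnerProductSpace ENNReal

open scoped ContDiff Topology FourierTransform

lemma fourier_L1L2_ae {d : ℕ} (h : E d → ℂ) (h1 : Integrable h) (h2 : MemLp h 2) :
    eLpNorm (𝓕 h) 2 volume = eLpNorm h 2 volume := by
  have hae : 𝓕 h =ᵐ[volume] (𝓕 (h2.toLp h) : Lp (α := E d) ℂ 2 volume) := by
    have hcont : Continuous (𝓕 h) :=
      VectorFourier.fourierIntegral_continuous Real.continuous_fourierChar
        continuous_inner h1
    refine ae_eq_of_integral_contDiff_smul_eq hcont.locallyIntegrable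
      ((Lp.memLp _).locallyIntegrable (by norm_num)) ?_
    intro g hg hgc
    let G : 𝓢(E d, ℂ) := HasCompactSupport.toSchwartzMap (f := fun x => (g x : ℂ))
      (hgc.comp_left (g := fun x : ℝ => (x : ℂ)) (by simp)) (Complex.ofRealCLM.contDiff.comp hg)
    have e1 : ∫ x, g x • (𝓕 (h2.toLp h) : Lp (α := E d) ℂ 2 volume) x =
        ((𝓕 (h2.toLp h) : Lp (α := E d) ℂ 2 volume) : 𝓢'(E d, ℂ)) G := by
      rw [Lp.toTemperedDistribution_apply]
      rfl
    rw [e1, ← Lp.fourier_toTemperedDistribution_eq, TemperedDistribution.fourier_apply,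
      Lp.toTemperedDistribution_apply]
    have e2 : ∫ x, (𝓕 G) x • (h2.toLp h) x = ∫ x, (𝓕 G) x • h x := by
      refine integral_congr_ae ?_
      filter_upwards [h2.coeFn_toLp] with x hx
      rw [hx]
    rw [e2]
    have e3 := VectorFourier.integral_fourierIntegral_smul_eq_flip (L := innerₗ (E d))
      (μ := volume) (ν := volume) Real.continuous_fourierChar continuous_inner G.integrable h1
    rw [flip_innerₗ] at e3
    exact e3.symm
  rw [eLpNorm_congr_ae hae]
  have := Lp.norm_fourier_eq (h2.toLp h)
  rw [Lp.norm_def, Lp.norm_def, eLpNorm_congr_ae h2.coeFn_toLp] at this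
  exact (ENNReal.toReal_eq_toReal_iff' (Lp.eLpNorm_ne_top _) h2.2.ne).1 this

end

section
open MeasureTheory Filter Complex SchwartzMap
open scoped RealInnerProductSpace ENNReal

open scoped ContDiff Topology Manifold

lemma exists_cutoff {X : Type*} [NormedAddCommGroup X] [NormedSpace ℝ X] [FiniteDimensional ℝ X]
    {K U : Set X} (hK : IsCompact K) (hU : IsOpen U) (hKU : K ⊆ U) :
    ∃ χ : X → ℝ, ContDiff ℝ ∞ χ ∧ HasCompactSupport χ ∧ tsupport χ ⊆ U ∧
      ∀ᶠ x in 𝓝ˢ K, χ x = 1 := by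
  obtain ⟨L, hL, hKL, hLU⟩ := exists_compact_between hK hU hKU
  obtain ⟨f, h1, h0, -⟩ := exists_contMDiffMap_one_nhds_of_subset_interior (n := (⊤ : ℕ∞))
    𝓘(ℝ, X) hK.isClosed hKL
  have hs : tsupport f ⊆ L := closure_minimal (fun x hx => by
    by_contra h; exact hx (h0 x h)) hL.isClosed
  exact ⟨f, f.contMDiff.contDiff, HasCompactSupport.of_support_subset_isCompact hL
    ((subset_tsupport _).trans hs), hs.trans hLU, h1⟩

/-- the physical-side kernel -/
def kerK {d : ℕ} (m : E d × E d → ℂ) (φ : E d × E d → ℝ) (lam : ℝ) (u v : E d) : ℂ :=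
  ∫ p : E d × E d,
    Complex.exp (I * ((⟪u, p.1⟫ + ⟪v, p.2⟫ + lam * φ p : ℝ) : ℂ)) * m p

lemma norm_expI (t : ℝ) : ‖Complex.exp (I * (t : ℂ))‖ = 1 := by
  rw [mul_comm I, Complex.norm_exp_ofReal_mul_I]

lemma ker_bound {d : ℕ} (m : E d × E d → ℂ) (φ : E d × E d → ℝ) (lam : ℝ) (u v : E d) :
    ‖kerK m φ lam u v‖ ≤ ∫ p, ‖m p‖ := by
  refine (norm_integral_le_integral_norm _).trans (le_of_eq ?_)
  simp only [norm_mul, norm_expI, one_mul]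

lemma ker_continuous {d : ℕ} (m : E d × E d → ℂ) (φ : E d × E d → ℝ) (lam : ℝ)
    (hφ : Continuous φ) (hm : Continuous m) (hmc : HasCompactSupport m) :
    Continuous (fun w : E d × E d => kerK m φ lam w.1 w.2) := by
  unfold kerK
  refine continuous_of_dominated (bound := fun p => ‖m p‖) ?_ ?_ ?_ ?_
  · intro w
    exact Continuous.aestronglyMeasurable (by fun_prop)
  · intro w
    refine Eventually.of_forall fun p => ?_
    rw [norm_mul, norm_expI, one_mul]
  · exact (hm.integrable_of_hasCompactSupport hmc).norm
  · refine Eventually.of_forall fun p => ?_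
    fun_prop

lemma diffdir_continuous {d : ℕ} {φ : E d × E d → ℝ} (hφs : ContDiff ℝ ∞ φ) :
    Continuous (fun p => (fderiv ℝ φ p).comp
      ((ContinuousLinearMap.id ℝ (E d)).prod (-ContinuousLinearMap.id ℝ (E d)))) :=
  (hφs.continuous_fderiv (by simp)).clm_comp continuous_const

lemma ker_decay {d : ℕ} (φ : E d × E d → ℝ) (m : E d × E d → ℂ)
    (hφs : ContDiff ℝ ∞ φ) (hms : ContDiff ℝ ∞ m) (hmc : HasCompactSupport m)
    (hgrad : ∀ p ∈ tsupport m, ∃ j : Fin d, fderiv ℝ φ p (etaV j - xiV j) ≠ 0) :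
    ∃ c : ℝ, 0 < c ∧ ∃ C0 : ℝ, 0 < C0 ∧ ∀ N : ℕ, ∃ C : ℝ, ∀ (lam : ℝ) (u v : E d),
      (C0 * |lam| ≤ ‖u‖ + ‖v‖ ∨ ‖u - v‖ ≤ c * |lam|) →
      (‖u‖ + ‖v‖ + |lam|) ^ N * ‖kerK m φ lam u v‖ ≤ C := by
  let J : E d →L[ℝ] E d × E d :=
    (ContinuousLinearMap.id ℝ (E d)).prod (-ContinuousLinearMap.id ℝ (E d))
  have hK : IsCompact (tsupport m) := hmc
  obtain ⟨c0, hc0, hc⟩ := hK.exists_forall_le' (f := fun p => ‖(fderiv ℝ φ p).comp J‖) (a := 0)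
    (diffdir_continuous hφs).norm.continuousOn (by
      intro p hp
      rw [norm_pos_iff]
      intro h
      obtain ⟨j, hj⟩ := hgrad p hp
      apply hj
      have h2 := congrArg (fun L => L (ev j)) h
      simpa [J, etaV, xiV] using h2)
  obtain ⟨C1, hC1⟩ := hK.exists_bound_of_continuousOn
    (f := fun p => fderiv ℝ φ p) (hφs.continuous_fderiv (by simp)).continuousOn
  let C2 := |C1|
  have hC2 : ∀ p ∈ tsupport m, ‖fderiv ℝ φ p‖ ≤ C2 := fun p hp => (hC1 p hp).trans (le_abs_self _)
  refine ⟨c0 / 2, by positivity, 2 * C2 + 1, by positivity, fun N => ?_⟩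
  let ψ : ((E d × E d) × ℝ) × (E d × E d) → ℝ := fun z =>
    ⟪z.1.1.1, z.2.1⟫ + ⟪z.1.1.2, z.2.2⟫ + z.1.2 * φ z.2
  have hψ : ContDiff ℝ ∞ ψ := by
    refine ContDiff.add (ContDiff.add ?_ ?_) ?_
    · exact ContDiff.inner ℝ (by fun_prop) (by fun_prop)
    · exact ContDiff.inner ℝ (by fun_prop) (by fun_prop)
    · exact (by fun_prop : ContDiff ℝ ∞ fun z : ((E d × E d) × ℝ) × (E d × E d) => z.1.2).mul
        (hφs.comp contDiff_snd)
  have hdψ : ∀ (z : ((E d × E d) × ℝ) × (E d × E d)) (v : E d × E d),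
      fderiv ℝ ψ z (0, v) = ⟪z.1.1.1, v.1⟫ + ⟪z.1.1.2, v.2⟫ + z.1.2 * fderiv ℝ φ z.2 v := by
    intro z v
    obtain ⟨q, p⟩ := z
    have h1 : HasFDerivAt (fun x => ψ (q, x))
        ((fderiv ℝ ψ (q, p)).comp (ContinuousLinearMap.inr ℝ _ _)) p :=
      ((hψ.differentiable (by simp)) (q, p)).hasFDerivAt.comp p (hasFDerivAt_prodMk_right q p)
    have h2 : HasFDerivAt (fun x => ψ (q, x))
        ((((innerSL ℝ q.1.1).comp (ContinuousLinearMap.fst ℝ (E d) (E d))) +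
          ((innerSL ℝ q.1.2).comp (ContinuousLinearMap.snd ℝ (E d) (E d)))) + q.2 • fderiv ℝ φ p) p := by
      refine HasFDerivAt.add (HasFDerivAt.add ?_ ?_) ?_
      · exact ContinuousLinearMap.hasFDerivAt (𝕜 := ℝ) (E := E d × E d) (F := ℝ) ((innerSL ℝ q.1.1).comp (ContinuousLinearMap.fst ℝ (E d) (E d)))
      · exact ContinuousLinearMap.hasFDerivAt (𝕜 := ℝ) (E := E d × E d) (F := ℝ) ((innerSL ℝ q.1.2).comp (ContinuousLinearMap.snd ℝ (E d) (E d)))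
      · exact ((hφs.differentiable (by simp)) p).hasFDerivAt.const_mul q.2
    have h3 := congrArg (fun L => L v) (h1.unique h2)
    simpa using h3
  let U : Set (((E d × E d) × ℝ) × (E d × E d)) := {z | ∃ v, fderiv ℝ ψ z (0, v) ≠ 0}
  have hU : IsOpen U := by
    have : U = ⋃ v, {z | fderiv ℝ ψ z (0, v) ≠ 0} := by ext; simp [U]
    rw [this]
    refine isOpen_iUnion fun v => ?_
    exact isOpen_ne_fun ((hψ.continuous_fderiv (by simp)).clm_apply continuous_const)
      continuous_const
  let P : Set ((E d × E d) × ℝ) := {q | (2 * C2 + 1) * |q.2| ≤ ‖q.1.1‖ + ‖q.1.2‖ ∨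
    ‖q.1.1 - q.1.2‖ ≤ c0 / 2 * |q.2|}
  have hP : IsClosed P := by
    have h1 : IsClosed {q : (E d × E d) × ℝ | (2 * C2 + 1) * |q.2| ≤ ‖q.1.1‖ + ‖q.1.2‖} :=
      isClosed_le (by fun_prop) (by fun_prop)
    have h2 : IsClosed {q : (E d × E d) × ℝ | ‖q.1.1 - q.1.2‖ ≤ c0 / 2 * |q.2|} :=
      isClosed_le (by fun_prop) (by fun_prop)
    exact h1.union h2
  let S : Set ((E d × E d) × ℝ) := Metric.sphere 0 1 ∩ P
  have hS : IsCompact S := (isCompact_sphere _ _).inter_right hP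
  have hSU : S ×ˢ tsupport m ⊆ U := by
    rintro ⟨q, p⟩ ⟨⟨hq1, hqP⟩, hp⟩
    by_contra hcon
    have h0 : ∀ v : E d × E d, ⟪q.1.1, v.1⟫ + ⟪q.1.2, v.2⟫ + q.2 * fderiv ℝ φ p v = 0 := by
      intro v
      by_contra hv
      exact hcon ⟨v, by rw [hdψ]; exact hv⟩
    have hF := hC2 p hp
    have hb1 : ‖q.1.1‖ ≤ |q.2| * C2 := by
      have h1 := h0 (q.1.1, 0)
      simp only [inner_zero_right, add_zero, real_inner_self_eq_norm_sq] at h1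
      have h2 : ‖q.1.1‖ * ‖q.1.1‖ ≤ |q.2| * C2 * ‖q.1.1‖ := by
        have h3 : ‖fderiv ℝ φ p (q.1.1, 0)‖ ≤ C2 * ‖q.1.1‖ := by
          refine ((fderiv ℝ φ p).le_of_opNorm_le hF _).trans (le_of_eq ?_)
          simp
        calc ‖q.1.1‖ * ‖q.1.1‖ = - (q.2 * fderiv ℝ φ p (q.1.1, 0)) := by linarith
          _ ≤ |q.2 * fderiv ℝ φ p (q.1.1, 0)| := neg_le_abs _
          _ = |q.2| * ‖fderiv ℝ φ p (q.1.1, 0)‖ := by rw [abs_mul, Real.norm_eq_abs]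
          _ ≤ |q.2| * (C2 * ‖q.1.1‖) := by gcongr
          _ = _ := by ring
      rcases (norm_nonneg q.1.1).eq_or_lt with h | h
      · rw [← h]; positivity
      · exact le_of_mul_le_mul_right h2 h
    have hb2 : ‖q.1.2‖ ≤ |q.2| * C2 := by
      have h1 := h0 (0, q.1.2)
      simp only [inner_zero_right, zero_add, real_inner_self_eq_norm_sq] at h1
      have h2 : ‖q.1.2‖ * ‖q.1.2‖ ≤ |q.2| * C2 * ‖q.1.2‖ := by
        have h3 : ‖fderiv ℝ φ p (0, q.1.2)‖ ≤ C2 * ‖q.1.2‖ := by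
          refine ((fderiv ℝ φ p).le_of_opNorm_le hF _).trans (le_of_eq ?_)
          simp
        calc ‖q.1.2‖ * ‖q.1.2‖ = - (q.2 * fderiv ℝ φ p (0, q.1.2)) := by linarith
          _ ≤ |q.2 * fderiv ℝ φ p (0, q.1.2)| := neg_le_abs _
          _ = |q.2| * ‖fderiv ℝ φ p (0, q.1.2)‖ := by rw [abs_mul, Real.norm_eq_abs]
          _ ≤ |q.2| * (C2 * ‖q.1.2‖) := by gcongr
          _ = _ := by ring
      rcases (norm_nonneg q.1.2).eq_or_lt with h | h
      · rw [← h]; positivity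
      · exact le_of_mul_le_mul_right h2 h
    have hs0 : |q.2| = 0 := by
      have hq2 := abs_nonneg q.2
      rcases hqP with h | h
      · simp only at h
        nlinarith
      · simp only at h
        have h1 : |q.2| * ‖(fderiv ℝ φ p).comp J‖ ≤ ‖q.1.1 - q.1.2‖ := by
          rw [← Real.norm_eq_abs, ← norm_smul]
          refine ContinuousLinearMap.opNorm_le_bound _ (norm_nonneg _) fun w => ?_
          have h2 := h0 (w, -w)
          have h3 : (q.2 • (fderiv ℝ φ p).comp J) w = - ⟪q.1.1 - q.1.2, w⟫ := by
            simp only [inner_neg_right] at h2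
            simp only [_root_.smul_apply, ContinuousLinearMap.comp_apply, J,
              ContinuousLinearMap.prod_apply, _root_.neg_apply,
              ContinuousLinearMap.id_apply, smul_eq_mul, inner_sub_left]
            linarith
          rw [h3, norm_neg]
          exact norm_inner_le_norm _ _
        have h4 := hc p hp
        have h5 : |q.2| * c0 ≤ |q.2| * ‖(fderiv ℝ φ p).comp J‖ := by gcongr
        nlinarith
    have hq : q = 0 := by
      rw [hs0] at hb1 hb2
      have e1 : q.1.1 = 0 := by simpa using hb1
      have e2 : q.1.2 = 0 := by simpa using hb2
      have e3 : q.2 = 0 := by simpa using hs0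
      exact Prod.ext (Prod.ext e1 e2) e3
    simp [hq] at hq1
  obtain ⟨χ, hχ1, hχ2, hχ3, hχ4⟩ := exists_cutoff (hS.prod hK) hU hSU
  have hχ5 : ∀ z ∈ S ×ˢ tsupport m, χ z = 1 := fun z hz => hχ4.self_of_nhdsSet z hz
  let a : ((E d × E d) × ℝ) × (E d × E d) → ℂ := fun z => (χ z : ℂ) * m z.2
  have ha : ContDiff ℝ ∞ a := (Complex.ofRealCLM.contDiff.comp hχ1).mul (hms.comp contDiff_snd)
  have has : tsupport a ⊆ tsupport χ := by
    refine closure_mono ?_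
    intro z hz
    simp only [a, Function.mem_support, ne_eq, mul_eq_zero, not_or] at hz
    simpa using hz.1
  have hac : HasCompactSupport a := hχ2.mono' ((subset_tsupport _).trans has)
  haveI : (volume : Measure (E d × E d)).IsAddHaarMeasure := by
    rw [Measure.volume_eq_prod]; infer_instance
  obtain ⟨C, hC⟩ := nsp volume ψ hψ N a ha hac (fun z hz => hχ3 (has hz))
  set B := ∫ p, ‖m p‖ with hB
  refine ⟨3 ^ N * |C| + B, fun lam u v huv => ?_⟩
  have hB0 : 0 ≤ B := integral_nonneg fun _ => norm_nonneg _
  set R : ℝ := ‖((u, v), lam)‖ with hR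
  have hR3 : ‖u‖ + ‖v‖ + |lam| ≤ 3 * R := by
    have h1 : ‖(u, v)‖ ≤ R := norm_fst_le ((u, v), lam)
    have h2 : ‖lam‖ ≤ R := norm_snd_le ((u, v), lam)
    have h3 : ‖u‖ ≤ ‖(u, v)‖ := norm_fst_le (u, v)
    have h4 : ‖v‖ ≤ ‖(u, v)‖ := norm_snd_le (u, v)
    rw [Real.norm_eq_abs] at h2
    linarith
  rcases (norm_nonneg ((u, v), lam)).eq_or_lt with h0 | hpos
  · have hle : ‖u‖ + ‖v‖ + |lam| ≤ 0 := by rw [← hR] at h0; linarith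
    have h1 : (‖u‖ + ‖v‖ + |lam|) ^ N ≤ 1 := pow_le_one₀ (by positivity) (by linarith)
    calc (‖u‖ + ‖v‖ + |lam|) ^ N * ‖kerK m φ lam u v‖ ≤ 1 * B := by
          gcongr; exact ker_bound m φ lam u v
      _ ≤ _ := by rw [one_mul]; linarith [show 0 ≤ 3 ^ N * |C| by positivity]
  · rw [← hR] at hpos
    let q : (E d × E d) × ℝ := R⁻¹ • ((u, v), lam)
    have hqS : q ∈ S := by
      refine ⟨?_, ?_⟩
      · simp only [mem_sphere_iff_norm, sub_zero, q, norm_smul, norm_inv, Real.norm_eq_abs,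
          abs_of_pos hpos]
        rw [← hR]
        exact inv_mul_cancel₀ hpos.ne'
      · have hRi : 0 < R⁻¹ := inv_pos.2 hpos
        simp only [P, q, Set.mem_setOf_eq, Prod.smul_fst, Prod.smul_snd, ← smul_sub, norm_smul,
          smul_eq_mul, abs_mul, Real.norm_eq_abs, abs_of_pos hRi]
        rcases huv with h | h
        · left
          calc (2 * C2 + 1) * (R⁻¹ * |lam|) = R⁻¹ * ((2 * C2 + 1) * |lam|) := by ring
            _ ≤ R⁻¹ * (‖u‖ + ‖v‖) := by gcongr
            _ = _ := by ring
        · right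
          calc R⁻¹ * ‖u - v‖ ≤ R⁻¹ * (c0 / 2 * |lam|) := by gcongr
            _ = _ := by ring
    have hker : kerK m φ lam u v =
        ∫ p, Complex.exp (I * ((R * ψ (q, p) : ℝ) : ℂ)) * a (q, p) := by
      unfold kerK
      refine integral_congr_ae (Eventually.of_forall fun p => ?_)
      simp only
      have h1 : R * ψ (q, p) = ⟪u, p.1⟫ + ⟪v, p.2⟫ + lam * φ p := by
        simp only [ψ, q, Prod.smul_fst, Prod.smul_snd, inner_smul_left, smul_eq_mul]
        simp
        field_simp
      rw [h1]
      congr 1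
      by_cases hp : p ∈ tsupport m
      · simp [a, hχ5 (q, p) ⟨hqS, hp⟩]
      · simp [a, image_eq_zero_of_notMem_tsupport hp]
    have h1 := hC q R
    rw [← hker, abs_of_pos hpos] at h1
    calc (‖u‖ + ‖v‖ + |lam|) ^ N * ‖kerK m φ lam u v‖
        ≤ (3 * R) ^ N * ‖kerK m φ lam u v‖ := by gcongr
      _ = 3 ^ N * (R ^ N * ‖kerK m φ lam u v‖) := by rw [mul_pow]; ring
      _ ≤ 3 ^ N * |C| := by gcongr; exact h1.trans (le_abs_self _)
      _ ≤ _ := by linarith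

end

section
open MeasureTheory Filter Complex SchwartzMap
open scoped RealInnerProductSpace ENNReal

open scoped ContDiff Topology Convolution

lemma contDiff_integral_01 {P : Type*} [NormedAddCommGroup P] [NormedSpace ℝ P]
    [FiniteDimensional ℝ P]
    (g : P × ℝ → ℝ) (hg : ContDiff ℝ ∞ g) :
    ContDiff ℝ ∞ (fun p => ∫ s in (0:ℝ)..1, g (p, s)) := by
  obtain ⟨χ, hχ1, hχ2, -, hχ4⟩ := exists_cutoff (X := ℝ) (isCompact_Icc (a := (-1:ℝ)) (b := 0))
    isOpen_univ (Set.subset_univ _)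
  let f : ℝ → ℝ := Set.indicator (Set.Ioc 0 1) (fun _ => 1)
  have hf : LocallyIntegrable f volume := by
    refine Integrable.locallyIntegrable ?_
    exact (integrable_indicator_iff measurableSet_Ioc).2 (by simp)
  have h := contDiffOn_convolution_right_with_param (𝕜 := ℝ) (μ := volume) (f := f) (n := (⊤ : ℕ∞))
    (ContinuousLinearMap.lsmul ℝ ℝ) (g := fun (p : P) (x : ℝ) => χ x * g (p, -x))
    (s := Set.univ) (k := tsupport χ) isOpen_univ hχ2 (by
      intro p x _ hx
      simp [image_eq_zero_of_notMem_tsupport hx]) hf (by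
      refine ContDiff.contDiffOn ?_
      refine (hχ1.comp contDiff_snd).mul (hg.comp ?_)
      exact contDiff_fst.prodMk contDiff_snd.neg)
  rw [Set.univ_prod_univ, contDiffOn_univ] at h
  have h2 : ContDiff ℝ ∞ (fun p : P => (p, (0 : ℝ))) := contDiff_prodMk_left 0
  have h3 := h.comp h2
  convert h3 using 1
  ext p
  simp only [Function.comp_apply, MeasureTheory.convolution, ContinuousLinearMap.lsmul_apply]
  rw [intervalIntegral.integral_of_le zero_le_one, ← integral_indicator measurableSet_Ioc]
  refine integral_congr_ae (Eventually.of_forall fun s => ?_)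
  by_cases hs : s ∈ Set.Ioc (0:ℝ) 1
  · have : χ (-s) = 1 := hχ4.self_of_nhdsSet _ ⟨by linarith [hs.2], by linarith [hs.1]⟩
    simp [f, hs, this]
  · simp [f, hs]

lemma D2_nondeg {d : ℕ} (φ : E d × E d → ℝ) (hφs : ContDiff ℝ ∞ φ) (p : E d × E d)
    (hdet : (derMat φ p xiV (fun j => etaV j - xiV j)).det ≠ 0) (θ : E d) (hθ : θ ≠ 0) :
    ∃ v : E d, fderiv ℝ (fun y => fderiv ℝ φ y (θ, -θ)) p (0, v) ≠ 0 := by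
  by_contra hcon
  push Not at hcon
  apply hθ
  have hD : Differentiable ℝ (fderiv ℝ φ) :=
    (hφs.fderiv_right (m := ∞) (by simp)).differentiable (by simp)
  have hlin : ∀ u v, fderiv ℝ (fun y => fderiv ℝ φ y u) p v = fderiv ℝ (fderiv ℝ φ) p v u := by
    intro u v
    have := (hD p).hasFDerivAt.clm_apply (hasFDerivAt_const u p)
    rw [this.fderiv]
    simp
  have hz : (derMat φ p xiV (fun j => etaV j - xiV j)).mulVec (fun j => θ j) = 0 := by
    ext i
    have h1 := hcon (ev i)
    rw [hlin] at h1
    have h2 : ((θ, -θ) : E d × E d) = ∑ j, θ j • (etaV j - xiV j) := by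
      have h3 : θ = ∑ j, θ j • (ev j : E d) := by
        ext k
        simp [ev, Finset.sum_apply, Pi.single_apply]
      ext k
      · conv_lhs => rw [h3]
        simp [etaV, xiV, Prod.fst_sum]
      · conv_lhs => rw [h3]
        simp [etaV, xiV, Prod.snd_sum]
    rw [h2, map_sum] at h1
    simp only [Matrix.mulVec, dotProduct, derMat, Matrix.of_apply, D2, Pi.zero_apply]
    rw [← h1]
    refine Finset.sum_congr rfl fun j _ => ?_
    rw [hlin, map_smul, smul_eq_mul, mul_comm]
    rfl
  have := Matrix.eq_zero_of_mulVec_eq_zero hdet hz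
  ext j
  exact congrFun this j

/-- kernel of `T* T` -/
def hK {d : ℕ} (m : E d × E d → ℂ) (φ : E d × E d → ℝ) (lam : ℝ) (η η' : E d) : ℂ :=
  ∫ ζ : E d, Complex.exp (I * ((lam * (φ (η', ζ - η') - φ (η, ζ - η)) : ℝ) : ℂ)) *
    (m (η', ζ - η') * (starRingEnd ℂ) (m (η, ζ - η)))

lemma hK_bound {d : ℕ} (m : E d × E d → ℂ) (φ : E d × E d → ℝ)
    (hm : Continuous m) (hmc : HasCompactSupport m) :
    ∃ B : ℝ, ∀ lam η η', ‖hK m φ lam η η'‖ ≤ B := by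
  obtain ⟨B, hB⟩ := hmc.exists_bound_of_continuous hm
  set L := Prod.snd '' tsupport m with hL
  have hLc : IsCompact L := hmc.isCompact.image continuous_snd
  refine ⟨B * B * (volume : Measure (E d)).real L, fun lam η η' => ?_⟩
  have hB0 : 0 ≤ B := (norm_nonneg _).trans (hB 0)
  have hsub : hK m φ lam η η' =
    ∫ ζ : E d, Complex.exp (I * ((lam * (φ (η', ζ + η - η') - φ (η, ζ)) : ℝ) : ℂ)) *
      (m (η', ζ + η - η') * (starRingEnd ℂ) (m (η, ζ))) := by
    unfold hK
    rw [← integral_add_right_eq_self _ η]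
    simp
  rw [hsub, ← setIntegral_eq_integral_of_forall_compl_eq_zero (s := L)]
  · refine norm_setIntegral_le_of_norm_le_const hLc.measure_lt_top ?_
    intro x _
    rw [norm_mul, norm_expI, one_mul, norm_mul, RCLike.norm_conj]
    exact mul_le_mul (hB _) (hB _) (norm_nonneg _) hB0
  · intro x hx
    have : m (η, x) = 0 := by
      apply image_eq_zero_of_notMem_tsupport
      exact fun h => hx ⟨_, h, rfl⟩
    simp [this]

lemma hK_decay {d : ℕ} (φ : E d × E d → ℝ) (m : E d × E d → ℂ)
    (hφs : ContDiff ℝ ∞ φ) (hms : ContDiff ℝ ∞ m) (hmc : HasCompactSupport m)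
    (hmat : ∀ p ∈ tsupport m, (derMat φ p xiV (fun j => etaV j - xiV j)).det ≠ 0) :
    ∃ r : ℝ, 0 < r ∧ ∀ N : ℕ, ∃ C : ℝ, ∀ (lam : ℝ) (η η' : E d), ‖η' - η‖ ≤ r → η' ≠ η →
      (|lam| * ‖η' - η‖) ^ N * ‖hK m φ lam η η'‖ ≤ C := by
  -- the integrand of the Hadamard quotient
  let g : (((E d × E d) × ℝ) × E d) × ℝ → ℝ := fun w =>
    fderiv ℝ φ (w.1.1.1.1 + (w.2 * w.1.1.2) • w.1.1.1.2,
      w.1.2 - (w.1.1.1.1 + (w.2 * w.1.1.2) • w.1.1.1.2)) (w.1.1.1.2, - w.1.1.1.2)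
  have hg : ContDiff ℝ ∞ g := by
    refine ContDiff.clm_apply ((hφs.fderiv_right (m := ∞) (by simp)).comp ?_) ?_
    · fun_prop
    · fun_prop
  let ψ : (((E d × E d) × ℝ) × E d) → ℝ := fun z => ∫ s in (0:ℝ)..1, g (z, s)
  have hψ : ContDiff ℝ ∞ ψ := contDiff_integral_01 g hg
  have hquot : ∀ (η θ : E d) (t : ℝ) (ζ : E d), t * ψ (((η, θ), t), ζ) =
      φ (η + t • θ, ζ - (η + t • θ)) - φ (η, ζ - η) := by
    intro η θ t ζ
    simp only [ψ]
    rw [← intervalIntegral.integral_const_mul]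
    have hd : ∀ s ∈ Set.uIcc (0:ℝ) 1, HasDerivAt
        (fun s : ℝ => φ (η + (s * t) • θ, ζ - (η + (s * t) • θ)))
        (t * g ((((η, θ), t), ζ), s)) s := by
      intro s _
      have h1 : HasDerivAt (fun s : ℝ => η + (s * t) • θ) (t • θ) s := by
        have := ((hasDerivAt_id s).mul_const t).smul_const θ
        simpa using this.const_add η
      have h2 : HasDerivAt (fun s : ℝ => ζ - (η + (s * t) • θ)) (-(t • θ)) s :=
        h1.const_sub ζ
      have h3 := ((hφs.differentiable (by simp)) _).hasFDerivAt.comp_hasDerivAt s (h1.prodMk h2)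
      have h4 : ((t • θ, -(t • θ)) : E d × E d) = t • (θ, -θ) := by simp
      rw [h4, map_smul, smul_eq_mul] at h3
      exact h3
    rw [intervalIntegral.integral_eq_sub_of_hasDerivAt hd]
    · simp
    · refine Continuous.intervalIntegrable ?_ _ _
      exact continuous_const.mul (hg.continuous.comp (by fun_prop))
  let U : Set (((E d × E d) × ℝ) × E d) := {z | ∃ v, fderiv ℝ ψ z (0, v) ≠ 0}
  have hU : IsOpen U := by
    have : U = ⋃ v, {z | fderiv ℝ ψ z (0, v) ≠ 0} := by ext; simp [U]
    rw [this]
    refine isOpen_iUnion fun v => ?_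
    exact isOpen_ne_fun ((hψ.continuous_fderiv (by simp)).clm_apply continuous_const)
      continuous_const
  let κ : (E d × E d) × E d → (((E d × E d) × ℝ) × E d) := fun w => (((w.1.1, w.2), 0), w.1.1 + w.1.2)
  let K0 : Set (((E d × E d) × ℝ) × E d) := κ '' (tsupport m ×ˢ Metric.sphere 0 1)
  have hK0 : IsCompact K0 :=
    (hmc.isCompact.prod (isCompact_sphere 0 1)).image (by fun_prop)
  have hK0U : K0 ⊆ U := by
    rintro _ ⟨⟨p, θ⟩, ⟨hp, hθ⟩, rfl⟩
    have hθ0 : θ ≠ 0 := by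
      rintro rfl
      simp at hθ
    obtain ⟨v, hv⟩ := D2_nondeg φ hφs p (hmat p hp) θ hθ0
    refine ⟨v, ?_⟩
    have hval : ∀ ζ, ψ (((p.1, θ), 0), ζ) = fderiv ℝ φ (p.1, ζ - p.1) (θ, -θ) := by
      intro ζ
      simp [ψ, g]
    have h1 : HasFDerivAt (fun x => ψ (((p.1, θ), 0), x))
        ((fderiv ℝ ψ (((p.1, θ), 0), p.1 + p.2)).comp (ContinuousLinearMap.inr ℝ _ _))
        (p.1 + p.2) :=
      ((hψ.differentiable (by simp)) _).hasFDerivAt.comp _ (hasFDerivAt_prodMk_right _ _)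
    have hF : ContDiff ℝ ∞ (fun y => fderiv ℝ φ y (θ, -θ)) :=
      (hφs.fderiv_right (m := ∞) (by simp)).clm_apply contDiff_const
    have h2 : HasFDerivAt (fun ζ : E d => (p.1, ζ - p.1)) (ContinuousLinearMap.inr ℝ (E d) (E d))
        (p.1 + p.2) := by
      have := (hasFDerivAt_const p.1 (p.1 + p.2)).prodMk
        ((hasFDerivAt_id (𝕜 := ℝ) (p.1 + p.2)).sub_const p.1)
      exact this
    have h3 : HasFDerivAt (fun x => ψ (((p.1, θ), 0), x))
        ((fderiv ℝ (fun y => fderiv ℝ φ y (θ, -θ)) p).comp (ContinuousLinearMap.inr ℝ _ _))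
        (p.1 + p.2) := by
      have hpe : (p.1, p.1 + p.2 - p.1) = p := by ext <;> simp
      have h4 : HasFDerivAt (fun y => fderiv ℝ φ y (θ, -θ))
          (fderiv ℝ (fun y => fderiv ℝ φ y (θ, -θ)) p) (p.1, p.1 + p.2 - p.1) := by
        rw [hpe]; exact ((hF.differentiable (by simp)) _).hasFDerivAt
      have h5 := h4.comp (p.1 + p.2) h2
      refine h5.congr_of_eventuallyEq (Eventually.of_forall fun x => ?_)
      exact hval x
    have h6 := congrArg (fun L => L v) (h1.unique h3)
    simp only [ContinuousLinearMap.comp_apply, ContinuousLinearMap.inr_apply] at h6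
    change fderiv ℝ ψ (((p.1, θ), 0), p.1 + p.2) (0, v) ≠ 0
    rw [h6]; exact hv
  obtain ⟨χ, hχ1, hχ2, hχ3, hχ4⟩ := exists_cutoff hK0 hU hK0U
  obtain ⟨W, hWo, hKW, hW1⟩ := mem_nhdsSet_iff_exists.1 hχ4
  obtain ⟨r, hr, hrW⟩ := hK0.exists_cthickening_subset_open hWo hKW
  refine ⟨r, hr, fun N => ?_⟩
  let a : (((E d × E d) × ℝ) × E d) → ℂ := fun z => (χ z : ℂ) *
    (m (z.1.1.1 + z.1.2 • z.1.1.2, z.2 - (z.1.1.1 + z.1.2 • z.1.1.2)) *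
      (starRingEnd ℂ) (m (z.1.1.1, z.2 - z.1.1.1)))
  have ha : ContDiff ℝ ∞ a := by
    refine (Complex.ofRealCLM.contDiff.comp hχ1).mul (ContDiff.mul ?_ ?_)
    · exact hms.comp (by fun_prop)
    · refine Complex.conjCLE.contDiff.comp (hms.comp (by fun_prop))
  have has : tsupport a ⊆ tsupport χ := by
    refine closure_mono ?_
    intro z hz
    simp only [a, Function.mem_support, ne_eq, mul_eq_zero, not_or] at hz
    simpa using hz.1
  have hac : HasCompactSupport a := hχ2.mono' ((subset_tsupport _).trans has)
  obtain ⟨C, hC⟩ := nsp (volume : Measure (E d)) ψ hψ N a ha hac (fun z hz => hχ3 (has hz))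
  refine ⟨C, fun lam η η' hle hne => ?_⟩
  have hpos : 0 < ‖η' - η‖ := norm_pos_iff.2 (sub_ne_zero.2 hne)
  set t := ‖η' - η‖ with ht
  let θ : E d := t⁻¹ • (η' - η)
  have htθ : η + t • θ = η' := by
    simp only [θ, smul_smul, mul_inv_cancel₀ hpos.ne', one_smul]; abel
  have hθ1 : θ ∈ Metric.sphere (0 : E d) 1 := by
    simp only [mem_sphere_iff_norm, sub_zero, θ, norm_smul, norm_inv, Real.norm_eq_abs,
      abs_of_pos hpos]
    exact inv_mul_cancel₀ hpos.ne'
  have hKa : hK m φ lam η η' =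
      ∫ ζ, Complex.exp (I * (((lam * t) * ψ (((η, θ), t), ζ) : ℝ) : ℂ)) * a (((η, θ), t), ζ) := by
    unfold hK
    refine integral_congr_ae (Eventually.of_forall fun ζ => ?_)
    simp only
    rw [mul_assoc lam t, hquot, htθ]
    congr 1
    simp only [a]
    rw [htθ]
    by_cases hp : (η, ζ - η) ∈ tsupport m
    · have : χ (((η, θ), t), ζ) = 1 := by
        apply hW1
        apply hrW
        refine Metric.mem_cthickening_of_dist_le _ (((η, θ), 0), ζ) _ _ ?_ ?_
        · exact ⟨((η, ζ - η), θ), ⟨hp, hθ1⟩, by simp [κ]⟩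
        · simp [Prod.dist_eq, abs_of_pos hpos, hle, hr.le]
      simp [this]
    · simp [image_eq_zero_of_notMem_tsupport hp]
  rw [hKa]
  have := hC ((η, θ), t) (lam * t)
  rwa [abs_mul, abs_of_pos hpos] at this

end

section
open MeasureTheory Filter Complex SchwartzMap
open scoped RealInnerProductSpace ENNReal

open scoped ContDiff Topology

lemma TTstar {d : ℕ} (F : E d × E d → ℂ) (hF : Continuous F) (hFc : HasCompactSupport F)
    (h : E d → ℂ) (hh : Measurable h) (M : ℝ) (hM : ∀ x, ‖h x‖ ≤ M) :
    ∫⁻ ζ, ‖∫ η, F (ζ, η) * h η‖ₑ ^ 2 ≤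
      ∫⁻ η, ∫⁻ η', ‖h η‖ₑ * ‖h η'‖ₑ * ‖∫ ζ, F (ζ, η') * (starRingEnd ℂ) (F (ζ, η))‖ₑ := by
  let G0 : E d × (E d × E d) → ℂ := fun w => (F (w.1, w.2.2) * (starRingEnd ℂ) (F (w.1, w.2.1)))
  let G : E d × (E d × E d) → ℂ := fun w => G0 w * (h w.2.2 * (starRingEnd ℂ) (h w.2.1))
  have hG0 : Continuous G0 := by
    have := Complex.continuous_conj
    fun_prop
  have hG0c : HasCompactSupport G0 := by
    let K := tsupport F
    have hK : IsCompact K := hFc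
    refine HasCompactSupport.of_support_subset_isCompact
      (K := (Prod.fst '' K) ×ˢ ((Prod.snd '' K) ×ˢ (Prod.snd '' K)))
      ((hK.image continuous_fst).prod ((hK.image continuous_snd).prod (hK.image continuous_snd))) ?_
    intro w hw
    have h1 : F (w.1, w.2.2) ≠ 0 := fun h0 => hw (by simp [G0, h0])
    have h2 : F (w.1, w.2.1) ≠ 0 := fun h0 => hw (by simp [G0, h0])
    have h1' := subset_tsupport F h1
    have h2' := subset_tsupport F h2
    exact ⟨⟨_, h1', rfl⟩, ⟨_, h2', rfl⟩, ⟨_, h1', rfl⟩⟩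
  have hvol2 : (volume : Measure (E d × E d)).IsAddHaarMeasure := by
    rw [Measure.volume_eq_prod]; infer_instance
  have hG0i : Integrable G0 ((volume : Measure (E d)).prod volume) :=
    hG0.integrable_of_hasCompactSupport hG0c
  have hGi : Integrable G ((volume : Measure (E d)).prod (volume : Measure (E d × E d))) := by
    refine hG0i.mul_bdd (c := M * M) ?_ ?_
    · have := Complex.continuous_conj.measurable
      exact Measurable.aestronglyMeasurable (by fun_prop)
    · refine Eventually.of_forall fun w => ?_
      rw [norm_mul, RCLike.norm_conj]
      exact mul_le_mul (hM _) (hM _) (norm_nonneg _) ((norm_nonneg _).trans (hM 0))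
  have hsq : ∀ ζ, ((‖∫ η, F (ζ, η) * h η‖ ^ 2 : ℝ) : ℂ) = ∫ p, G (ζ, p) := by
    intro ζ
    have e1 : ∀ p : E d × E d, G (ζ, p) =
        ((starRingEnd ℂ) (F (ζ, p.1) * h p.1)) * (F (ζ, p.2) * h p.2) := by
      intro p; simp only [G, G0, map_mul]; ring
    simp_rw [e1]
    rw [Measure.volume_eq_prod]
    rw [integral_prod_mul (fun x => (starRingEnd ℂ) (F (ζ, x) * h x)) (fun x => F (ζ, x) * h x)]
    rw [integral_conj]
    rw [mul_comm, Complex.mul_conj, Complex.normSq_eq_norm_sq]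
  have hi : Integrable (fun ζ => ((‖∫ η, F (ζ, η) * h η‖ ^ 2 : ℝ) : ℂ)) := by
    simp_rw [hsq]
    exact hGi.integral_prod_left
  have hi' : Integrable (fun ζ => ‖∫ η, F (ζ, η) * h η‖ ^ 2) := by
    have := hi.norm
    simpa using this
  have e2 : ∫⁻ ζ, ‖∫ η, F (ζ, η) * h η‖ₑ ^ 2 = ‖∫ ζ, ∫ p, G (ζ, p)‖ₑ := by
    simp_rw [← hsq]
    rw [integral_complex_ofReal]
    have : ∀ x : ℝ, 0 ≤ x → ‖(x:ℂ)‖ₑ = ENNReal.ofReal x := by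
      intro x hx
      rw [← ofReal_norm]; simp [abs_of_nonneg hx]
    rw [this _ (integral_nonneg fun _ => by positivity)]
    rw [ofReal_integral_eq_lintegral_ofReal hi' (Eventually.of_forall fun _ => by positivity)]
    refine lintegral_congr fun ζ => ?_
    rw [ENNReal.ofReal_pow (norm_nonneg _), ofReal_norm]
  rw [e2]
  have e3 : ∫ ζ, ∫ p, G (ζ, p) = ∫ p, ∫ ζ, G (ζ, p) :=
    integral_integral_swap (f := fun ζ p => G (ζ, p)) hGi
  rw [e3]
  refine (enorm_integral_le_lintegral_enorm _).trans ?_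
  have e4 : ∀ p : E d × E d, ‖∫ ζ, G (ζ, p)‖ₑ =
    ‖h p.1‖ₑ * ‖h p.2‖ₑ * ‖∫ ζ, F (ζ, p.2) * (starRingEnd ℂ) (F (ζ, p.1))‖ₑ := by
    intro p
    simp only [G, G0]
    rw [integral_mul_const, enorm_mul, enorm_mul, RCLike.enorm_conj]
    ring
  have hm : AEMeasurable (fun p => ‖∫ ζ, G (ζ, p)‖ₑ) (volume.prod volume : Measure (E d × E d)) :=
    (hGi.integral_prod_right).aestronglyMeasurable.enorm
  rw [Measure.volume_eq_prod, lintegral_prod _ hm]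
  simp_rw [e4]
  exact le_rfl

lemma mul_le_sq_add_sq (x y : ℝ≥0∞) : x * y ≤ x ^ 2 + y ^ 2 := by
  rcases le_total x y with h | h
  · calc x * y ≤ y * y := by gcongr
      _ = y ^ 2 := by ring
      _ ≤ _ := le_add_self
  · calc x * y ≤ x * x := by gcongr
      _ = x ^ 2 := by ring
      _ ≤ _ := le_self_add

lemma schur {d : ℕ} (h : E d → ℂ) (hh : Measurable h) (H : E d → E d → ℂ)
    (k : E d → ℝ≥0∞) (hk : Measurable k)
    (hH : ∀ x y, h x ≠ 0 → h y ≠ 0 → ‖H x y‖ₑ ≤ k (y - x)) :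
    ∫⁻ x, ∫⁻ y, ‖h x‖ₑ * ‖h y‖ₑ * ‖H x y‖ₑ ≤ 2 * (∫⁻ z, k z) * ∫⁻ x, ‖h x‖ₑ ^ 2 := by
  calc ∫⁻ x, ∫⁻ y, ‖h x‖ₑ * ‖h y‖ₑ * ‖H x y‖ₑ
      ≤ ∫⁻ x, ∫⁻ y, (‖h x‖ₑ ^ 2 * k (y - x) + ‖h y‖ₑ ^ 2 * k (y - x)) := by
        refine lintegral_mono fun x => lintegral_mono fun y => ?_
        by_cases hx : h x = 0
        · simp [hx]
        by_cases hy : h y = 0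
        · simp [hy]
        calc _ ≤ (‖h x‖ₑ ^ 2 + ‖h y‖ₑ ^ 2) * k (y - x) := by
              gcongr
              · exact mul_le_sq_add_sq _ _
              · exact hH x y hx hy
          _ = _ := by ring
    _ = ∫⁻ x, ((∫⁻ y, ‖h x‖ₑ ^ 2 * k (y - x)) + ∫⁻ y, ‖h y‖ₑ ^ 2 * k (y - x)) := by
        refine lintegral_congr fun x => ?_
        rw [lintegral_add_left (by fun_prop)]
    _ = (∫⁻ x, ∫⁻ y, ‖h x‖ₑ ^ 2 * k (y - x)) + ∫⁻ x, ∫⁻ y, ‖h y‖ₑ ^ 2 * k (y - x) := by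
        rw [lintegral_add_left]
        exact Measurable.lintegral_prod_right (f := fun x y : E d => ‖h x‖ₑ ^ 2 * k (y - x))
          (by unfold Function.uncurry; fun_prop)
    _ = _ := by
        have e1 : ∫⁻ x, ∫⁻ y, ‖h x‖ₑ ^ 2 * k (y - x) = (∫⁻ z, k z) * ∫⁻ x, ‖h x‖ₑ ^ 2 := by
          rw [← lintegral_const_mul _ (by fun_prop)]
          refine lintegral_congr fun x => ?_
          rw [lintegral_const_mul _ (by fun_prop), lintegral_sub_right_eq_self k x, mul_comm]
        have e2 : ∫⁻ x, ∫⁻ y, ‖h y‖ₑ ^ 2 * k (y - x) = (∫⁻ z, k z) * ∫⁻ x, ‖h x‖ₑ ^ 2 := by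
          rw [lintegral_lintegral_swap (Measurable.aemeasurable (by unfold Function.uncurry; fun_prop))]
          rw [← lintegral_const_mul _ (by fun_prop)]
          refine lintegral_congr fun x => ?_
          rw [lintegral_const_mul _ (by fun_prop), lintegral_sub_left_eq_self k x, mul_comm]
        rw [e1, e2]; ring

lemma lint_weight {d : ℕ} : ∃ A : ℝ, 0 ≤ A ∧ ∀ L : ℝ, 0 < L →
    ∫⁻ x : E d, ENNReal.ofReal ((1 + L * ‖x‖) ^ (-((d + 1 : ℕ) : ℝ))) ≤
      ENNReal.ofReal (A * L ^ (-(d : ℝ))) := by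
  have hint : Integrable (fun x : E d => (1 + ‖x‖) ^ (-((d + 1 : ℕ) : ℝ))) := by
    apply integrable_one_add_norm
    simp
  refine ⟨∫ x : E d, (1 + ‖x‖) ^ (-((d + 1 : ℕ) : ℝ)), integral_nonneg fun _ => by positivity, ?_⟩
  intro L hL
  have hint' : Integrable (fun x : E d => (1 + ‖L • x‖) ^ (-((d + 1 : ℕ) : ℝ))) :=
    hint.comp_smul hL.ne'
  have e : ∀ x : E d, (1 + L * ‖x‖) = 1 + ‖L • x‖ := by
    intro x; rw [norm_smul, Real.norm_eq_abs, abs_of_pos hL]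
  simp_rw [e]
  rw [← ofReal_integral_eq_lintegral_ofReal hint' (Eventually.of_forall fun _ => by positivity)]
  rw [Measure.integral_comp_smul volume (fun x : E d => (1 + ‖x‖) ^ (-((d + 1 : ℕ) : ℝ))) L]
  refine ENNReal.ofReal_le_ofReal (le_of_eq ?_)
  rw [smul_eq_mul, mul_comm, finrank_euclideanSpace_fin, abs_of_pos (by positivity),
    Real.rpow_neg hL.le, Real.rpow_natCast]

/-- frequency-side kernel -/
def fK {d : ℕ} (m : E d × E d → ℂ) (φ : E d × E d → ℝ) (lam : ℝ) (w : E d × E d) : ℂ :=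
  Complex.exp (I * ((lam * φ (w.2, w.1 - w.2) : ℝ) : ℂ)) * m (w.2, w.1 - w.2)

lemma fK_cont {d : ℕ} (m : E d × E d → ℂ) (φ : E d × E d → ℝ) (lam : ℝ)
    (hφ : Continuous φ) (hm : Continuous m) : Continuous (fK m φ lam) := by
  unfold fK; fun_prop

lemma fK_comp {d : ℕ} (m : E d × E d → ℂ) (φ : E d × E d → ℝ) (lam : ℝ)
    (hmc : HasCompactSupport m) : HasCompactSupport (fK m φ lam) := by
  refine HasCompactSupport.of_support_subset_isCompact
    (K := (fun p : E d × E d => (p.1 + p.2, p.1)) '' tsupport m)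
    (hmc.isCompact.image (by fun_prop)) ?_
  intro w hw
  have : m (w.2, w.1 - w.2) ≠ 0 := fun h0 => hw (by simp [fK, h0])
  exact ⟨_, subset_tsupport m this, by ext <;> simp⟩

lemma fK_hK {d : ℕ} (m : E d × E d → ℂ) (φ : E d × E d → ℝ) (lam : ℝ) (η η' : E d) :
    ∫ ζ, fK m φ lam (ζ, η') * (starRingEnd ℂ) (fK m φ lam (ζ, η)) = hK m φ lam η η' := by
  unfold hK fK
  refine integral_congr_ae (Eventually.of_forall fun ζ => ?_)
  simp only [map_mul, ← Complex.exp_conj, Complex.conj_I, Complex.conj_ofReal]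
  rw [show ((lam * (φ (η', ζ - η') - φ (η, ζ - η)) : ℝ) : ℂ) =
    ((lam * φ (η', ζ - η') : ℝ) : ℂ) - ((lam * φ (η, ζ - η) : ℝ) : ℂ) by push_cast; ring]
  rw [mul_sub, sub_eq_add_neg (I * _) (I * _), Complex.exp_add, neg_mul]
  ring

lemma hormander_local {d : ℕ} (φ : E d × E d → ℝ) (m : E d × E d → ℂ)
    (hφs : ContDiff ℝ ∞ φ) (hms : ContDiff ℝ ∞ m) (hmc : HasCompactSupport m)
    (hmat : ∀ p ∈ tsupport m, (derMat φ p xiV (fun j => etaV j - xiV j)).det ≠ 0) :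
    ∃ r : ℝ, 0 < r ∧ ∃ C : ℝ, 0 ≤ C ∧ ∀ (lam : ℝ), lam ≠ 0 → ∀ (h : E d → ℂ), Measurable h →
      (∃ M : ℝ, ∀ x, ‖h x‖ ≤ M) → (∀ x y, h x ≠ 0 → h y ≠ 0 → ‖y - x‖ ≤ r) →
      ∫⁻ ζ, ‖∫ η, fK m φ lam (ζ, η) * h η‖ₑ ^ 2 ≤
        ENNReal.ofReal (C * |lam| ^ (-(d : ℝ))) * ∫⁻ x, ‖h x‖ₑ ^ 2 := by
  obtain ⟨B, hB⟩ := hK_bound m φ hms.continuous hmc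
  obtain ⟨r, hr, hdec⟩ := hK_decay φ m hφs hms hmc hmat
  obtain ⟨C1, hC1⟩ := hdec (d + 1)
  obtain ⟨A, hA, hAL⟩ := lint_weight (d := d)
  have hB0 : 0 ≤ B := (norm_nonneg _).trans (hB 0 0 0)
  set D : ℝ := 2 ^ (d + 1) * (B + |C1|) with hD
  have hD0 : 0 ≤ D := by positivity
  refine ⟨r, hr, 2 * (D * A), by positivity, ?_⟩
  intro lam hlam h hh ⟨M, hM⟩ hsupp
  have hL : 0 < |lam| := abs_pos.mpr hlam
  have hker : ∀ x y : E d, ‖y - x‖ ≤ r →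
      ‖hK m φ lam x y‖ ≤ D * (1 + |lam| * ‖y - x‖) ^ (-((d + 1 : ℕ) : ℝ)) := by
    intro x y hxy
    rw [Real.rpow_neg (by positivity), Real.rpow_natCast, ← div_eq_mul_inv,
      le_div_iff₀ (by positivity)]
    set s := |lam| * ‖y - x‖ with hs
    have hs0 : 0 ≤ s := by positivity
    have h2 : s ^ (d + 1) * ‖hK m φ lam x y‖ ≤ |C1| := by
      by_cases hne : y = x
      · simp [hs, hne]
      · exact (hC1 lam x y hxy hne).trans (le_abs_self _)
    have h3 : (1 + s) ^ (d + 1) ≤ 2 ^ (d + 1) * (1 + s ^ (d + 1)) := by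
      rcases le_total s 1 with h1 | h1
      · calc (1 + s) ^ (d + 1) ≤ 2 ^ (d + 1) := by gcongr; linarith
          _ ≤ _ := by
            have : 0 ≤ s ^ (d + 1) := by positivity
            nlinarith [show (0:ℝ) < 2 ^ (d + 1) by positivity]
      · calc (1 + s) ^ (d + 1) ≤ (2 * s) ^ (d + 1) := by gcongr; linarith
          _ = 2 ^ (d + 1) * s ^ (d + 1) := mul_pow _ _ _
          _ ≤ _ := by gcongr; linarith
    calc ‖hK m φ lam x y‖ * (1 + s) ^ (d + 1)
        ≤ ‖hK m φ lam x y‖ * (2 ^ (d + 1) * (1 + s ^ (d + 1))) := by gcongr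
      _ = 2 ^ (d + 1) * (‖hK m φ lam x y‖ + s ^ (d + 1) * ‖hK m φ lam x y‖) := by ring
      _ ≤ D := by rw [hD]; gcongr; exact hB _ _ _
  refine (TTstar _ (fK_cont m φ lam hφs.continuous hms.continuous) (fK_comp m φ lam hmc) h hh M hM).trans ?_
  simp_rw [fK_hK]
  refine (schur h hh (hK m φ lam)
    (fun z => ENNReal.ofReal (D * (1 + |lam| * ‖z‖) ^ (-((d + 1 : ℕ) : ℝ)))) (by fun_prop) ?_).trans ?_
  · intro x y hx hy
    rw [← ofReal_norm]
    exact ENNReal.ofReal_le_ofReal (hker x y (hsupp x y hx hy))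
  · gcongr
    simp_rw [ENNReal.ofReal_mul hD0]
    rw [lintegral_const_mul _ (by fun_prop)]
    calc 2 * (ENNReal.ofReal D * ∫⁻ x : E d, ENNReal.ofReal ((1 + |lam| * ‖x‖) ^ (-((d + 1 : ℕ) : ℝ))))
        ≤ 2 * (ENNReal.ofReal D * ENNReal.ofReal (A * |lam| ^ (-(d : ℝ)))) := by
          gcongr; exact hAL _ hL
      _ = _ := by
          rw [← ENNReal.ofReal_mul hD0, show (2 : ℝ≥0∞) = ENNReal.ofReal 2 by simp,
            ← ENNReal.ofReal_mul (by norm_num)]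
          congr 1; ring

lemma add_sq_le_enn (x y : ℝ≥0∞) : (x + y) ^ 2 ≤ 4 * (x ^ 2 + y ^ 2) := by
  rcases le_total x y with h | h
  · calc (x + y) ^ 2 ≤ (y + y) ^ 2 := by gcongr
      _ = 4 * y ^ 2 := by ring
      _ ≤ _ := by gcongr; exact le_add_self
  · calc (x + y) ^ 2 ≤ (x + x) ^ 2 := by gcongr
      _ = 4 * x ^ 2 := by ring
      _ ≤ _ := by gcongr; exact le_self_add

lemma fK_integrable {d : ℕ} (φ : E d × E d → ℝ) (m : E d × E d → ℂ)
    (hφ : Continuous φ) (hm : Continuous m) (hmc : HasCompactSupport m) (lam : ℝ) (ζ : E d) :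
    Integrable (fun η => fK m φ lam (ζ, η)) := by
  refine Continuous.integrable_of_hasCompactSupport
    ((fK_cont m φ lam hφ hm).comp (by fun_prop)) ?_
  refine HasCompactSupport.of_support_subset_isCompact
    (K := Prod.snd '' tsupport (fK m φ lam))
    ((fK_comp m φ lam hmc).isCompact.image continuous_snd) ?_
  intro η hη
  exact ⟨(ζ, η), subset_tsupport _ hη, rfl⟩

lemma hormander {d : ℕ} (φ : E d × E d → ℝ) (m : E d × E d → ℂ)
    (hφs : ContDiff ℝ ∞ φ) (hms : ContDiff ℝ ∞ m) (hmc : HasCompactSupport m)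
    (hmat : ∀ p ∈ tsupport m, (derMat φ p xiV (fun j => etaV j - xiV j)).det ≠ 0) :
    ∃ C : ℝ, 0 ≤ C ∧ ∀ (lam : ℝ), lam ≠ 0 → ∀ (h : E d → ℂ), Measurable h →
      (∃ M : ℝ, ∀ x, ‖h x‖ ≤ M) →
      ∫⁻ ζ, ‖∫ η, fK m φ lam (ζ, η) * h η‖ₑ ^ 2 ≤
        ENNReal.ofReal (C * |lam| ^ (-(d : ℝ))) * ∫⁻ x, ‖h x‖ₑ ^ 2 := by
  obtain ⟨r, hr, C, hC, hloc⟩ := hormander_local φ m hφs hms hmc hmat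
  have hK1 : IsCompact (Prod.fst '' tsupport m) := hmc.isCompact.image continuous_fst
  obtain ⟨t, ht, hcov⟩ := hK1.elim_nhds_subcover (fun x => Metric.ball x (r/2))
    (fun x _ => Metric.ball_mem_nhds x (by positivity))
  -- induction over finite covers
  have key : ∀ t : Finset (E d), ∃ C : ℝ, 0 ≤ C ∧ ∀ (lam : ℝ), lam ≠ 0 → ∀ (h : E d → ℂ),
      Measurable h → (∃ M : ℝ, ∀ x, ‖h x‖ ≤ M) →
      (∀ x, h x ≠ 0 → x ∈ ⋃ c ∈ t, Metric.ball c (r/2)) →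
      ∫⁻ ζ, ‖∫ η, fK m φ lam (ζ, η) * h η‖ₑ ^ 2 ≤
        ENNReal.ofReal (C * |lam| ^ (-(d : ℝ))) * ∫⁻ x, ‖h x‖ₑ ^ 2 := by
    classical
    intro t
    induction t using Finset.induction_on with
    | empty =>
      refine ⟨0, le_rfl, fun lam _ h _ _ hs => ?_⟩
      have : h = 0 := by
        funext x; by_contra hx; simpa using hs x hx
      subst this; simp
    | insert c t hct ih =>
      obtain ⟨C2, hC2, ih⟩ := ih
      refine ⟨4 * (C + C2), by positivity, fun lam hlam h hh ⟨M, hM⟩ hs => ?_⟩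
      set b := Metric.ball c (r/2) with hb
      have hbm : MeasurableSet b := Metric.isOpen_ball.measurableSet
      set h1 := b.indicator h with hh1
      set h2 := bᶜ.indicator h with hh2
      have hsum : ∀ x, h x = h1 x + h2 x := by
        intro x; simp only [hh1, hh2]
        exact (congrFun (Set.indicator_self_add_compl b h) x).symm
      have h1m : Measurable h1 := hh.indicator hbm
      have h2m : Measurable h2 := hh.indicator hbm.compl
      have n1 : ∀ x, ‖h1 x‖ ≤ ‖h x‖ := fun x => norm_indicator_le_norm_self _ _
      have n2 : ∀ x, ‖h2 x‖ ≤ ‖h x‖ := fun x => norm_indicator_le_norm_self _ _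
      have b1 := hloc lam hlam h1 h1m ⟨M, fun x => (n1 x).trans (hM x)⟩ (by
        intro x y hx hy
        have hx' : x ∈ b := Set.mem_of_indicator_ne_zero hx
        have hy' : y ∈ b := Set.mem_of_indicator_ne_zero hy
        rw [hb, Metric.mem_ball] at hx' hy'
        rw [← dist_eq_norm]
        linarith [dist_triangle_right y x c])
      have b2 := ih lam hlam h2 h2m ⟨M, fun x => (n2 x).trans (hM x)⟩ (by
        intro x hx
        have hx' : x ∈ bᶜ := Set.mem_of_indicator_ne_zero hx
        have hx2 : h x ≠ 0 := fun h0 => hx (by simp [hh2, Set.indicator, h0])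
        have := hs x hx2
        rw [Finset.set_biUnion_insert] at this
        exact this.resolve_left hx')
      have e1 : ∫⁻ x, ‖h1 x‖ₑ ^ 2 ≤ ∫⁻ x, ‖h x‖ₑ ^ 2 := by
        refine lintegral_mono fun x => ?_
        gcongr
        exact enorm_le_iff_norm_le.mpr (n1 x)
      have e2 : ∫⁻ x, ‖h2 x‖ₑ ^ 2 ≤ ∫⁻ x, ‖h x‖ₑ ^ 2 := by
        refine lintegral_mono fun x => ?_
        gcongr
        exact enorm_le_iff_norm_le.mpr (n2 x)
      have hfi := fK_integrable φ m hφs.continuous hms.continuous hmc lam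
      have i1 : ∀ ζ, Integrable (fun η => fK m φ lam (ζ, η) * h1 η) := fun ζ =>
        (hfi ζ).mul_bdd h1m.aestronglyMeasurable
          (Eventually.of_forall fun x => (n1 x).trans (hM x))
      have i2 : ∀ ζ, Integrable (fun η => fK m φ lam (ζ, η) * h2 η) := fun ζ =>
        (hfi ζ).mul_bdd h2m.aestronglyMeasurable
          (Eventually.of_forall fun x => (n2 x).trans (hM x))
      have es : ∀ ζ, ∫ η, fK m φ lam (ζ, η) * h η = (∫ η, fK m φ lam (ζ, η) * h1 η) +
          ∫ η, fK m φ lam (ζ, η) * h2 η := by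
        intro ζ
        rw [← integral_add (i1 ζ) (i2 ζ)]
        congr 1; funext η; rw [hsum η]; ring
      have hmeas : Measurable fun ζ => ‖∫ η, fK m φ lam (ζ, η) * h1 η‖ₑ ^ 2 := by
        have : StronglyMeasurable (fun ζ => ∫ η, fK m φ lam (ζ, η) * h1 η) := by
          refine StronglyMeasurable.integral_prod_right (f := fun ζ η => fK m φ lam (ζ, η) * h1 η) ?_
          exact ((fK_cont m φ lam hφs.continuous hms.continuous).measurable.mul
            (h1m.comp measurable_snd)).stronglyMeasurable
        exact this.measurable.enorm.pow_const 2
      calc ∫⁻ ζ, ‖∫ η, fK m φ lam (ζ, η) * h η‖ₑ ^ 2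
          ≤ ∫⁻ ζ, 4 * (‖∫ η, fK m φ lam (ζ, η) * h1 η‖ₑ ^ 2 + ‖∫ η, fK m φ lam (ζ, η) * h2 η‖ₑ ^ 2) := by
            refine lintegral_mono fun ζ => ?_
            rw [es ζ]
            refine le_trans ?_ (add_sq_le_enn _ _)
            gcongr
            exact enorm_add_le _ _
        _ = 4 * ((∫⁻ ζ, ‖∫ η, fK m φ lam (ζ, η) * h1 η‖ₑ ^ 2) +
              ∫⁻ ζ, ‖∫ η, fK m φ lam (ζ, η) * h2 η‖ₑ ^ 2) := by
            rw [lintegral_const_mul' _ _ (by simp), lintegral_add_left hmeas]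
        _ ≤ 4 * ((ENNReal.ofReal (C * |lam| ^ (-(d : ℝ))) * ∫⁻ x, ‖h x‖ₑ ^ 2) +
              ENNReal.ofReal (C2 * |lam| ^ (-(d : ℝ))) * ∫⁻ x, ‖h x‖ₑ ^ 2) := by
            gcongr
            · exact b1.trans (by gcongr)
            · exact b2.trans (by gcongr)
        _ = _ := by
            have hp : 0 ≤ |lam| ^ (-(d : ℝ)) := by positivity
            rw [mul_assoc 4 (C + C2), ENNReal.ofReal_mul (by norm_num : (0:ℝ) ≤ 4), add_mul C,
              ENNReal.ofReal_add (by positivity) (by positivity)]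
            simp only [ENNReal.ofReal_ofNat]
            ring
  obtain ⟨C', hC', hk⟩ := key t
  refine ⟨C', hC', fun lam hlam h hh ⟨M, hM⟩ => ?_⟩
  set K := ⋃ c ∈ t, Metric.ball c (r/2) with hK
  have hKm : MeasurableSet K := (isOpen_biUnion fun _ _ => Metric.isOpen_ball).measurableSet
  have := hk lam hlam (K.indicator h) (hh.indicator hKm)
    ⟨M, fun x => (norm_indicator_le_norm_self _ _).trans (hM x)⟩
    (fun x hx => Set.mem_of_indicator_ne_zero hx)
  have e : ∀ ζ η, fK m φ lam (ζ, η) * K.indicator h η = fK m φ lam (ζ, η) * h η := by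
    intro ζ η
    by_cases hη : η ∈ K
    · rw [Set.indicator_of_mem hη]
    · have : m (η, ζ - η) = 0 := by
        by_contra h0
        exact hη (hcov ⟨_, subset_tsupport m h0, rfl⟩)
      simp [fK, this]
  simp_rw [e] at this
  refine this.trans ?_
  gcongr with x
  exact enorm_le_iff_norm_le.mpr (norm_indicator_le_norm_self _ _)

end

section
open MeasureTheory Filter Complex SchwartzMap
open scoped RealInnerProductSpace ENNReal

open scoped ContDiff Topology FourierTransform

/-- unnormalised Fourier transform -/
def FT0 {d : ℕ} (h : E d → ℂ) (η : E d) : ℂ :=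
  ∫ z : E d, Complex.exp (I * ((-⟪z, η⟫ : ℝ) : ℂ)) * h z

lemma FT0_cont {d : ℕ} (h : E d → ℂ) (h1 : Integrable h) : Continuous (FT0 h) := by
  unfold FT0
  refine continuous_of_dominated (bound := fun z => ‖h z‖) ?_ ?_ h1.norm ?_
  · intro η
    exact (Continuous.aestronglyMeasurable (by fun_prop)).mul h1.aestronglyMeasurable
  · intro η
    refine Eventually.of_forall fun z => ?_
    rw [norm_mul, norm_expI, one_mul]
  · refine Eventually.of_forall fun z => ?_
    fun_prop

lemma FT0_bound {d : ℕ} (h : E d → ℂ) (η : E d) : ‖FT0 h η‖ ≤ ∫ z, ‖h z‖ := by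
  refine (norm_integral_le_integral_norm _).trans (le_of_eq ?_)
  simp only [norm_mul, norm_expI, one_mul]

lemma eLpNorm_two_sq {d : ℕ} (f : E d → ℂ) :
    eLpNorm f 2 volume ^ 2 = ∫⁻ x, ‖f x‖ₑ ^ 2 := by
  have := eLpNorm_nnreal_pow_eq_lintegral (f := f) (μ := volume) (p := 2) (by norm_num)
  simpa using this

lemma FT0_plancherel {d : ℕ} : ∃ A : ℝ, 0 ≤ A ∧ ∀ h : E d → ℂ, Integrable h → MemLp h 2 →
    ∫⁻ η, ‖FT0 h η‖ₑ ^ 2 = ENNReal.ofReal A * ∫⁻ x, ‖h x‖ₑ ^ 2 := by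
  have hpi : ((2 * Real.pi)⁻¹ : ℝ) ≠ 0 := by positivity
  refine ⟨|(((2 * Real.pi)⁻¹ : ℝ) ^ Module.finrank ℝ (E d))⁻¹|, abs_nonneg _, fun h h1 h2 => ?_⟩
  have e : ∀ η, FT0 h η = 𝓕 h ((2 * Real.pi)⁻¹ • η) := by
    intro η
    rw [Real.fourier_eq']
    unfold FT0
    refine integral_congr_ae (Eventually.of_forall fun z => ?_)
    simp only [smul_eq_mul, inner_smul_right]
    congr 2
    rw [mul_comm]
    congr 2
    field_simp
  have hc : Continuous (𝓕 h) :=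
      VectorFourier.fourierIntegral_continuous Real.continuous_fourierChar
        (by exact continuous_inner) h1
  simp_rw [e]
  have hmap := Measure.map_addHaar_smul (volume : Measure (E d)) hpi
  have := lintegral_map (μ := (volume : Measure (E d))) (f := fun η => ‖𝓕 h η‖ₑ ^ 2)
    (g := fun η : E d => (2 * Real.pi)⁻¹ • η) (by fun_prop) (by fun_prop)
  rw [← this, hmap, lintegral_smul_measure, smul_eq_mul]
  congr 1
  rw [← eLpNorm_two_sq, ← eLpNorm_two_sq, fourier_L1L2_ae h h1 h2]

/-- the operator for a fixed translation -/
def Sop {d : ℕ} (m : E d × E d → ℂ) (φ : E d × E d → ℝ) (lam : ℝ) (y : E d) (h : E d → ℂ)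
    (x : E d) : ℂ :=
  ∫ z : E d, kerK m φ lam (x - z) (x - y) * h z

lemma Sop_eq1 {d : ℕ} (φ : E d × E d → ℝ) (m : E d × E d → ℂ)
    (hφ : Continuous φ) (hm : Continuous m) (hmc : HasCompactSupport m) (lam : ℝ) (y : E d)
    (h : E d → ℂ) (h1 : Integrable h) (x : E d) :
    Sop m φ lam y h x = ∫ p : E d × E d,
      Complex.exp (I * ((⟪x, p.1⟫ + ⟪x - y, p.2⟫ + lam * φ p : ℝ) : ℂ)) * m p * FT0 h p.1 := by
  have hvol2 : (volume : Measure (E d × E d)).IsAddHaarMeasure := by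
    rw [Measure.volume_eq_prod]; infer_instance
  have hmi : Integrable m := hm.integrable_of_hasCompactSupport hmc
  unfold Sop kerK FT0
  simp_rw [← integral_mul_const, ← integral_const_mul]
  rw [integral_integral_swap]
  · refine integral_congr_ae (Eventually.of_forall fun p => ?_)
    refine integral_congr_ae (Eventually.of_forall fun z => ?_)
    simp only
    have : ((⟪x - z, p.1⟫ + ⟪x - y, p.2⟫ + lam * φ p : ℝ) : ℂ) =
      ((⟪x, p.1⟫ + ⟪x - y, p.2⟫ + lam * φ p : ℝ) : ℂ) + ((-⟪z, p.1⟫ : ℝ) : ℂ) := by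
      rw [inner_sub_left]; push_cast; ring
    rw [this, mul_add, Complex.exp_add]
    ring
  · have hi : Integrable (fun w : E d × (E d × E d) => h w.1 * m w.2) (volume.prod volume) :=
      h1.mul_prod hmi
    have := hi.bdd_mul (c := 1) (f := fun w : E d × (E d × E d) =>
      Complex.exp (I * ((⟪x - w.1, w.2.1⟫ + ⟪x - y, w.2.2⟫ + lam * φ w.2 : ℝ) : ℂ)))
      (Continuous.aestronglyMeasurable (by fun_prop))
      (Eventually.of_forall fun w => (norm_expI _).le)
    refine this.congr (Eventually.of_forall fun w => ?_)
    simp only [Function.uncurry]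
    ring

lemma shear_integral {d : ℕ} (F : E d × E d → ℂ) (hF : Continuous F) (hFc : HasCompactSupport F) :
    ∫ p, F p = ∫ ζ, ∫ η, F (η, ζ - η) := by
  have hFi : Integrable F (volume.prod volume) := hF.integrable_of_hasCompactSupport hFc
  rw [Measure.volume_eq_prod, integral_prod _ hFi]
  have : ∀ η : E d, ∫ ξ, F (η, ξ) = ∫ ζ, F (η, ζ - η) := fun η =>
    (integral_sub_right_eq_self (fun ξ => F (η, ξ)) η).symm
  simp_rw [this]
  rw [integral_integral_swap]
  refine Continuous.integrable_of_hasCompactSupport ?_ ?_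
  · unfold Function.uncurry; fun_prop
  · refine HasCompactSupport.of_support_subset_isCompact
      (K := (fun p : E d × E d => (p.1, p.1 + p.2)) '' tsupport F)
      (hFc.isCompact.image (by fun_prop)) ?_
    intro w hw
    exact ⟨_, subset_tsupport F hw, by ext <;> simp⟩

lemma Tfreq_cont {d : ℕ} (φ : E d × E d → ℝ) (m : E d × E d → ℂ)
    (hφ : Continuous φ) (hm : Continuous m) (hmc : HasCompactSupport m) (lam : ℝ)
    (h : E d → ℂ) (hh : Continuous h) :
    Continuous (fun ζ => ∫ η, fK m φ lam (ζ, η) * h η) ∧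
    HasCompactSupport (fun ζ => ∫ η, fK m φ lam (ζ, η) * h η) := by
  have hc := fK_comp m φ lam hmc
  have hcont := fK_cont m φ lam hφ hm
  constructor
  · have hK : IsCompact (Prod.snd '' tsupport (fK m φ lam)) := hc.isCompact.image continuous_snd
    have := continuous_parametric_integral_of_continuous (μ := (volume : Measure (E d)))
      (f := fun ζ η => fK m φ lam (ζ, η) * h η) (by unfold Function.uncurry; fun_prop) hK
    convert this using 2 with ζ
    rw [setIntegral_eq_integral_of_forall_compl_eq_zero]
    intro η hη
    have : fK m φ lam (ζ, η) = 0 := by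
      by_contra h0
      exact hη ⟨_, subset_tsupport _ h0, rfl⟩
    simp [this]
  · refine HasCompactSupport.of_support_subset_isCompact
      (K := Prod.fst '' tsupport (fK m φ lam)) (hc.isCompact.image continuous_fst) ?_
    intro ζ hζ
    by_contra h0
    apply hζ
    have : ∀ η, fK m φ lam (ζ, η) * h η = 0 := by
      intro η
      have : fK m φ lam (ζ, η) = 0 := by
        by_contra h1
        exact h0 ⟨_, subset_tsupport _ h1, rfl⟩
      simp [this]
    simp [this]

lemma Sop_eq2 {d : ℕ} (φ : E d × E d → ℝ) (m : E d × E d → ℂ)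
    (hφ : Continuous φ) (hm : Continuous m) (hmc : HasCompactSupport m) (lam : ℝ) (y : E d)
    (h : E d → ℂ) (h1 : Integrable h) (x : E d) :
    Sop m φ lam y h x = FT0 (fun ζ => ∫ η, fK m φ lam (ζ, η) *
      (Complex.exp (I * ((⟪y, η⟫ : ℝ) : ℂ)) * FT0 h η)) (y - x) := by
  have hcF := FT0_cont h h1
  rw [Sop_eq1 φ m hφ hm hmc lam y h h1 x, shear_integral]
  · unfold FT0
    refine integral_congr_ae (Eventually.of_forall fun ζ => ?_)
    simp only
    rw [← integral_const_mul]
    refine integral_congr_ae (Eventually.of_forall fun η => ?_)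
    simp only [fK]
    have : ((⟪x, η⟫ + ⟪x - y, ζ - η⟫ + lam * φ (η, ζ - η) : ℝ) : ℂ) =
      ((-⟪ζ, y - x⟫ : ℝ) : ℂ) + ((lam * φ (η, ζ - η) : ℝ) : ℂ) + ((⟪y, η⟫ : ℝ) : ℂ) := by
      rw [real_inner_comm (y - x) ζ, inner_sub_right, inner_sub_left, inner_sub_left, inner_sub_left]
      push_cast; ring
    rw [this, mul_add, mul_add, Complex.exp_add, Complex.exp_add]
    ring
  · fun_prop
  · refine HasCompactSupport.of_support_subset_isCompact hmc.isCompact ?_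
    intro p hp
    refine subset_tsupport m ?_
    intro h0
    apply hp
    simp [h0]

lemma Sop_L2 {d : ℕ} (φ : E d × E d → ℝ) (m : E d × E d → ℂ)
    (hφs : ContDiff ℝ ∞ φ) (hms : ContDiff ℝ ∞ m) (hmc : HasCompactSupport m)
    (hmat : ∀ p ∈ tsupport m, (derMat φ p xiV (fun j => etaV j - xiV j)).det ≠ 0) :
    ∃ C : ℝ, 0 ≤ C ∧ ∀ (lam : ℝ), lam ≠ 0 → ∀ (y : E d) (h : E d → ℂ), Integrable h → MemLp h 2 →
      ∫⁻ x, ‖Sop m φ lam y h x‖ₑ ^ 2 ≤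
        ENNReal.ofReal (C * |lam| ^ (-(d : ℝ))) * ∫⁻ x, ‖h x‖ₑ ^ 2 := by
  obtain ⟨C, hC, hH⟩ := hormander φ m hφs hms hmc hmat
  obtain ⟨A, hA, hP⟩ := FT0_plancherel (d := d)
  refine ⟨A * C * A, by positivity, fun lam hlam y h h1 h2 => ?_⟩
  have hcF := FT0_cont h h1
  set h' : E d → ℂ := fun η => Complex.exp (I * ((⟪y, η⟫ : ℝ) : ℂ)) * FT0 h η with hh'
  have hc' : Continuous h' := by fun_prop
  obtain ⟨gc, gs⟩ := Tfreq_cont φ m hφs.continuous hms.continuous hmc lam h' hc'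
  simp_rw [Sop_eq2 φ m hφs.continuous hms.continuous hmc lam y h h1]
  rw [lintegral_sub_left_eq_self (fun w => ‖FT0 (fun ζ => ∫ η, fK m φ lam (ζ, η) * h' η) w‖ₑ ^ 2) y]
  rw [hP _ (gc.integrable_of_hasCompactSupport gs) (gc.memLp_of_hasCompactSupport gs)]
  have hn : ∀ η, ‖h' η‖ = ‖FT0 h η‖ := fun η => by rw [hh']; simp only [norm_mul, norm_expI, one_mul]
  have b := hH lam hlam h' hc'.measurable ⟨_, fun x => (hn x).le.trans (FT0_bound h x)⟩
  have e : ∫⁻ x, ‖h' x‖ₑ ^ 2 = ENNReal.ofReal A * ∫⁻ x, ‖h x‖ₑ ^ 2 := by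
    rw [← hP h h1 h2]
    refine lintegral_congr fun x => ?_
    rw [← ofReal_norm, hn, ofReal_norm]
  rw [e] at b
  calc _ ≤ ENNReal.ofReal A * (ENNReal.ofReal (C * |lam| ^ (-(d : ℝ))) *
        (ENNReal.ofReal A * ∫⁻ x, ‖h x‖ₑ ^ 2)) := by gcongr
    _ = _ := by
      rw [show A * C * A * |lam| ^ (-(d : ℝ)) = A * ((C * |lam| ^ (-(d : ℝ))) * A) by ring,
        ENNReal.ofReal_mul hA,
        ENNReal.ofReal_mul (p := C * |lam| ^ (-(d : ℝ))) (q := A) (by positivity)]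
      ring

end

section
open MeasureTheory Filter Complex SchwartzMap
open scoped RealInnerProductSpace ENNReal

open scoped ContDiff Topology

lemma cs_lintegral {α : Type*} [MeasurableSpace α] (μ : Measure α) (f g : α → ℝ≥0∞)
    (hf : AEMeasurable f μ) (hg : AEMeasurable g μ) :
    (∫⁻ x, f x * g x ∂μ) ^ 2 ≤ (∫⁻ x, f x ^ 2 ∂μ) * ∫⁻ x, g x ^ 2 ∂μ := by
  have h := ENNReal.lintegral_mul_le_Lp_mul_Lq μ (p := 2) (q := 2)
    ⟨by norm_num, by norm_num, by norm_num⟩ hf hg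
  simp only [Pi.mul_apply, ENNReal.rpow_ofNat] at h
  calc _ ≤ ((∫⁻ x, f x ^ 2 ∂μ) ^ (1 / 2 : ℝ) * (∫⁻ x, g x ^ 2 ∂μ) ^ (1 / 2 : ℝ)) ^ 2 := by
        gcongr
    _ = _ := by
        rw [mul_pow, ← ENNReal.rpow_natCast, ← ENNReal.rpow_natCast, ← ENNReal.rpow_mul,
          ← ENNReal.rpow_mul]
        norm_num

lemma ker_decay' {d : ℕ} (φ : E d × E d → ℝ) (m : E d × E d → ℂ)
    (hφs : ContDiff ℝ ∞ φ) (hms : ContDiff ℝ ∞ m) (hmc : HasCompactSupport m)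
    (hgrad : ∀ p ∈ tsupport m, ∃ j : Fin d, fderiv ℝ φ p (etaV j - xiV j) ≠ 0) :
    ∃ c : ℝ, 0 < c ∧ ∃ C0 : ℝ, 0 < C0 ∧ ∀ N : ℕ, ∃ D : ℝ, 0 ≤ D ∧ ∀ (lam : ℝ) (u v : E d),
      (C0 * |lam| ≤ ‖u‖ + ‖v‖ ∨ ‖u - v‖ ≤ c * |lam| ∨ |lam| ≤ 1) →
      ‖kerK m φ lam u v‖ * (1 + |lam| + ‖u‖ + ‖v‖) ^ N ≤ D := by
  obtain ⟨c, hc, C0, hC0, h⟩ := ker_decay φ m hφs hms hmc hgrad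
  refine ⟨c, hc, C0, hC0, fun N => ?_⟩
  obtain ⟨C, hC⟩ := h N
  set B := ∫ p, ‖m p‖ with hB
  have hB0 : 0 ≤ B := integral_nonneg fun _ => norm_nonneg _
  refine ⟨2 ^ N * (B + |C|) + B * (2 + C0) ^ N, by positivity, fun lam u v hP => ?_⟩
  have hkb := ker_bound m φ lam u v
  by_cases hP' : C0 * |lam| ≤ ‖u‖ + ‖v‖ ∨ ‖u - v‖ ≤ c * |lam|
  · have h2 := (hC lam u v hP').trans (le_abs_self C)
    set s := ‖u‖ + ‖v‖ + |lam| with hs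
    have hs0 : 0 ≤ s := by positivity
    have e : 1 + |lam| + ‖u‖ + ‖v‖ = 1 + s := by rw [hs]; ring
    have h3 : (1 + s) ^ N ≤ 2 ^ N * (1 + s ^ N) := by
      rcases le_total s 1 with h1 | h1
      · calc (1 + s) ^ N ≤ 2 ^ N := by gcongr; linarith
          _ ≤ _ := by
            have : 0 ≤ s ^ N := by positivity
            nlinarith [show (0:ℝ) < 2 ^ N by positivity]
      · calc (1 + s) ^ N ≤ (2 * s) ^ N := by gcongr; linarith
          _ = 2 ^ N * s ^ N := mul_pow _ _ _
          _ ≤ _ := by gcongr; linarith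
    rw [e]
    calc ‖kerK m φ lam u v‖ * (1 + s) ^ N
        ≤ ‖kerK m φ lam u v‖ * (2 ^ N * (1 + s ^ N)) := by gcongr
      _ = 2 ^ N * (‖kerK m φ lam u v‖ + s ^ N * ‖kerK m φ lam u v‖) := by ring
      _ ≤ 2 ^ N * (B + |C|) := by gcongr
      _ ≤ _ := by
        have : 0 ≤ B * (2 + C0) ^ N := by positivity
        linarith
  · have hl : |lam| ≤ 1 := by tauto
    have h4 : ‖u‖ + ‖v‖ ≤ C0 * |lam| := by
      by_contra h5; exact hP' (Or.inl (not_le.mp h5).le)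
    have h5 : 1 + |lam| + ‖u‖ + ‖v‖ ≤ 2 + C0 := by nlinarith
    calc _ ≤ B * (2 + C0) ^ N := by gcongr
      _ ≤ _ := by
        have : 0 ≤ 2 ^ N * (B + |C|) := by positivity
        linarith

lemma Sop_cont {d : ℕ} (φ : E d × E d → ℝ) (m : E d × E d → ℂ)
    (hφ : Continuous φ) (hm : Continuous m) (hmc : HasCompactSupport m) (lam : ℝ)
    (h : E d → ℂ) (h1 : Integrable h) : Continuous (fun w : E d × E d => Sop m φ lam w.1 h w.2) := by
  have hk := ker_continuous m φ lam hφ hm hmc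
  unfold Sop
  refine continuous_of_dominated (bound := fun z => (∫ p, ‖m p‖) * ‖h z‖) ?_ ?_
    (h1.norm.const_mul _) ?_
  · intro w
    refine (Continuous.aestronglyMeasurable ?_).mul h1.aestronglyMeasurable
    exact hk.comp (g := fun w : E d × E d => kerK m φ lam w.1 w.2) (f := fun z => (w.2 - z, w.2 - w.1)) (by fun_prop)
  · intro w
    refine Eventually.of_forall fun z => ?_
    rw [norm_mul]
    gcongr
    exact ker_bound _ _ _ _ _
  · refine Eventually.of_forall fun z => ?_
    refine Continuous.mul ?_ continuous_const
    exact hk.comp (g := fun w : E d × E d => kerK m φ lam w.1 w.2) (f := fun w : E d × E d => (w.2 - z, w.2 - w.1)) (by fun_prop)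

lemma q_sq_int {d : ℕ} : ∃ A : ℝ, 0 ≤ A ∧
    ∫⁻ x : E d, ENNReal.ofReal (((1 + ‖x‖) ^ (d + 1))⁻¹) ^ 2 ≤ ENNReal.ofReal A := by
  obtain ⟨A, hA, h⟩ := lint_weight (d := d)
  refine ⟨A, hA, le_trans (lintegral_mono fun x => ?_) ((h 1 one_pos).trans (by simp))⟩
  rw [one_mul, Real.rpow_neg (by positivity), Real.rpow_natCast]
  set t := ENNReal.ofReal (((1 + ‖x‖) ^ (d + 1))⁻¹)
  have ht : t ≤ 1 := by
    rw [← ENNReal.ofReal_one]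
    refine ENNReal.ofReal_le_ofReal (inv_le_one_of_one_le₀ (one_le_pow₀ ?_))
    linarith [norm_nonneg x]
  calc t ^ 2 = t * t := by ring
    _ ≤ t * 1 := by gcongr
    _ = t := mul_one t

lemma lemB_real {L p q r a k D : ℝ} (ha : 0 ≤ a) {M n : ℕ} (hL : 0 ≤ L) (hp : 0 ≤ p) (hq : 0 ≤ q)
    (hk : k * (1 + L + p + q) ^ (M + n + (n + ⌈a⌉₊)) ≤ D) (hD : 0 ≤ D) :
    k ≤ (D * ((1 + L) ^ M)⁻¹ * ((1 + q) ^ (n + ⌈a⌉₊))⁻¹) * ((1 + p) ^ n)⁻¹ := by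
  have h1 : (1 + L) ^ M * (1 + p) ^ n * (1 + q) ^ (n + ⌈a⌉₊) ≤
      (1 + L + p + q) ^ (M + n + (n + ⌈a⌉₊)) := by
    rw [pow_add _ (M + n), pow_add _ M]
    have e1 : 1 + L ≤ 1 + L + p + q := by linarith
    have e2 : 1 + p ≤ 1 + L + p + q := by linarith
    have e3 : 1 + q ≤ 1 + L + p + q := by linarith
    exact mul_le_mul (mul_le_mul (pow_le_pow_left₀ (by positivity) e1 _)
      (pow_le_pow_left₀ (by positivity) e2 _) (by positivity) (by positivity))
      (pow_le_pow_left₀ (by positivity) e3 _) (by positivity) (by positivity)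
  rcases le_total k 0 with hk0 | hk0
  · exact hk0.trans (by positivity)
  have h2 : k * ((1 + L) ^ M * (1 + p) ^ n * (1 + q) ^ (n + ⌈a⌉₊)) ≤ D :=
    (mul_le_mul_of_nonneg_left h1 hk0).trans hk
  rw [← le_div_iff₀ (by positivity)] at h2
  refine h2.trans (le_of_eq ?_)
  field_simp

lemma lemB_real2 {L q x y a D : ℝ} (ha : 0 ≤ a) {M n : ℕ} (hL : 0 ≤ L) (hq : 0 ≤ q) (hx : 0 ≤ x)
    (hy : 0 ≤ y) (hxy : x ≤ y + q) :
    (1 + x) ^ (2 * a) * (D * ((1 + L) ^ M)⁻¹ * ((1 + q) ^ (n + ⌈a⌉₊))⁻¹) ^ 2 ≤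
      (D ^ 2 * ((1 + L) ^ (2 * M))⁻¹ * (1 + y) ^ (2 * a)) * (((1 + q) ^ n)⁻¹) ^ 2 := by
  have h1 : (1 + x) ^ (2 * a) ≤ (1 + y) ^ (2 * a) * ((1 + q) ^ ⌈a⌉₊) ^ 2 := by
    calc (1 + x) ^ (2 * a) ≤ ((1 + y) * (1 + q)) ^ (2 * a) := by
          gcongr; nlinarith
      _ = (1 + y) ^ (2 * a) * (1 + q) ^ (2 * a) := Real.mul_rpow (by positivity) (by positivity)
      _ ≤ (1 + y) ^ (2 * a) * (1 + q) ^ (2 * (⌈a⌉₊ : ℝ)) := by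
          gcongr
          · linarith
          · exact Nat.le_ceil a
      _ = _ := by
          rw [mul_comm 2 (⌈a⌉₊ : ℝ), Real.rpow_mul (x := 1 + q) (by positivity), Real.rpow_natCast,
            Real.rpow_two]
  calc _ ≤ ((1 + y) ^ (2 * a) * ((1 + q) ^ ⌈a⌉₊) ^ 2) *
        (D * ((1 + L) ^ M)⁻¹ * ((1 + q) ^ (n + ⌈a⌉₊))⁻¹) ^ 2 := by gcongr
    _ = _ := by
        rw [pow_add, mul_comm 2 M, pow_mul (1 + L)]
        field_simp

lemma lemB {d : ℕ} (φ : E d × E d → ℝ) (m : E d × E d → ℂ) (a : ℝ) (ha : 0 ≤ a) (M : ℕ) :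
    ∃ A : ℝ, 0 ≤ A ∧ ∀ (D L lam : ℝ) (y : E d) (h : E d → ℂ) (X : Set (E d)), 0 ≤ D → 0 ≤ L →
      Measurable h → MeasurableSet X →
      (∀ x ∈ X, ∀ z, h z ≠ 0 → ‖kerK m φ lam (x - z) (x - y)‖ *
        (1 + L + ‖x - z‖ + ‖x - y‖) ^ (M + (d + 1) + (d + 1 + ⌈a⌉₊)) ≤ D) →
      ∫⁻ x in X, ENNReal.ofReal ((1 + ‖x‖) ^ (2 * a)) * ‖Sop m φ lam y h x‖ₑ ^ 2 ≤
        ENNReal.ofReal (A * (D ^ 2 * ((1 + L) ^ (2 * M))⁻¹ * (1 + ‖y‖) ^ (2 * a))) *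
          ∫⁻ z, ‖h z‖ₑ ^ 2 := by
  obtain ⟨A, hA, hq⟩ := q_sq_int (d := d)
  refine ⟨A * A, by positivity, fun D L lam y h X hD hL hh hX hker => ?_⟩
  set Q : E d → ℝ≥0∞ := fun x => ENNReal.ofReal (((1 + ‖x‖) ^ (d + 1))⁻¹) with hQ
  have hQm : Measurable Q := by fun_prop
  have hpt : ∀ x ∈ X, ENNReal.ofReal ((1 + ‖x‖) ^ (2 * a)) * ‖Sop m φ lam y h x‖ₑ ^ 2 ≤
      ENNReal.ofReal (D ^ 2 * ((1 + L) ^ (2 * M))⁻¹ * (1 + ‖y‖) ^ (2 * a)) *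
        (ENNReal.ofReal A * ∫⁻ z, ‖h z‖ₑ ^ 2) * Q (x - y) ^ 2 := by
    intro x hx
    set c1 := (D * ((1 + L) ^ M)⁻¹ * ((1 + ‖x - y‖) ^ (d + 1 + ⌈a⌉₊))⁻¹) with hc1
    have hc10 : 0 ≤ c1 := by positivity
    have h1 : ‖Sop m φ lam y h x‖ₑ ≤ ENNReal.ofReal c1 * ∫⁻ z, Q (x - z) * ‖h z‖ₑ := by
      unfold Sop
      refine (enorm_integral_le_lintegral_enorm _).trans ?_
      rw [← lintegral_const_mul _ (by fun_prop)]
      refine lintegral_mono fun z => ?_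
      by_cases hz : h z = 0
      · simp [hz]
      rw [enorm_mul, ← mul_assoc]
      gcongr
      rw [← ofReal_norm, hQ, ← ENNReal.ofReal_mul hc10]
      exact ENNReal.ofReal_le_ofReal (lemB_real (r := 0) ha hL (norm_nonneg _) (norm_nonneg _)
        (hker x hx z hz) hD)
    have h2 : (∫⁻ z, Q (x - z) * ‖h z‖ₑ) ^ 2 ≤ ENNReal.ofReal A * ∫⁻ z, ‖h z‖ₑ ^ 2 := by
      refine (cs_lintegral volume _ _ (by fun_prop) (by fun_prop)).trans ?_
      rw [lintegral_sub_left_eq_self (fun z => Q z ^ 2) x]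
      gcongr
    calc _ ≤ ENNReal.ofReal ((1 + ‖x‖) ^ (2 * a)) *
          (ENNReal.ofReal c1 * ∫⁻ z, Q (x - z) * ‖h z‖ₑ) ^ 2 := by gcongr
      _ = (ENNReal.ofReal ((1 + ‖x‖) ^ (2 * a)) * ENNReal.ofReal c1 ^ 2) *
          (∫⁻ z, Q (x - z) * ‖h z‖ₑ) ^ 2 := by ring
      _ ≤ (ENNReal.ofReal (D ^ 2 * ((1 + L) ^ (2 * M))⁻¹ * (1 + ‖y‖) ^ (2 * a)) * Q (x - y) ^ 2) *
          (ENNReal.ofReal A * ∫⁻ z, ‖h z‖ₑ ^ 2) := by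
          refine mul_le_mul' ?_ h2
          rw [hQ, ← ENNReal.ofReal_pow hc10, ← ENNReal.ofReal_mul (by positivity),
            ← ENNReal.ofReal_pow (by positivity), ← ENNReal.ofReal_mul (by positivity)]
          refine ENNReal.ofReal_le_ofReal (lemB_real2 ha hL (norm_nonneg _) (norm_nonneg _)
            (norm_nonneg _) ?_)
          calc ‖x‖ = ‖y + (x - y)‖ := by congr 1; abel
            _ ≤ _ := norm_add_le _ _
      _ = _ := by ring
  calc _ ≤ ∫⁻ x in X, ENNReal.ofReal (D ^ 2 * ((1 + L) ^ (2 * M))⁻¹ * (1 + ‖y‖) ^ (2 * a)) *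
        (ENNReal.ofReal A * ∫⁻ z, ‖h z‖ₑ ^ 2) * Q (x - y) ^ 2 := setLIntegral_mono' hX hpt
    _ ≤ ∫⁻ x, ENNReal.ofReal (D ^ 2 * ((1 + L) ^ (2 * M))⁻¹ * (1 + ‖y‖) ^ (2 * a)) *
        (ENNReal.ofReal A * ∫⁻ z, ‖h z‖ₑ ^ 2) * Q (x - y) ^ 2 := setLIntegral_le_lintegral _ _
    _ = ENNReal.ofReal (D ^ 2 * ((1 + L) ^ (2 * M))⁻¹ * (1 + ‖y‖) ^ (2 * a)) *
        (ENNReal.ofReal A * ∫⁻ z, ‖h z‖ₑ ^ 2) * ∫⁻ x, Q x ^ 2 := by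
        rw [lintegral_const_mul _ (by fun_prop), lintegral_sub_right_eq_self (fun z => Q z ^ 2) y]
    _ ≤ ENNReal.ofReal (D ^ 2 * ((1 + L) ^ (2 * M))⁻¹ * (1 + ‖y‖) ^ (2 * a)) *
        (ENNReal.ofReal A * ∫⁻ z, ‖h z‖ₑ ^ 2) * ENNReal.ofReal A := by gcongr
    _ = _ := by
        rw [ENNReal.ofReal_mul (p := A * A) (by positivity), ENNReal.ofReal_mul hA]
        ring

end

section
open MeasureTheory Filter Complex SchwartzMap
open scoped RealInnerProductSpace ENNReal

open scoped ContDiff Topology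

lemma norm_le_add_sub {d : ℕ} (x y : E d) : ‖x‖ ≤ ‖y‖ + ‖x - y‖ := by
  calc ‖x‖ = ‖y + (x - y)‖ := by congr 1; abel
    _ ≤ _ := norm_add_le _ _

lemma pow_inv_le {L : ℝ} (hL : 1 ≤ L) (M : ℕ) (e : ℝ) (he : -(2 * M : ℝ) ≤ e) :
    ((1 + L) ^ (2 * M))⁻¹ ≤ L ^ e := by
  have h0 : 0 < L := by linarith
  calc ((1 + L) ^ (2 * M))⁻¹ ≤ (L ^ (2 * M))⁻¹ := by
        gcongr; linarith
    _ = L ^ (-(2 * M : ℝ)) := by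
        rw [Real.rpow_neg h0.le, ← Real.rpow_natCast]; push_cast; rfl
    _ ≤ _ := Real.rpow_le_rpow_of_exponent_le hL he

lemma lemA {d : ℕ} (φ : E d × E d → ℝ) (m : E d × E d → ℂ)
    (hφs : ContDiff ℝ ∞ φ) (hms : ContDiff ℝ ∞ m) (hmc : HasCompactSupport m)
    (hmat : ∀ p ∈ tsupport m, (derMat φ p xiV (fun j => etaV j - xiV j)).det ≠ 0)
    (hgrad : ∀ p ∈ tsupport m, ∃ j : Fin d, fderiv ℝ φ p (etaV j - xiV j) ≠ 0)
    (a : ℝ) (ha : 0 ≤ a) :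
    ∃ C : ℝ, 0 ≤ C ∧ ∀ (lam : ℝ), 1 ≤ |lam| → ∀ (y : E d) (h : E d → ℂ), Measurable h →
      Integrable h → MemLp h 2 →
      ∫⁻ x, ENNReal.ofReal ((1 + ‖x‖) ^ (2 * a)) * ‖Sop m φ lam y h x‖ₑ ^ 2 ≤
        ENNReal.ofReal (C * ((1 + ‖y‖ + |lam|) ^ (2 * a) * |lam| ^ (-(d : ℝ)))) *
          ∫⁻ z, ‖h z‖ₑ ^ 2 := by
  obtain ⟨c, hc, C0, hC0, hdec⟩ := ker_decay' φ m hφs hms hmc hgrad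
  obtain ⟨A, hA, hB⟩ := lemB φ m a ha d
  obtain ⟨D, hD, hdec⟩ := hdec (d + (d + 1) + (d + 1 + ⌈a⌉₊))
  obtain ⟨C2, hC2, hL2⟩ := Sop_L2 φ m hφs hms hmc hmat
  refine ⟨A * D ^ 2 + (1 + C0) ^ (2 * a) * C2, by positivity, fun lam hlam y h hm h1 h2 => ?_⟩
  have hL0 : 0 < |lam| := by linarith
  have hl0 : lam ≠ 0 := abs_pos.mp hL0
  set X : Set (E d) := {x | C0 * |lam| ≤ ‖x - y‖} with hX
  have hXm : MeasurableSet X := (isClosed_le (by fun_prop) (by fun_prop)).measurableSet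
  rw [← lintegral_add_compl _ hXm]
  have bX := hB D |lam| lam y h X hD hL0.le hm hXm (by
    intro x hx z _
    refine hdec lam _ _ (Or.inl ?_)
    have : C0 * |lam| ≤ ‖x - y‖ := hx
    linarith [norm_nonneg (x - z)])
  have bXc : ∫⁻ x in Xᶜ, ENNReal.ofReal ((1 + ‖x‖) ^ (2 * a)) * ‖Sop m φ lam y h x‖ₑ ^ 2 ≤
      ENNReal.ofReal ((1 + C0) ^ (2 * a) * C2 * ((1 + ‖y‖ + |lam|) ^ (2 * a) * |lam| ^ (-(d : ℝ)))) *
        ∫⁻ z, ‖h z‖ₑ ^ 2 := by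
    calc _ ≤ ∫⁻ x in Xᶜ, ENNReal.ofReal ((1 + C0) ^ (2 * a) * (1 + ‖y‖ + |lam|) ^ (2 * a)) *
          ‖Sop m φ lam y h x‖ₑ ^ 2 := by
          refine setLIntegral_mono' hXm.compl fun x hx => ?_
          gcongr
          rw [← Real.mul_rpow (by positivity) (by positivity)]
          have h3 : ‖x - y‖ ≤ C0 * |lam| := by
            have : ¬ (C0 * |lam| ≤ ‖x - y‖) := hx
            exact (not_le.mp this).le
          gcongr
          have := norm_le_add_sub x y
          nlinarith [norm_nonneg y]
      _ ≤ ∫⁻ x, ENNReal.ofReal ((1 + C0) ^ (2 * a) * (1 + ‖y‖ + |lam|) ^ (2 * a)) *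
          ‖Sop m φ lam y h x‖ₑ ^ 2 := setLIntegral_le_lintegral _ _
      _ = ENNReal.ofReal ((1 + C0) ^ (2 * a) * (1 + ‖y‖ + |lam|) ^ (2 * a)) *
          ∫⁻ x, ‖Sop m φ lam y h x‖ₑ ^ 2 := lintegral_const_mul' _ _ (by simp)
      _ ≤ ENNReal.ofReal ((1 + C0) ^ (2 * a) * (1 + ‖y‖ + |lam|) ^ (2 * a)) *
          (ENNReal.ofReal (C2 * |lam| ^ (-(d : ℝ))) * ∫⁻ x, ‖h x‖ₑ ^ 2) := by
          gcongr
          exact hL2 lam hl0 y h h1 h2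
      _ = _ := by
          rw [← mul_assoc, ← ENNReal.ofReal_mul (by positivity)]
          congr 2; ring
  refine (add_le_add bX bXc).trans ?_
  rw [← add_mul, ← ENNReal.ofReal_add (by positivity) (by positivity)]
  gcongr
  rw [add_mul]
  gcongr ?_ + _
  calc A * (D ^ 2 * ((1 + |lam|) ^ (2 * d))⁻¹ * (1 + ‖y‖) ^ (2 * a))
      ≤ A * (D ^ 2 * |lam| ^ (-(d : ℝ)) * (1 + ‖y‖ + |lam|) ^ (2 * a)) := by
        have e1 : ((1 + |lam|) ^ (2 * d))⁻¹ ≤ |lam| ^ (-(d : ℝ)) := by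
          refine pow_inv_le hlam d _ ?_
          have : (0:ℝ) ≤ d := Nat.cast_nonneg d
          linarith
        have e2 : (1 + ‖y‖) ^ (2 * a) ≤ (1 + ‖y‖ + |lam|) ^ (2 * a) :=
          Real.rpow_le_rpow (by positivity) (by linarith) (by positivity)
        gcongr
    _ = _ := by ring

set_option maxHeartbeats 1000000 in
lemma lemW {d : ℕ} (φ : E d × E d → ℝ) (m : E d × E d → ℂ)
    (hφs : ContDiff ℝ ∞ φ) (hms : ContDiff ℝ ∞ m) (hmc : HasCompactSupport m)
    (hmat : ∀ p ∈ tsupport m, (derMat φ p xiV (fun j => etaV j - xiV j)).det ≠ 0)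
    (hgrad : ∀ p ∈ tsupport m, ∃ j : Fin d, fderiv ℝ φ p (etaV j - xiV j) ≠ 0)
    (a b : ℝ) (ha : 0 ≤ a) (hb : 0 ≤ b) :
    ∃ C : ℝ, 0 ≤ C ∧ ∀ (lam : ℝ), lam ≠ 0 → ∀ (y : E d) (h : E d → ℂ), Measurable h →
      Integrable h → MemLp h 2 →
      ∫⁻ x, ENNReal.ofReal ((1 + ‖x‖) ^ (2 * a)) * ‖Sop m φ lam y h x‖ₑ ^ 2 ≤
        ENNReal.ofReal (C * (|lam| ^ (-(d : ℝ) - 2 * b) * (1 + ‖y‖) ^ (2 * (a + b)))) *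
          ∫⁻ z, ENNReal.ofReal ((1 + ‖z‖) ^ (2 * (a + b))) * ‖h z‖ₑ ^ 2 := by
  obtain ⟨c, hc, C0, hC0, hdec⟩ := ker_decay' φ m hφs hms hmc hgrad
  obtain ⟨CA, hCA, hA⟩ := lemA φ m hφs hms hmc hmat hgrad a ha
  obtain ⟨A, hA0, hB⟩ := lemB φ m a ha (d + ⌈b⌉₊)
  obtain ⟨D, hD, hdec⟩ := hdec ((d + ⌈b⌉₊) + (d + 1) + (d + 1 + ⌈a⌉₊))
  set κ : ℝ := 2 + c + 2 / c with hκ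
  have hκ0 : 0 < κ := by positivity
  have hκ1 : 1 ≤ κ := by
    have : 0 < c + 2 / c := by positivity
    linarith
  have hc2 : c * (2 / c) = 2 := by field_simp
  refine ⟨A * D ^ 2 + CA * (κ ^ (2 * a) * κ ^ (2 * b)) +
      4 * (CA * (κ ^ (2 * a) * κ ^ (2 * (a + b))) + A * D ^ 2), by positivity, ?_⟩
  intro lam hlam y h hm h1 h2
  have hL0 : 0 < |lam| := abs_pos.mpr hlam
  set W : E d → ℝ≥0∞ := fun z => ENNReal.ofReal ((1 + ‖z‖) ^ (2 * (a + b))) with hW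
  have hWm : Measurable W := by fun_prop
  have hW1 : ∀ z, 1 ≤ W z := by
    intro z
    rw [hW, ← ENNReal.ofReal_one]
    refine ENNReal.ofReal_le_ofReal (Real.one_le_rpow ?_ (by positivity))
    linarith [norm_nonneg z]
  have hle : ∫⁻ z, ‖h z‖ₑ ^ 2 ≤ ∫⁻ z, W z * ‖h z‖ₑ ^ 2 := by
    refine lintegral_mono fun z => ?_
    calc _ = 1 * ‖h z‖ₑ ^ 2 := (one_mul _).symm
      _ ≤ _ := by gcongr; exact hW1 z
  have hy1 : 1 ≤ 1 + ‖y‖ := by linarith [norm_nonneg y]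
  have hya : (1 + ‖y‖) ^ (2 * a) ≤ (1 + ‖y‖) ^ (2 * (a + b)) :=
    Real.rpow_le_rpow_of_exponent_le hy1 (by linarith)
  have hdn : (0:ℝ) ≤ d := Nat.cast_nonneg d
  set P := |lam| ^ (-(d : ℝ) - 2 * b) * (1 + ‖y‖) ^ (2 * (a + b)) with hP
  have hP0 : 0 ≤ P := by positivity
  have t1 : 0 ≤ A * D ^ 2 := by positivity
  have t2 : 0 ≤ CA * (κ ^ (2 * a) * κ ^ (2 * b)) := by positivity
  have t3 : 0 ≤ CA * (κ ^ (2 * a) * κ ^ (2 * (a + b))) := by positivity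
  rcases le_total |lam| 1 with hl | hl
  · -- small parameter
    have b1 := hB D |lam| lam y h Set.univ hD hL0.le hm MeasurableSet.univ (by
      intro x _ z _
      exact hdec lam _ _ (Or.inr (Or.inr hl)))
    rw [Measure.restrict_univ] at b1
    refine b1.trans (mul_le_mul' (ENNReal.ofReal_le_ofReal ?_) hle)
    have e1 : ((1 + |lam|) ^ (2 * (d + ⌈b⌉₊)))⁻¹ ≤ 1 :=
      inv_le_one_of_one_le₀ (one_le_pow₀ (by linarith))
    have e2 : 1 ≤ |lam| ^ (-(d : ℝ) - 2 * b) :=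
      Real.one_le_rpow_of_pos_of_le_one_of_nonpos hL0 hl (by linarith)
    calc A * (D ^ 2 * ((1 + |lam|) ^ (2 * (d + ⌈b⌉₊)))⁻¹ * (1 + ‖y‖) ^ (2 * a))
        ≤ A * (D ^ 2 * 1 * (1 + ‖y‖) ^ (2 * (a + b))) := by gcongr
      _ = A * D ^ 2 * (1 * (1 + ‖y‖) ^ (2 * (a + b))) := by ring
      _ ≤ A * D ^ 2 * P := by rw [hP]; gcongr
      _ ≤ _ := by gcongr; linarith
  have hsplit : |lam| ^ (-(d : ℝ)) = |lam| ^ (-(d : ℝ) - 2 * b) * |lam| ^ (2 * b) := by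
    rw [← Real.rpow_add hL0]; congr 1; ring
  rcases le_total (c * |lam| / 2) ‖y‖ with hy | hy
  · have hly : |lam| ≤ κ * (1 + ‖y‖) := by
      have e : |lam| ≤ (2 / c) * ‖y‖ := by
        rw [div_mul_eq_mul_div, le_div_iff₀ hc]; linarith
      have : (2 / c) * ‖y‖ ≤ κ * (1 + ‖y‖) := by
        gcongr
        · rw [hκ]; linarith
        · linarith
      linarith
    have hly2 : 1 + ‖y‖ + |lam| ≤ κ * (1 + ‖y‖) := by
      have e : |lam| ≤ (2 / c) * ‖y‖ := by
        rw [div_mul_eq_mul_div, le_div_iff₀ hc]; linarith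
      rw [hκ]
      have : 0 < 2 / c := by positivity
      nlinarith [norm_nonneg y]
    refine (hA lam hl y h hm h1 h2).trans (mul_le_mul' (ENNReal.ofReal_le_ofReal ?_) hle)
    calc CA * ((1 + ‖y‖ + |lam|) ^ (2 * a) * |lam| ^ (-(d : ℝ)))
        ≤ CA * ((κ * (1 + ‖y‖)) ^ (2 * a) * (|lam| ^ (-(d : ℝ) - 2 * b) * (κ * (1 + ‖y‖)) ^ (2 * b))) := by
          rw [hsplit]; gcongr
      _ = CA * (κ ^ (2 * a) * κ ^ (2 * b)) * P := by
          rw [hP, Real.mul_rpow hκ0.le (by positivity), Real.mul_rpow hκ0.le (by positivity),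
            show 2 * (a + b) = 2 * a + 2 * b by ring, Real.rpow_add (by positivity)]
          ring
      _ ≤ _ := by gcongr; linarith
  · -- main case: split h
    set S : Set (E d) := {z | c * |lam| / 2 ≤ ‖z‖} with hS
    have hSm : MeasurableSet S := (isClosed_le (by fun_prop) (by fun_prop)).measurableSet
    set f1 := S.indicator h with hf1
    set f2 := Sᶜ.indicator h with hf2
    have hsum : h = f1 + f2 := (Set.indicator_self_add_compl S h).symm
    have m1 : Measurable f1 := hm.indicator hSm
    have m2 : Measurable f2 := hm.indicator hSm.compl
    have i1 : Integrable f1 := h1.indicator hSm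
    have i2 : Integrable f2 := h1.indicator hSm.compl
    have l1 : MemLp f1 2 := h2.indicator hSm
    have hSadd : ∀ x, Sop m φ lam y h x = Sop m φ lam y f1 x + Sop m φ lam y f2 x := by
      intro x
      unfold Sop
      have hkm : AEStronglyMeasurable (fun z => kerK m φ lam (x - z) (x - y)) volume := by
        refine Continuous.aestronglyMeasurable ?_
        exact (ker_continuous m φ lam hφs.continuous hms.continuous hmc).comp
          (g := fun w : E d × E d => kerK m φ lam w.1 w.2) (f := fun z => (x - z, x - y)) (by fun_prop)
      rw [← integral_add]
      · congr 1; funext z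
        rw [← mul_add]; congr 1
        exact congrFun hsum z
      · exact i1.bdd_mul hkm (Eventually.of_forall fun z => ker_bound _ _ _ _ _)
      · exact i2.bdd_mul hkm (Eventually.of_forall fun z => ker_bound _ _ _ _ _)
    have n1 : ∫⁻ z, ‖f1 z‖ₑ ^ 2 ≤
        ENNReal.ofReal (κ ^ (2 * (a + b)) * |lam| ^ (-(2 * (a + b)))) * ∫⁻ z, W z * ‖h z‖ₑ ^ 2 := by
      rw [← lintegral_const_mul' _ _ (by simp)]
      refine lintegral_mono fun z => ?_
      by_cases hz : z ∈ S
      · rw [hf1, Set.indicator_of_mem hz, ← mul_assoc]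
        calc ‖h z‖ₑ ^ 2 = 1 * ‖h z‖ₑ ^ 2 := (one_mul _).symm
          _ ≤ _ := by
            gcongr
            rw [hW, ← ENNReal.ofReal_mul (by positivity), ← ENNReal.ofReal_one]
            refine ENNReal.ofReal_le_ofReal ?_
            rw [Real.rpow_neg hL0.le, mul_right_comm, ← Real.mul_rpow hκ0.le (by positivity),
              ← div_eq_mul_inv, one_le_div (by positivity)]
            gcongr
            have hz' : c * |lam| / 2 ≤ ‖z‖ := hz
            have e : |lam| ≤ (2 / c) * ‖z‖ := by
              rw [div_mul_eq_mul_div, le_div_iff₀ hc]; linarith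
            rw [hκ]
            have : 0 < 2 / c := by positivity
            nlinarith [norm_nonneg z]
      · rw [hf1, Set.indicator_of_notMem hz]; simp
    have n2 : ∫⁻ z, ‖f2 z‖ₑ ^ 2 ≤ ∫⁻ z, W z * ‖h z‖ₑ ^ 2 := by
      refine le_trans (lintegral_mono fun z => ?_) hle
      gcongr
      exact enorm_le_iff_norm_le.mpr (norm_indicator_le_norm_self _ _)
    have b1 : ∫⁻ x, ENNReal.ofReal ((1 + ‖x‖) ^ (2 * a)) * ‖Sop m φ lam y f1 x‖ₑ ^ 2 ≤
        ENNReal.ofReal (CA * (κ ^ (2 * a) * κ ^ (2 * (a + b))) * P) * ∫⁻ z, W z * ‖h z‖ₑ ^ 2 := by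
      refine (hA lam hl y f1 m1 i1 l1).trans ?_
      refine (mul_le_mul' le_rfl n1).trans ?_
      rw [← mul_assoc, ← ENNReal.ofReal_mul (by positivity)]
      refine mul_le_mul' (ENNReal.ofReal_le_ofReal ?_) le_rfl
      have hly : 1 + ‖y‖ + |lam| ≤ κ * |lam| := by
        rw [hκ]
        have : 0 < 2 / c := by positivity
        nlinarith
      have hone : 1 ≤ (1 + ‖y‖) ^ (2 * (a + b)) := Real.one_le_rpow hy1 (by positivity)
      calc CA * ((1 + ‖y‖ + |lam|) ^ (2 * a) * |lam| ^ (-(d : ℝ))) *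
            (κ ^ (2 * (a + b)) * |lam| ^ (-(2 * (a + b))))
          ≤ CA * ((κ * |lam|) ^ (2 * a) * |lam| ^ (-(d : ℝ))) *
            (κ ^ (2 * (a + b)) * |lam| ^ (-(2 * (a + b)))) := by gcongr
        _ = CA * (κ ^ (2 * a) * κ ^ (2 * (a + b))) *
            (|lam| ^ (2 * a) * |lam| ^ (-(d : ℝ)) * |lam| ^ (-(2 * (a + b))) * 1) := by
            rw [Real.mul_rpow hκ0.le hL0.le]; ring
        _ = CA * (κ ^ (2 * a) * κ ^ (2 * (a + b))) * (|lam| ^ (-(d : ℝ) - 2 * b) * 1) := by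
            rw [← Real.rpow_add hL0, ← Real.rpow_add hL0,
              show (2 * a + -(d : ℝ) + -(2 * (a + b))) = -(d : ℝ) - 2 * b by ring]
        _ ≤ _ := by rw [hP]; gcongr
    have b2 : ∫⁻ x, ENNReal.ofReal ((1 + ‖x‖) ^ (2 * a)) * ‖Sop m φ lam y f2 x‖ₑ ^ 2 ≤
        ENNReal.ofReal (A * D ^ 2 * P) * ∫⁻ z, W z * ‖h z‖ₑ ^ 2 := by
      have bb := hB D |lam| lam y f2 Set.univ hD hL0.le m2 MeasurableSet.univ (by
        intro x _ z hz
        refine hdec lam _ _ (Or.inr (Or.inl ?_))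
        have hz' : z ∈ Sᶜ := Set.mem_of_indicator_ne_zero hz
        have hz2 : ¬ (c * |lam| / 2 ≤ ‖z‖) := hz'
        have e : x - z - (x - y) = y - z := by abel
        rw [e]
        have := norm_sub_le y z
        linarith [not_le.mp hz2])
      rw [Measure.restrict_univ] at bb
      refine bb.trans (mul_le_mul' (ENNReal.ofReal_le_ofReal ?_) n2)
      calc A * (D ^ 2 * ((1 + |lam|) ^ (2 * (d + ⌈b⌉₊)))⁻¹ * (1 + ‖y‖) ^ (2 * a))
          ≤ A * (D ^ 2 * |lam| ^ (-(d : ℝ) - 2 * b) * (1 + ‖y‖) ^ (2 * (a + b))) := by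
            gcongr
            refine pow_inv_le hl _ _ ?_
            push_cast
            have := Nat.le_ceil b
            linarith
        _ = _ := by rw [hP]; ring
    have hmeas : Measurable (fun x => ENNReal.ofReal ((1 + ‖x‖) ^ (2 * a)) * ‖Sop m φ lam y f1 x‖ₑ ^ 2) := by
      have hc1 : Continuous (fun x => Sop m φ lam y f1 x) :=
        (Sop_cont φ m hφs.continuous hms.continuous hmc lam f1 i1).comp
          (f := fun x => (y, x)) (by fun_prop)
      have := hc1.measurable
      fun_prop
    calc _ ≤ ∫⁻ x, 4 * (ENNReal.ofReal ((1 + ‖x‖) ^ (2 * a)) * ‖Sop m φ lam y f1 x‖ₑ ^ 2 +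
          ENNReal.ofReal ((1 + ‖x‖) ^ (2 * a)) * ‖Sop m φ lam y f2 x‖ₑ ^ 2) := by
          refine lintegral_mono fun x => ?_
          rw [hSadd x]
          calc _ ≤ ENNReal.ofReal ((1 + ‖x‖) ^ (2 * a)) *
                (4 * (‖Sop m φ lam y f1 x‖ₑ ^ 2 + ‖Sop m φ lam y f2 x‖ₑ ^ 2)) := by
                gcongr
                refine le_trans ?_ (add_sq_le_enn _ _)
                gcongr
                exact enorm_add_le _ _
            _ = _ := by ring
      _ = 4 * ((∫⁻ x, ENNReal.ofReal ((1 + ‖x‖) ^ (2 * a)) * ‖Sop m φ lam y f1 x‖ₑ ^ 2) +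
          ∫⁻ x, ENNReal.ofReal ((1 + ‖x‖) ^ (2 * a)) * ‖Sop m φ lam y f2 x‖ₑ ^ 2) := by
          rw [lintegral_const_mul' _ _ (by simp), lintegral_add_left hmeas]
      _ ≤ 4 * ((ENNReal.ofReal (CA * (κ ^ (2 * a) * κ ^ (2 * (a + b))) * P) * ∫⁻ z, W z * ‖h z‖ₑ ^ 2) +
          ENNReal.ofReal (A * D ^ 2 * P) * ∫⁻ z, W z * ‖h z‖ₑ ^ 2) := by
          gcongr
      _ = ENNReal.ofReal (4 * (CA * (κ ^ (2 * a) * κ ^ (2 * (a + b))) + A * D ^ 2) * P) *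
          ∫⁻ z, W z * ‖h z‖ₑ ^ 2 := by
          rw [mul_assoc 4 _ P, add_mul _ _ P, ENNReal.ofReal_mul (by norm_num : (0:ℝ) ≤ 4),
            ENNReal.ofReal_add (by positivity) (by positivity)]
          simp only [ENNReal.ofReal_ofNat]
          ring
      _ ≤ _ := by
          gcongr
          linarith

end

section
open MeasureTheory Filter Complex SchwartzMap
open scoped RealInnerProductSpace ENNReal
open scoped ContDiff Topology

lemma FT_eq {d : ℕ} (h : E d → ℂ) (η : E d) :
    FT h η = (((2 * Real.pi) ^ (-(d : ℝ) / 2) : ℝ) : ℂ) * FT0 h η := by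
  unfold FT FT0
  congr 1
  refine integral_congr_ae (Eventually.of_forall fun z => ?_)
  simp only
  congr 2
  push_cast
  ring

lemma Bop_eq {d : ℕ} (φ : E d × E d → ℝ) (m : E d × E d → ℂ)
    (hφ : Continuous φ) (hm : Continuous m) (hmc : HasCompactSupport m) (lam : ℝ)
    (f g : 𝓢(E d, ℂ)) (x : E d) :
    Bop m φ lam f g x = (((2 * Real.pi) ^ (-(d : ℝ) / 2) : ℝ) : ℂ) ^ 3 *
      ∫ y, g y * Sop m φ lam y f x := by
  have hv : (volume : Measure (E d × E d)).IsAddHaarMeasure := by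
    rw [Measure.volume_eq_prod]; infer_instance
  have hf0 : Continuous (FT0 (f : E d → ℂ)) := FT0_cont _ f.integrable
  set c : ℂ := (((2 * Real.pi) ^ (-(d : ℝ) / 2) : ℝ) : ℂ) with hc
  set A : E d × E d → ℂ := fun p =>
    cexp (I * ((⟪x, p.1 + p.2⟫ + lam * φ p : ℝ) : ℂ)) * m p * FT0 f p.1 with hA
  have hAc : Continuous A := by
    rw [hA]; fun_prop
  have hAs : HasCompactSupport A := by
    rw [hA]
    exact (hmc.mul_left (f := fun p : E d × E d =>
      cexp (I * ((⟪x, p.1 + p.2⟫ + lam * φ p : ℝ) : ℂ)))).mul_right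
  have hAi : Integrable A := hAc.integrable_of_hasCompactSupport hAs
  have e1 : Bop m φ lam f g x = c ^ 3 * ∫ p : E d × E d, ∫ y : E d,
      A p * (cexp (I * ((-⟪y, p.2⟫ : ℝ) : ℂ)) * g y) := by
    unfold Bop
    rw [← hc, show c ^ 3 = c * c ^ 2 by ring, mul_assoc, ← integral_const_mul (c ^ 2)]
    refine congrArg (c * ·) (integral_congr_ae (Eventually.of_forall fun p => ?_))
    simp only [hA]
    rw [integral_const_mul, FT_eq, FT_eq, ← hc]
    unfold FT0
    ring
  rw [e1]
  congr 1
  have hint : Integrable (fun w : (E d × E d) × E d =>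
      A w.1 * (cexp (I * ((-⟪w.2, w.1.2⟫ : ℝ) : ℂ)) * g w.2))
      ((volume : Measure (E d × E d)).prod (volume : Measure (E d))) := by
    have h0 := hAi.mul_prod (g.integrable (μ := (volume : Measure (E d))))
    have h1 := h0.bdd_mul (c := 1) (g := fun w : (E d × E d) × E d => A w.1 * g w.2)
      (f := fun w : (E d × E d) × E d => cexp (I * ((-⟪w.2, w.1.2⟫ : ℝ) : ℂ)))
      (Continuous.aestronglyMeasurable (by fun_prop))
      (Eventually.of_forall fun w => (norm_expI _).le)
    refine h1.congr (Eventually.of_forall fun w => ?_)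
    simp only
    ring
  rw [integral_integral_swap hint]
  refine integral_congr_ae (Eventually.of_forall fun y => ?_)
  simp only
  rw [Sop_eq1 φ m hφ hm hmc lam y f f.integrable x, ← integral_const_mul]
  refine integral_congr_ae (Eventually.of_forall fun p => ?_)
  simp only [hA]
  have : cexp (I * ((⟪x, p.1⟫ + ⟪x - y, p.2⟫ + lam * φ p : ℝ) : ℂ)) =
      cexp (I * ((⟪x, p.1 + p.2⟫ + lam * φ p : ℝ) : ℂ)) * cexp (I * ((-⟪y, p.2⟫ : ℝ) : ℂ)) := by
    rw [← Complex.exp_add, ← mul_add, ← Complex.ofReal_add]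
    congr 3
    rw [inner_add_right, inner_sub_left]; ring
  rw [this]; ring

/-- Minkowski-type step in squared form. -/
lemma mink {d : ℕ} (a s : ℝ) (K : ℝ≥0∞) (G : E d → ℂ) (hG : Measurable G)
    (F : E d → E d → ℂ) (hF : Measurable (fun w : E d × E d => F w.1 w.2))
    (hb : ∀ y, ∫⁻ x, ENNReal.ofReal ((1 + ‖x‖) ^ (2 * a)) * ‖F y x‖ₑ ^ 2 ≤
      ENNReal.ofReal ((1 + ‖y‖) ^ (2 * s)) * K) :
    ∫⁻ x, ENNReal.ofReal ((1 + ‖x‖) ^ (2 * a)) * ‖∫ y, G y * F y x‖ₑ ^ 2 ≤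
      K * (∫⁻ y, ENNReal.ofReal ((1 + ‖y‖) ^ s) * ‖G y‖ₑ) ^ 2 := by
  set w : E d → ℝ≥0∞ := fun y => ENNReal.ofReal ((1 + ‖y‖) ^ s) with hw
  set v : E d → ℝ≥0∞ := fun y => ENNReal.ofReal ((1 + ‖y‖) ^ (-s)) with hv
  set r : E d → ℝ≥0∞ := fun y => ENNReal.ofReal ((1 + ‖y‖) ^ (s / 2)) * ‖G y‖ₑ ^ (1 / 2 : ℝ) with hr
  set t : E d → ℝ≥0∞ := fun y => ENNReal.ofReal ((1 + ‖y‖) ^ (-s / 2)) * ‖G y‖ₑ ^ (1 / 2 : ℝ) with ht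
  have hpos : ∀ y : E d, 0 < 1 + ‖y‖ := fun y => by positivity
  have hhalf : ∀ X : ℝ≥0∞, (X ^ (1 / 2 : ℝ)) ^ 2 = X := by
    intro X
    rw [← ENNReal.rpow_natCast, ← ENNReal.rpow_mul]; norm_num
  have hr2 : ∀ y, r y ^ 2 = w y * ‖G y‖ₑ := by
    intro y
    rw [hr, hw]; simp only
    rw [mul_pow, hhalf, ← ENNReal.ofReal_pow (by positivity), ← Real.rpow_natCast, ← Real.rpow_mul (hpos y).le]
    congr 3; push_cast; ring
  have ht2 : ∀ y, t y ^ 2 = v y * ‖G y‖ₑ := by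
    intro y
    rw [ht, hv]; simp only
    rw [mul_pow, hhalf, ← ENNReal.ofReal_pow (by positivity), ← Real.rpow_natCast, ← Real.rpow_mul (hpos y).le]
    congr 3; push_cast; ring
  have hrt : ∀ y, r y * t y = ‖G y‖ₑ := by
    intro y
    rw [hr, ht]; simp only
    rw [mul_mul_mul_comm, ← sq, hhalf, ← ENNReal.ofReal_mul (by positivity), ← Real.rpow_add (hpos y)]
    rw [show s / 2 + -s / 2 = 0 by ring]; simp
  have hFy : ∀ x, Measurable (fun y => F y x) := fun x =>
    hF.comp (measurable_id.prodMk measurable_const)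
  have hrm : Measurable r := by rw [hr]; fun_prop
  have htm : Measurable t := by rw [ht]; fun_prop
  have hvm : Measurable v := by rw [hv]; fun_prop
  have hpt : ∀ x, ‖∫ y, G y * F y x‖ₑ ^ 2 ≤
      (∫⁻ y, w y * ‖G y‖ₑ) * ∫⁻ y, v y * ‖G y‖ₑ * ‖F y x‖ₑ ^ 2 := by
    intro x
    calc ‖∫ y, G y * F y x‖ₑ ^ 2 ≤ (∫⁻ y, ‖G y * F y x‖ₑ) ^ 2 := by
          gcongr; exact enorm_integral_le_lintegral_enorm _
      _ = (∫⁻ y, r y * (t y * ‖F y x‖ₑ)) ^ 2 := by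
          congr 2; funext y
          rw [enorm_mul, ← mul_assoc, hrt]
      _ ≤ (∫⁻ y, r y ^ 2) * ∫⁻ y, (t y * ‖F y x‖ₑ) ^ 2 :=
          cs_lintegral _ _ _ hrm.aemeasurable (htm.mul (hFy x).enorm).aemeasurable
      _ = _ := by simp only [mul_pow, hr2, ht2]
  have hjoint : Measurable (fun q : E d × E d => ENNReal.ofReal ((1 + ‖q.1‖) ^ (2 * a)) *
      (v q.2 * ‖G q.2‖ₑ * ‖F q.2 q.1‖ₑ ^ 2)) := by
    have h1 : Measurable (fun q : E d × E d => F q.2 q.1) := hF.comp measurable_swap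
    fun_prop
  set N : ℝ≥0∞ := ∫⁻ y, w y * ‖G y‖ₑ with hN
  calc _ ≤ ∫⁻ x, N * ∫⁻ y, ENNReal.ofReal ((1 + ‖x‖) ^ (2 * a)) *
        (v y * ‖G y‖ₑ * ‖F y x‖ₑ ^ 2) := by
        refine lintegral_mono fun x => ?_
        simp only
        rw [lintegral_const_mul' _ _ (by simp)]
        calc _ ≤ _ := mul_le_mul' le_rfl (hpt x)
          _ = _ := by ring
    _ = N * ∫⁻ x, ∫⁻ y, ENNReal.ofReal ((1 + ‖x‖) ^ (2 * a)) *
        (v y * ‖G y‖ₑ * ‖F y x‖ₑ ^ 2) := by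
        rw [lintegral_const_mul _ (hjoint.lintegral_prod_right')]
    _ = N * ∫⁻ y, ∫⁻ x, ENNReal.ofReal ((1 + ‖x‖) ^ (2 * a)) *
        (v y * ‖G y‖ₑ * ‖F y x‖ₑ ^ 2) := by
        rw [lintegral_lintegral_swap hjoint.aemeasurable]
    _ ≤ N * ∫⁻ y, K * (w y * ‖G y‖ₑ) := by
        refine mul_le_mul' le_rfl (lintegral_mono fun y => ?_)
        calc _ = (v y * ‖G y‖ₑ) * ∫⁻ x, ENNReal.ofReal ((1 + ‖x‖) ^ (2 * a)) * ‖F y x‖ₑ ^ 2 := by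
              rw [← lintegral_const_mul' _ _ (by rw [hv]; exact ENNReal.mul_ne_top (by simp) (by simp))]
              congr 1; funext x; ring
          _ ≤ (v y * ‖G y‖ₑ) * (ENNReal.ofReal ((1 + ‖y‖) ^ (2 * s)) * K) :=
              mul_le_mul' le_rfl (hb y)
          _ = (v y * ENNReal.ofReal ((1 + ‖y‖) ^ (2 * s))) * (K * ‖G y‖ₑ) := by ring
          _ = w y * (K * ‖G y‖ₑ) := by
              rw [hv, hw]; simp only
              rw [← ENNReal.ofReal_mul (by positivity), ← Real.rpow_add (hpos y)]
              rw [show -s + 2 * s = s by ring]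
          _ = _ := by ring
    _ = _ := by
        rw [lintegral_const_mul _ (by rw [hw]; fun_prop), ← hN]; ring

lemma wt_le {d : ℕ} (a : ℝ) (ha : 0 ≤ a) (x : E d) :
    (1 + ‖x‖ ^ 2) ^ (a / 2) ≤ (1 + ‖x‖) ^ a := by
  rw [show a = 2 * (a / 2) by ring, Real.rpow_mul (by positivity)]
  rw [show 2 * (a / 2) / 2 = a / 2 by ring]
  refine Real.rpow_le_rpow (by positivity) ?_ (by positivity)
  rw [Real.rpow_two]
  nlinarith [norm_nonneg x]

lemma wt_ge {d : ℕ} (a : ℝ) (ha : 0 ≤ a) (x : E d) :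
    (1 + ‖x‖) ^ a ≤ 2 ^ (a / 2) * (1 + ‖x‖ ^ 2) ^ (a / 2) := by
  rw [← Real.mul_rpow (by norm_num) (by positivity)]
  calc (1 + ‖x‖) ^ a = ((1 + ‖x‖) ^ (2:ℝ)) ^ (a / 2) := by
        rw [← Real.rpow_mul (by positivity)]; congr 1; ring
    _ ≤ _ := by
      refine Real.rpow_le_rpow (by positivity) ?_ (by positivity)
      rw [Real.rpow_two]
      nlinarith [sq_nonneg (1 - ‖x‖)]

lemma enorm_wt {d : ℕ} (a : ℝ) (x : E d) (z : ℂ) :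
    ‖(((1 + ‖x‖ ^ 2) ^ (a / 2) : ℝ) : ℂ) * z‖ₑ =
      ENNReal.ofReal ((1 + ‖x‖ ^ 2) ^ (a / 2)) * ‖z‖ₑ := by
  rw [enorm_mul, ← ofReal_norm, Complex.norm_real, Real.norm_of_nonneg (by positivity)]

lemma final {d : ℕ} (φ : E d × E d → ℝ) (m : E d × E d → ℂ)
    (a b : ℝ) (ha : 0 ≤ a) (hb : 0 ≤ b)
    (hφs : ContDiff ℝ ∞ φ)
    (hms : ContDiff ℝ ∞ m) (hmc : HasCompactSupport m)
    (hmat : ∀ p ∈ tsupport m,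
      (derMat φ p xiV (fun j => etaV j - xiV j)).det ≠ 0)
    (hgrad : ∀ p ∈ tsupport m, ∃ j : Fin d, fderiv ℝ φ p (etaV j - xiV j) ≠ 0) :
    ∃ C : ℝ, ∀ lam : ℝ, lam ≠ 0 → ∀ f g : 𝓢(E d, ℂ),
      wLpNorm 2 a (Bop m φ lam f g) ≤
        ENNReal.ofReal (C * |lam| ^ (-(d : ℝ) / 2 - b)) *
          (wLpNorm 2 (a + b) (⇑f) * wLpNorm 1 (a + b) (⇑g)) := by
  obtain ⟨C, hC, hW⟩ := lemW φ m hφs hms hmc hmat hgrad a b ha hb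
  set c : ℝ := (2 * Real.pi) ^ (-(d : ℝ) / 2) with hc
  have hc0 : 0 ≤ c := by positivity
  set s : ℝ := a + b with hs
  have hs0 : 0 ≤ s := add_nonneg ha hb
  set T : ℝ := 2 ^ (s / 2) with hT
  have hT0 : 0 ≤ T := by positivity
  refine ⟨c ^ 3 * Real.sqrt C * T * T, ?_⟩
  intro lam hlam f g
  have hL0 : 0 < |lam| := abs_pos.mpr hlam
  set L : ℝ := |lam| ^ (-(d : ℝ) / 2 - b) with hL
  have hLp : 0 ≤ L := by positivity
  have hL2 : |lam| ^ (-(d : ℝ) - 2 * b) = L ^ 2 := by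
    rw [hL, ← Real.rpow_natCast, ← Real.rpow_mul hL0.le]; congr 1; push_cast; ring
  -- the estimate for f
  set Nf := wLpNorm 2 s (⇑f) with hNf
  set Ng := wLpNorm 1 s (⇑g) with hNg
  have hfN : ∫⁻ z, ENNReal.ofReal ((1 + ‖z‖) ^ (2 * s)) * ‖f z‖ₑ ^ 2 ≤
      (ENNReal.ofReal T * Nf) ^ 2 := by
    rw [mul_pow, hNf, wLpNorm, eLpNorm_two_sq, ← lintegral_const_mul' _ _ (by simp)]
    refine lintegral_mono fun z => ?_
    simp only
    rw [enorm_wt, mul_pow, ← mul_assoc, ← mul_pow, ← ENNReal.ofReal_mul hT0]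
    refine mul_le_mul' ?_ le_rfl
    rw [← ENNReal.ofReal_pow (by positivity)]
    refine ENNReal.ofReal_le_ofReal ?_
    rw [mul_comm 2 s, Real.rpow_mul (by positivity), Real.rpow_two]
    gcongr
    exact wt_ge s hs0 z
  have hgN : ∫⁻ y, ENNReal.ofReal ((1 + ‖y‖) ^ s) * ‖g y‖ₑ ≤ ENNReal.ofReal T * Ng := by
    rw [hNg, wLpNorm, eLpNorm_one_eq_lintegral_enorm, ← lintegral_const_mul' _ _ (by simp)]
    refine lintegral_mono fun z => ?_
    simp only
    rw [enorm_wt, ← mul_assoc, ← ENNReal.ofReal_mul hT0]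
    refine mul_le_mul' (ENNReal.ofReal_le_ofReal (wt_ge s hs0 z)) le_rfl
  have hmk := mink a s (ENNReal.ofReal (C * L ^ 2) *
      ∫⁻ z, ENNReal.ofReal ((1 + ‖z‖) ^ (2 * s)) * ‖f z‖ₑ ^ 2) (⇑g) g.continuous.measurable
    (fun y x => Sop m φ lam y f x)
    (Sop_cont φ m hφs.continuous hms.continuous hmc lam f f.integrable).measurable (by
      intro y
      refine (hW lam hlam y f f.continuous.measurable f.integrable (f.memLp 2)).trans (le_of_eq ?_)
      rw [hL2, ← mul_assoc C, ENNReal.ofReal_mul (by positivity)]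
      ring)
  have hsq : wLpNorm 2 a (Bop m φ lam f g) ^ 2 ≤
      (ENNReal.ofReal (c ^ 3 * Real.sqrt C * T * T * L) * (Nf * Ng)) ^ 2 := by
    rw [wLpNorm, eLpNorm_two_sq]
    calc _ ≤ ∫⁻ x, ENNReal.ofReal (c ^ 3) ^ 2 * (ENNReal.ofReal ((1 + ‖x‖) ^ (2 * a)) *
          ‖∫ y, g y * Sop m φ lam y f x‖ₑ ^ 2) := by
          refine lintegral_mono fun x => ?_
          simp only
          rw [enorm_wt, Bop_eq φ m hφs.continuous hms.continuous hmc lam f g x, enorm_mul, ← hc]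
          have e : ‖((c : ℝ) : ℂ) ^ 3‖ₑ = ENNReal.ofReal (c ^ 3) := by
            rw [← ofReal_norm, norm_pow, Complex.norm_real, Real.norm_of_nonneg hc0]
          rw [e, mul_pow, mul_pow, ← mul_assoc, ← mul_assoc, mul_comm (ENNReal.ofReal (c ^ 3) ^ 2)]
          refine mul_le_mul' (mul_le_mul' ?_ le_rfl) le_rfl
          rw [← ENNReal.ofReal_pow (by positivity)]
          refine ENNReal.ofReal_le_ofReal ?_
          rw [mul_comm 2 a, Real.rpow_mul (by positivity), Real.rpow_two]
          gcongr
          exact wt_le a ha x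
      _ = ENNReal.ofReal (c ^ 3) ^ 2 * ∫⁻ x, (ENNReal.ofReal ((1 + ‖x‖) ^ (2 * a)) *
          ‖∫ y, g y * Sop m φ lam y f x‖ₑ ^ 2) := by
          rw [lintegral_const_mul' _ _ (by simp)]
      _ ≤ ENNReal.ofReal (c ^ 3) ^ 2 * ((ENNReal.ofReal (C * L ^ 2) * (ENNReal.ofReal T * Nf) ^ 2) *
          (ENNReal.ofReal T * Ng) ^ 2) := by
          refine mul_le_mul' le_rfl (hmk.trans ?_)
          exact mul_le_mul' (mul_le_mul' le_rfl hfN) (pow_le_pow_left' hgN 2)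
      _ = _ := by
          have e : ENNReal.ofReal (C * L ^ 2) = (ENNReal.ofReal (Real.sqrt C) * ENNReal.ofReal L) ^ 2 := by
            rw [← ENNReal.ofReal_mul (by positivity), ← ENNReal.ofReal_pow (by positivity), mul_pow,
              Real.sq_sqrt hC]
          rw [e, ENNReal.ofReal_mul (by positivity), ENNReal.ofReal_mul (by positivity),
            ENNReal.ofReal_mul (by positivity), ENNReal.ofReal_mul (by positivity)]
          ring
  exact (ENNReal.pow_le_pow_left_iff (by norm_num)).mp hsq

end

/-- Weighted `L^2 × L^1 → L^2` estimate: if `φ, m ∈ C_0^∞(ℝ^{2d})`,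
`a, b ≥ 0`, `∇_ξ(∇_η - ∇_ξ)φ` invertible and `(∇_η - ∇_ξ)φ` non-vanishing on `supp m`, then
for `λ ≠ 0`, `‖B_λ(f,g)‖_{L^2(⟨x⟩^a)} ≤ C |λ|^{-d/2-b} ‖f‖_{L^2(⟨x⟩^{a+b})} ‖g‖_{L^1(⟨x⟩^{a+b})}`. -/
theorem statement6 {d : ℕ} (φ : E d × E d → ℝ) (m : E d × E d → ℂ)
    (a b : ℝ) (ha : 0 ≤ a) (hb : 0 ≤ b)
    (hφs : ContDiff ℝ (⊤ : ℕ∞) φ) (hφc : HasCompactSupport φ)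
    (hms : ContDiff ℝ (⊤ : ℕ∞) m) (hmc : HasCompactSupport m)
    (hmat : ∀ p ∈ tsupport m,
      (derMat φ p xiV (fun j => etaV j - xiV j)).det ≠ 0)
    (hgrad : ∀ p ∈ tsupport m, ∃ j : Fin d, fderiv ℝ φ p (etaV j - xiV j) ≠ 0) :
    ∃ C : ℝ, ∀ lam : ℝ, lam ≠ 0 → ∀ f g : 𝓢(E d, ℂ),
      wLpNorm 2 a (Bop m φ lam f g) ≤
        ENNReal.ofReal (C * |lam| ^ (-(d : ℝ) / 2 - b)) *
          (wLpNorm 2 (a + b) (⇑f) * wLpNorm 1 (a + b) (⇑g)) := by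
  exact final φ m a b ha hb hφs hms hmc hmat hgrad
end
end

section
/- Let m be a Coifman–Meyer symbol on ℝ^{2d} with compact support and let φ be a smooth real-valued function on ℝ^{2d} such that the 2d×2d Hessian Hess φ is invertible at every point of supp m. Then there exists a constant C such that for all λ ≠ 0 and all Schwartz functions f, g on ℝ^d, ‖B_λ(f,g)‖_{L^∞} ≤ C |λ|^{−d} ‖f‖_{L^1} ‖g‖_{L^1}. -/
open MeasureTheory Filter Complex SchwartzMap
open scoped RealInnerProductSpace ENNReal

noncomputable section

/-- A Coifman–Meyer symbol: smooth away from the origin, with derivative bounds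
`|∂^α m(η,ξ)| ≤ C_α (|η|+|ξ|)^{-|α|}` for all orders. -/
def CoifmanMeyer {d : ℕ} (m : E d × E d → ℂ) : Prop :=
  ContDiffOn ℝ (⊤ : ℕ∞) m {p : E d × E d | p ≠ 0} ∧
    ∀ n : ℕ, ∃ C : ℝ, 0 < C ∧ ∀ p : E d × E d, p ≠ 0 →
      ‖iteratedFDerivWithin ℝ n m {q : E d × E d | q ≠ 0} p‖ ≤
        C * (‖p.1‖ + ‖p.2‖) ^ (-(n : ℝ))

theorem fourier_decay {V : Type*} [NormedAddCommGroup V] [NormedSpace ℝ V]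
    [FiniteDimensional ℝ V] [MeasurableSpace V] [BorelSpace V] (μ : Measure V)
    [μ.IsAddHaarMeasure] (N : ℕ) :
    ∃ C : ℝ, 0 < C ∧ ∀ (F : V → ℂ) (B : ℝ), ContDiff ℝ (⊤ : ℕ∞) F →
      (∀ z, 1 < ‖z‖ → F z = 0) →
      (∀ n ≤ N, ∀ z, ‖iteratedFDeriv ℝ n F z‖ ≤ B) → ∀ ξ : V →L[ℝ] ℝ,
      (1 + ‖ξ‖) ^ N * ‖∫ z, Complex.exp (I * (ξ z : ℝ)) * F z ∂μ‖ ≤ C * B := by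
  let M : ℝ := μ.real (Metric.closedBall (0 : V) 1)
  have hM : 0 ≤ M := measureReal_nonneg
  refine ⟨(2 + 2 * (2 * Real.pi)) ^ N * (2 ^ N * ((N + 1) * (M + 1))), by positivity, ?_⟩
  intro F B hF hsupp hB ξ
  have hts : tsupport F ⊆ Metric.closedBall 0 1 := by
    apply closure_minimal _ Metric.isClosed_closedBall
    intro z hz
    by_contra h
    exact hz (hsupp z (by simpa using h))
  have hcs : HasCompactSupport F :=
    HasCompactSupport.of_support_subset_isCompact (isCompact_closedBall (0 : V) 1)
      ((subset_tsupport F).trans hts)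
  have hB0 : 0 ≤ B := (norm_nonneg _).trans (hB 0 (Nat.zero_le _) 0)
  have hcsn : ∀ n, HasCompactSupport (iteratedFDeriv ℝ n F) := fun n => hcs.iteratedFDeriv n
  have hcont : ∀ n : ℕ, Continuous (iteratedFDeriv ℝ n F) := fun n =>
    hF.continuous_iteratedFDeriv (by exact_mod_cast le_top)
  have hint : ∀ n ≤ N, ∫ v, ‖iteratedFDeriv ℝ n F v‖ ∂μ ≤ B * (M + 1) := by
    intro n hn
    have h1 : ∫ v, ‖iteratedFDeriv ℝ n F v‖ ∂μ
        = ∫ v in Metric.closedBall (0 : V) 1, ‖iteratedFDeriv ℝ n F v‖ ∂μ := by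
      symm
      apply setIntegral_eq_integral_of_forall_compl_eq_zero
      intro x hx
      rw [norm_eq_zero]
      by_contra h
      exact hx (hts (support_iteratedFDeriv_subset n h))
    have h2 : ∫ v in Metric.closedBall (0 : V) 1, ‖iteratedFDeriv ℝ n F v‖ ∂μ
        ≤ ∫ v in Metric.closedBall (0 : V) 1, B ∂μ := by
      apply integral_mono
      · exact (((hcont n).integrable_of_hasCompactSupport (hcsn n)).norm).integrableOn
      · apply (continuous_const.locallyIntegrable).integrableOn_isCompact (isCompact_closedBall _ _)
      · intro v; exact hB n hn v
    rw [h1]; refine h2.trans ?_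
    simp only [setIntegral_const, smul_eq_mul]
    change M * B ≤ _
    nlinarith
  let L : V →L[ℝ] (V →L[ℝ] ℝ) →L[ℝ] ℝ := (ContinuousLinearMap.id ℝ (V →L[ℝ] ℝ)).flip
  let w : V →L[ℝ] ℝ := -((2 * Real.pi)⁻¹ • ξ)
  have hFT : VectorFourier.fourierIntegral Real.fourierChar μ L.toLinearMap₁₂ F w
      = ∫ z, Complex.exp (I * (ξ z : ℝ)) * F z ∂μ := by
    rw [VectorFourier.fourierIntegral]
    congr 1
    ext z
    rw [Circle.smul_def, Real.fourierChar_apply, smul_eq_mul]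
    congr 2
    have : L.toLinearMap₁₂ z w = -((2 * Real.pi)⁻¹ * ξ z) := by
      simp [L, w]
    rw [this]
    push_cast
    have := Real.pi_ne_zero
    field_simp
  set J := ∫ z, Complex.exp (I * (ξ z : ℝ)) * F z ∂μ with hJ
  have hbd : ∀ n ≤ N, ∀ v : V, |w v| ^ n * ‖J‖ ≤ ‖v‖ ^ n * (2 ^ n * ((N + 1) * (B * (M + 1)))) := by
    intro n hn v
    have := VectorFourier.pow_mul_norm_iteratedFDeriv_fourierIntegral_le L (μ := μ) (f := F)
      (K := 0) (N := ⊤) hF (fun k n hk _ => by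
        have hk0 : k = 0 := by simpa using hk
        subst hk0
        simpa using ((hcont n).integrable_of_hasCompactSupport (hcsn n)).norm)
      (k := 0) (n := n) le_rfl le_top v w
    simp only [norm_iteratedFDeriv_zero, hFT] at this
    have hLw : L v w = w v := by simp [L]
    rw [hLw] at this
    refine this.trans ?_
    simp only [pow_zero, mul_one, CharP.cast_eq_zero, mul_zero, zero_add, mul_assoc]
    gcongr
    rw [Finset.sum_product]
    simp only [Finset.range_one, Finset.sum_singleton, pow_zero, one_mul]
    refine (Finset.sum_le_card_nsmul _ _ (B * (M + 1)) ?_).trans ?_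
    · intro i hi; exact hint i ((Nat.lt_succ_iff.1 (Finset.mem_range.1 hi)).trans hn)
    · simp only [Finset.card_range, nsmul_eq_mul]; push_cast
      have : (n : ℝ) ≤ N := by exact_mod_cast hn
      gcongr
  set S := (N + 1) * (B * (M + 1)) with hS
  have hS0 : 0 ≤ S := by positivity
  have hw : ‖ξ‖ ≤ (2 * Real.pi) * ‖w‖ := by
    have : ξ = -((2 * Real.pi) • w) := by
      have := Real.pi_ne_zero
      simp only [w, smul_neg, neg_neg, smul_smul]
      rw [mul_inv_cancel₀ (by positivity), one_smul]
    rw [this, norm_neg, norm_smul]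
    simp [abs_of_pos Real.pi_pos, w]
  have hJ0 : ‖J‖ ≤ S := by
    have := hbd 0 (Nat.zero_le _) 0
    simpa using this
  have hmain : (1 + ‖ξ‖) ^ N * ‖J‖ ≤ (2 + 2 * (2 * Real.pi)) ^ N * (2 ^ N * S) := by
    by_cases h1 : ‖w‖ ≤ 1
    · have h2 : 1 + ‖ξ‖ ≤ 2 + 2 * (2 * Real.pi) := by nlinarith [Real.pi_pos]
      have h3 : S ≤ 2 ^ N * S := le_mul_of_one_le_left hS0 (one_le_pow₀ (by norm_num))
      have := hJ0.trans h3
      gcongr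
    · push Not at h1
      obtain ⟨v, hv, hv2⟩ := w.exists_lt_apply_of_lt_opNorm (show ‖w‖ / 2 < ‖w‖ by linarith)
      rw [Real.norm_eq_abs] at hv2
      have hx : 1 + ‖ξ‖ ≤ (2 + 2 * (2 * Real.pi)) * |w v| := by
        nlinarith [Real.pi_pos, mul_pos Real.pi_pos (sub_pos.2 hv2)]
      have h4 : ‖v‖ ^ N ≤ 1 := pow_le_one₀ (norm_nonneg _) hv.le
      calc (1 + ‖ξ‖) ^ N * ‖J‖ ≤ ((2 + 2 * (2 * Real.pi)) * |w v|) ^ N * ‖J‖ := by gcongr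
        _ = (2 + 2 * (2 * Real.pi)) ^ N * (|w v| ^ N * ‖J‖) := by rw [mul_pow]; ring
        _ ≤ (2 + 2 * (2 * Real.pi)) ^ N * (‖v‖ ^ N * (2 ^ N * S)) := 
            mul_le_mul_of_nonneg_left (hbd N le_rfl v) (by positivity)
        _ ≤ (2 + 2 * (2 * Real.pi)) ^ N * (1 * (2 ^ N * S)) := by gcongr
        _ = _ := by ring
  calc _ ≤ _ := hmain
    _ = _ := by rw [hS]; ring
theorem scale_bound {V W : Type*} [NormedAddCommGroup V] [NormedSpace ℝ V]
    [NormedAddCommGroup W] [NormedSpace ℝ W] (h : V → W) (q : V) (δ : ℝ) (hδ : 0 < δ) (i : ℕ)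
    (z : V) : ‖iteratedFDeriv ℝ i (fun z => h (q + δ • z)) z‖
      ≤ δ ^ i * ‖iteratedFDeriv ℝ i h (q + δ • z)‖ := by
  let g : V ≃L[ℝ] V := ContinuousLinearEquiv.smulLeft (Units.mk0 δ hδ.ne')
  have hg : ∀ z, g z = δ • z := fun z => rfl
  have h1 := g.iteratedFDerivWithin_comp_right (fun y => h (q + y)) (s := Set.univ)
    uniqueDiffOn_univ (x := z) (Set.mem_univ _) i
  simp only [Set.preimage_univ, iteratedFDerivWithin_univ] at h1
  have h2 : (fun z => h (q + δ • z)) = (fun y => h (q + y)) ∘ g := by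
    ext z; simp [hg]
  rw [h2, h1, iteratedFDeriv_comp_add_left, hg]
  refine (ContinuousMultilinearMap.norm_compContinuousLinearMap_le _ _).trans ?_
  rw [mul_comm]
  gcongr
  rw [Finset.prod_const, Finset.card_univ, Fintype.card_fin]
  gcongr
  refine ContinuousLinearMap.opNorm_le_bound _ hδ.le fun x => ?_
  change ‖δ • x‖ ≤ _
  rw [norm_smul, Real.norm_eq_abs, abs_of_pos hδ]

theorem mul_bound {V : Type*} [NormedAddCommGroup V] [NormedSpace ℝ V]
    {U : Set V} (hU : IsOpen U) {f g : V → ℂ} (hf : ContDiffOn ℝ (⊤ : ℕ∞) f U)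
    (hg : ContDiffOn ℝ (⊤ : ℕ∞) g U) {x : V} (hx : x ∈ U) {n : ℕ} {A B : ℝ}
    (hA : ∀ i ≤ n, ‖iteratedFDeriv ℝ i f x‖ ≤ A) (hB : ∀ i ≤ n, ‖iteratedFDeriv ℝ i g x‖ ≤ B) :
    ∀ i ≤ n, ‖iteratedFDeriv ℝ i (fun y => f y * g y) x‖ ≤ 2 ^ n * (A * B) := by
  intro i hi
  have hA0 : 0 ≤ A := (norm_nonneg _).trans (hA 0 (Nat.zero_le _))
  have hB0 : 0 ≤ B := (norm_nonneg _).trans (hB 0 (Nat.zero_le _))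
  have := norm_iteratedFDerivWithin_mul_le hf hg hU.uniqueDiffOn hx (n := i)
    (by exact_mod_cast le_top)
  simp only [iteratedFDerivWithin_of_isOpen _ hU hx] at this
  refine this.trans ?_
  calc _ ≤ ∑ j ∈ Finset.range (i + 1), (i.choose j : ℝ) * (A * B) := by
        apply Finset.sum_le_sum
        intro j hj
        rw [mul_assoc]
        have hj' : j ≤ i := Nat.lt_succ_iff.1 (Finset.mem_range.1 hj)
        gcongr
        · exact hA j (hj'.trans hi)
        · exact hB _ ((Nat.sub_le _ _).trans hi)
    _ = 2 ^ i * (A * B) := by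
        rw [← Finset.sum_mul]
        congr 1
        exact_mod_cast Nat.sum_range_choose i
    _ ≤ _ := by gcongr; norm_num

theorem norm_iterated_exp (i : ℕ) (t : ℝ) :
    ‖iteratedFDeriv ℝ i (fun t : ℝ => Complex.exp (I * (t : ℂ))) t‖ ≤ 1 := by
  rw [norm_iteratedFDeriv_eq_norm_iteratedDeriv]
  have : ∀ i : ℕ, iteratedDeriv i (fun t : ℝ => Complex.exp (I * (t : ℂ)))
      = fun t : ℝ => I ^ i * Complex.exp (I * (t : ℂ)) := by
    intro i
    induction i with
    | zero => ext; simp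
    | succ k ih =>
      rw [iteratedDeriv_succ, ih]
      ext t
      have h1 : HasDerivAt (fun t : ℝ => Complex.exp (I * (t : ℂ)))
          (Complex.exp (I * (t : ℂ)) * (I * 1)) t :=
        ((Complex.ofRealCLM.hasDerivAt (x := t)).const_mul I).cexp
      rw [(h1.const_mul (I ^ k)).deriv]
      ring
  rw [this]
  simp [Complex.norm_exp]

theorem contDiff_expI : ContDiff ℝ (⊤ : ℕ∞) (fun t : ℝ => Complex.exp (I * (t : ℂ))) := by
  have : ContDiff ℝ (⊤ : ℕ∞) (fun t : ℝ => (t : ℂ)) := Complex.ofRealCLM.contDiff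
  exact (contDiff_const.mul this).cexp

theorem exp_bound {V : Type*} [NormedAddCommGroup V] [NormedSpace ℝ V]
    {R : V → ℝ} (hR : ContDiff ℝ (⊤ : ℕ∞) R) {x : V} {n : ℕ} {D : ℝ} (hD1 : 1 ≤ D)
    (hD : ∀ i, 1 ≤ i → i ≤ n → ‖iteratedFDeriv ℝ i R x‖ ≤ D) :
    ∀ i ≤ n, ‖iteratedFDeriv ℝ i (fun y => Complex.exp (I * (R y : ℂ))) x‖ ≤ n.factorial * D ^ n := by
  intro i hi
  have := norm_iteratedFDeriv_comp_le contDiff_expI hR (n := i) (by exact_mod_cast le_top) x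
    (C := 1) (D := D) (fun j _ => norm_iterated_exp j _)
    (fun j h1 hj => (hD j h1 (hj.trans hi)).trans (le_self_pow₀ hD1 (by omega)))
  refine this.trans ?_
  rw [mul_one]
  have := Nat.factorial_le hi
  gcongr

theorem phase_bound {V : Type*} [NormedAddCommGroup V] [NormedSpace ℝ V] [FiniteDimensional ℝ V]
    (φ : V → ℝ) (hφ : ContDiff ℝ (⊤ : ℕ∞) φ) (ρ : ℝ) (N : ℕ) :
    ∃ D : ℝ, 1 ≤ D ∧ ∀ (q z : V) (δ lam : ℝ), 0 < δ → δ ≤ 1 → |lam| * δ ^ 2 = 1 →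
      ‖q‖ ≤ ρ → ‖z‖ ≤ 1 → ∀ i, 1 ≤ i → i ≤ N →
      ‖iteratedFDeriv ℝ i (fun z => lam * (φ (q + δ • z) - φ q - δ * fderiv ℝ φ q z)) z‖ ≤ D := by
  have hcont : ∀ i : ℕ, Continuous (iteratedFDeriv ℝ i φ) := fun n =>
    hφ.continuous_iteratedFDeriv (by exact_mod_cast le_top)
  have hex : ∀ i : ℕ, ∃ C, ∀ p ∈ Metric.closedBall (0 : V) (ρ + 1), ‖iteratedFDeriv ℝ i φ p‖ ≤ C :=
    fun i => (isCompact_closedBall (0 : V) (ρ + 1)).exists_bound_of_continuousOn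
      (hcont i).continuousOn
  choose C hC using hex
  refine ⟨1 + ∑ i ∈ Finset.range (N + 2), |C i|, ?_, ?_⟩
  · have : 0 ≤ ∑ i ∈ Finset.range (N + 2), |C i| := Finset.sum_nonneg fun i _ => abs_nonneg _
    linarith
  intro q z δ lam hδ hδ1 hlam hq hz i hi hiN
  have hle : ∀ j < N + 2, C j ≤ 1 + ∑ i ∈ Finset.range (N + 2), |C i| := by
    intro j hj
    have := Finset.single_le_sum (f := fun i => |C i|) (fun i _ => abs_nonneg (C i))
      (Finset.mem_range.2 hj)
    have h2 := le_abs_self (C j)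
    linarith
  have hmem : ∀ w : V, ‖w‖ ≤ 1 → q + δ • w ∈ Metric.closedBall (0 : V) (ρ + 1) := by
    intro w hw
    rw [mem_closedBall_zero_iff]
    refine (norm_add_le _ _).trans ?_
    rw [norm_smul, Real.norm_eq_abs, abs_of_pos hδ]
    nlinarith [norm_nonneg w]
  have hq' : q ∈ Metric.closedBall (0 : V) (ρ + 1) := by
    rw [mem_closedBall_zero_iff]; linarith
  obtain ⟨j, rfl⟩ : ∃ j, i = j + 1 := ⟨i - 1, by omega⟩
  have hd : fderiv ℝ (fun z => lam * (φ (q + δ • z) - φ q - δ * fderiv ℝ φ q z))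
      = fun z => (lam * δ) • (fderiv ℝ φ (q + δ • z) - fderiv ℝ φ q) := by
    ext1 z
    have h1 : HasFDerivAt φ (fderiv ℝ φ (q + δ • z)) (q + δ • z) :=
      (hφ.differentiable (by simp) _).hasFDerivAt
    have h2 : HasFDerivAt (fun z : V => q + δ • z) (δ • ContinuousLinearMap.id ℝ V) z :=
      ((hasFDerivAt_id z).const_smul δ).const_add q
    have h3 := (((h1.comp z h2).sub_const (φ q)).sub
      ((fderiv ℝ φ q).hasFDerivAt.const_mul δ)).const_mul lam
    refine h3.fderiv.trans ?_
    ext v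
    simp
    ring
  have hfφ : ContDiff ℝ (⊤ : ℕ∞) (fderiv ℝ φ) := hφ.fderiv_right (by simp)
  have haff : ContDiff ℝ (⊤ : ℕ∞) (fun z : V => q + δ • z) := by fun_prop
  rw [← norm_iteratedFDeriv_fderiv, hd]
  rcases Nat.eq_zero_or_pos j with rfl | hj
  · rw [norm_iteratedFDeriv_zero, norm_smul]
    have hmv : ‖fderiv ℝ φ (q + δ • z) - fderiv ℝ φ q‖ ≤ C 2 * ‖(q + δ • z) - q‖ := by
      refine (convex_closedBall (0 : V) (ρ + 1)).norm_image_sub_le_of_norm_fderiv_le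
        (fun x _ => hfφ.differentiable (by simp) x) (fun x hx => ?_) hq' (hmem z hz)
      rw [← norm_iteratedFDeriv_zero (𝕜 := ℝ) (f := fderiv ℝ (fderiv ℝ φ)),
        norm_iteratedFDeriv_fderiv, norm_iteratedFDeriv_fderiv]
      exact hC 2 x hx
    have hC2 : 0 ≤ C 2 := (norm_nonneg _).trans (hC 2 q hq')
    rw [add_sub_cancel_left, norm_smul, Real.norm_eq_abs δ, abs_of_pos hδ] at hmv
    rw [Real.norm_eq_abs, abs_mul, abs_of_pos hδ]
    calc _ ≤ |lam| * δ * (C 2 * (δ * 1)) := by gcongr; exact hmv.trans (by gcongr)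
      _ = (|lam| * δ ^ 2) * C 2 := by ring
      _ = C 2 := by rw [hlam, one_mul]
      _ ≤ _ := hle 2 (by omega)
  · have hs : ContDiff ℝ (⊤ : ℕ∞) (fun z : V => fderiv ℝ φ (q + δ • z)) := hfφ.comp haff
    have e1 : iteratedFDeriv ℝ j (fun z => (lam * δ) • (fderiv ℝ φ (q + δ • z) - fderiv ℝ φ q)) z
        = (lam * δ) • iteratedFDeriv ℝ j (fun z => fderiv ℝ φ (q + δ • z)) z := by
      rw [iteratedFDeriv_const_smul_apply'
        ((hs.sub contDiff_const).contDiffAt.of_le (by exact_mod_cast le_top))]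
      congr 1
      have := iteratedFDeriv_sub_apply (𝕜 := ℝ) (i := j) (x := z)
        (f := (fun z => fderiv ℝ φ (q + δ • z))) (g := fun _ => fderiv ℝ φ q)
        (hs.contDiffAt.of_le (by exact_mod_cast le_top)) contDiff_const.contDiffAt
      refine this.trans ?_
      rw [iteratedFDeriv_const_of_ne (by omega)]
      simp
    rw [e1, norm_smul]
    have h5 := scale_bound (fderiv ℝ φ) q δ hδ j z
    rw [norm_iteratedFDeriv_fderiv] at h5
    have h6 := hC (j + 1) _ (hmem z hz)
    have hC0 := (norm_nonneg _).trans h6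
    have h7 : δ ^ j ≤ δ := pow_le_of_le_one hδ.le hδ1 (by omega)
    rw [Real.norm_eq_abs, abs_mul, abs_of_pos hδ]
    calc _ ≤ |lam| * δ * (δ * C (j + 1)) := by gcongr; exact h5.trans (by gcongr)
      _ = (|lam| * δ ^ 2) * C (j + 1) := by ring
      _ = C (j + 1) := by rw [hlam, one_mul]
      _ ≤ _ := hle _ (by omega)

theorem amp_bound {V : Type*} [NormedAddCommGroup V] [NormedSpace ℝ V]
    [FiniteDimensional ℝ V] [MeasurableSpace V] [BorelSpace V] (μ : Measure V)
    [μ.IsAddHaarMeasure] (N : ℕ) (η : V → ℝ) (hη : ContDiff ℝ (⊤ : ℕ∞) η)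
    (hη0 : ∀ z, 1 < ‖z‖ → η z = 0)
    (m : V → ℂ) (hm : ContDiffOn ℝ (⊤ : ℕ∞) m {p | p ≠ 0})
    (hmb : ∀ i : ℕ, ∃ C : ℝ, ∀ p ≠ 0, ‖iteratedFDeriv ℝ i m p‖ ≤ C * (‖p‖ ^ i)⁻¹)
    (φ : V → ℝ) (hφ : ContDiff ℝ (⊤ : ℕ∞) φ) (ρ : ℝ) :
    ∃ C : ℝ, 0 < C ∧ ∀ (q : V) (δ lam : ℝ) (ℓ : V →L[ℝ] ℝ), 0 < δ → δ ≤ 1 → |lam| * δ ^ 2 = 1 →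
      ‖q‖ ≤ ρ → 2 * δ < ‖q‖ →
      (1 + δ⁻¹ * ‖fderiv ℝ φ q + lam⁻¹ • ℓ‖) ^ N *
        ‖∫ z, (η z : ℂ) * (Complex.exp (I * ((ℓ (q + δ • z) + lam * φ (q + δ • z) : ℝ) : ℂ)) *
          m (q + δ • z)) ∂μ‖ ≤ C := by
  obtain ⟨C0, hC0, hdec⟩ := fourier_decay μ N
  obtain ⟨D, hD1, hD⟩ := phase_bound φ hφ ρ N
  have hηC : ContDiff ℝ (⊤ : ℕ∞) (fun z => (η z : ℂ)) := Complex.ofRealCLM.contDiff.comp hη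
  have hηb : ∀ i : ℕ, ∃ C, ∀ z ∈ Metric.closedBall (0 : V) 1,
      ‖iteratedFDeriv ℝ i (fun z => (η z : ℂ)) z‖ ≤ C := fun i =>
    (isCompact_closedBall (0 : V) 1).exists_bound_of_continuousOn
      (hηC.continuous_iteratedFDeriv (by exact_mod_cast le_top)).continuousOn
  choose Cη hCη using hηb
  choose Cm hCm using hmb
  have hsum : ∀ (c : ℕ → ℝ), ∀ i ≤ N, c i ≤ ∑ i ∈ Finset.range (N + 1), |c i| := by
    intro c i hi
    have := Finset.single_le_sum (f := fun i => |c i|) (fun i _ => abs_nonneg (c i))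
      (Finset.mem_range.2 (Nat.lt_succ_iff.2 hi))
    exact (le_abs_self _).trans this
  set A := ∑ i ∈ Finset.range (N + 1), |Cη i| with hA
  set M := ∑ i ∈ Finset.range (N + 1), |Cm i| with hM
  have hA0 : 0 ≤ A := Finset.sum_nonneg fun i _ => abs_nonneg _
  have hM0 : 0 ≤ M := Finset.sum_nonneg fun i _ => abs_nonneg _
  set B := 2 ^ N * (A * (2 ^ N * ((N.factorial * D ^ N) * M))) with hB
  have hB0 : 0 ≤ B := by positivity
  refine ⟨C0 * B + 1, by positivity, ?_⟩
  intro q δ lam ℓ hδ hδ1 hlam hq hqδ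
  have hlam0 : lam ≠ 0 := by rintro rfl; simp at hlam
  set R : V → ℝ := fun z => lam * (φ (q + δ • z) - φ q - δ * fderiv ℝ φ q z) with hRdef
  have haff : ContDiff ℝ (⊤ : ℕ∞) (fun z : V => q + δ • z) := by fun_prop
  have hR : ContDiff ℝ (⊤ : ℕ∞) R := by
    have h1 : ContDiff ℝ (⊤ : ℕ∞) (fun z : V => φ (q + δ • z)) := hφ.comp haff
    exact contDiff_const.mul ((h1.sub contDiff_const).sub
      (contDiff_const.mul (fderiv ℝ φ q).contDiff))
  set U : Set V := Metric.ball 0 2 with hU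
  have hUo : IsOpen U := Metric.isOpen_ball
  have hlow : ∀ (z : V) (r : ℝ), ‖z‖ ≤ r → ‖q‖ - δ * r ≤ ‖q + δ • z‖ := by
    intro z r hz
    have h1 : ‖q‖ ≤ ‖q + δ • z‖ + ‖δ • z‖ := by
      have := norm_sub_le (q + δ • z) (δ • z)
      simpa using this
    rw [norm_smul, Real.norm_eq_abs, abs_of_pos hδ] at h1
    nlinarith
  have hmU : ContDiffOn ℝ (⊤ : ℕ∞) (fun z => m (q + δ • z)) U := by
    refine hm.comp haff.contDiffOn ?_
    intro z hz h0
    have hz2 : ‖z‖ < 2 := by simpa [hU] using hz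
    have := hlow z 2 hz2.le
    rw [show q + δ • z = 0 from h0, norm_zero] at this
    linarith
  have hE : ContDiff ℝ (⊤ : ℕ∞) (fun z => Complex.exp (I * (R z : ℂ))) := contDiff_expI.comp hR
  set F : V → ℂ := fun z => (η z : ℂ) * (Complex.exp (I * (R z : ℂ)) * m (q + δ • z)) with hF
  have hFU : ContDiffOn ℝ (⊤ : ℕ∞) F U := hηC.contDiffOn.mul (hE.contDiffOn.mul hmU)
  have hF0 : ∀ z, 1 < ‖z‖ → F z = 0 := by
    intro z hz; simp [hF, hη0 z hz]
  have hFev : ∀ z, 1 < ‖z‖ → F =ᶠ[nhds z] (fun _ => 0) := by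
    intro z hz
    filter_upwards [(isOpen_lt continuous_const continuous_norm).mem_nhds hz] with y hy
    exact hF0 y hy
  have hFs : ContDiff ℝ (⊤ : ℕ∞) F := by
    rw [contDiff_iff_contDiffAt]
    intro z
    by_cases hz : ‖z‖ < 2
    · exact hFU.contDiffAt (hUo.mem_nhds (by simpa [hU] using hz))
    · exact contDiffAt_const.congr_of_eventuallyEq (hFev z (by linarith))
  have hFB : ∀ n ≤ N, ∀ z, ‖iteratedFDeriv ℝ n F z‖ ≤ B := by
    intro n hn z
    by_cases hz : ‖z‖ ≤ 1
    · have hzU : z ∈ U := by simp [hU]; linarith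
      have b1 := exp_bound hR hD1 (fun i h1 h2 => hD q z δ lam hδ hδ1 hlam hq hz i h1 h2)
      have b2 : ∀ i ≤ N, ‖iteratedFDeriv ℝ i (fun z => m (q + δ • z)) z‖ ≤ M := by
        intro i hi
        refine (scale_bound m q δ hδ i z).trans ?_
        have hl := hlow z 1 hz
        have hl2 : δ ≤ ‖q + δ • z‖ := by linarith
        have hp : 0 < ‖q + δ • z‖ := by linarith
        have hc := hCm i (q + δ • z) (norm_pos_iff.1 hp)
        have hCi : Cm i ≤ M := hsum Cm i hi
        calc _ ≤ δ ^ i * (M * (δ ^ i)⁻¹) := by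
              gcongr
              refine hc.trans ?_
              gcongr
          _ = M := by field_simp
      have b3 := mul_bound hUo hE.contDiffOn hmU hzU b1 b2
      have b4 := mul_bound hUo hηC.contDiffOn (hE.contDiffOn.mul hmU) hzU
        (fun i hi => (hCη i z (by simpa using hz)).trans (hsum Cη i hi)) b3
      exact b4 n hn
    · push Not at hz
      have := (hFev z hz).iteratedFDeriv ℝ n
      rw [this.eq_of_nhds]
      have h0 : iteratedFDeriv ℝ n (fun _ : V => (0 : ℂ)) z = 0 := by
        exact congrFun (iteratedFDeriv_fun_zero (𝕜 := ℝ) (n := n)) z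
      rw [h0, norm_zero]; exact hB0
  have key := hdec F B hFs hF0 hFB (δ • (ℓ + lam • fderiv ℝ φ q))
  have hnorm : ‖δ • (ℓ + lam • fderiv ℝ φ q)‖ = δ⁻¹ * ‖fderiv ℝ φ q + lam⁻¹ • ℓ‖ := by
    have : ℓ + lam • fderiv ℝ φ q = lam • (fderiv ℝ φ q + lam⁻¹ • ℓ) := by
      rw [smul_add, smul_smul, mul_inv_cancel₀ hlam0, one_smul, add_comm]
    rw [this, smul_smul, norm_smul, Real.norm_eq_abs, abs_mul, abs_of_pos hδ]
    congr 1
    field_simp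
    linarith
  rw [hnorm] at key
  have hint : ‖∫ z, (η z : ℂ) * (Complex.exp (I * ((ℓ (q + δ • z) + lam * φ (q + δ • z) : ℝ) : ℂ)) *
          m (q + δ • z)) ∂μ‖
      = ‖∫ z, Complex.exp (I * (((δ • (ℓ + lam • fderiv ℝ φ q)) z : ℝ) : ℂ)) * F z ∂μ‖ := by
    have e : ∀ z, (η z : ℂ) * (Complex.exp (I * ((ℓ (q + δ • z) + lam * φ (q + δ • z) : ℝ) : ℂ)) *
          m (q + δ • z)) = Complex.exp (((ℓ q + lam * φ q : ℝ) : ℂ) * I) *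
          (Complex.exp (I * (((δ • (ℓ + lam • fderiv ℝ φ q)) z : ℝ) : ℂ)) * F z) := by
      intro z
      have e2 : Complex.exp (I * ((ℓ (q + δ • z) + lam * φ (q + δ • z) : ℝ) : ℂ))
          = Complex.exp (((ℓ q + lam * φ q : ℝ) : ℂ) * I) *
            (Complex.exp (I * (((δ • (ℓ + lam • fderiv ℝ φ q)) z : ℝ) : ℂ)) *
              Complex.exp (I * (R z : ℂ))) := by
        rw [← Complex.exp_add, ← Complex.exp_add]
        congr 1
        simp only [hRdef, map_add, map_smul, _root_.smul_apply,
          _root_.add_apply, smul_eq_mul]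
        push_cast
        ring
      rw [e2]
      simp only [hF]
      ring
    simp_rw [e]
    rw [integral_const_mul, norm_mul, Complex.norm_exp_ofReal_mul_I, one_mul]
  rw [hint]
  linarith

theorem local_antilip {V : Type*} [NormedAddCommGroup V] [NormedSpace ℝ V]
    [FiniteDimensional ℝ V] (φ : V → ℝ) (hφ : ContDiff ℝ (⊤ : ℕ∞) φ) (p : V)
    (hinj : Function.Injective (fderiv ℝ (fderiv ℝ φ) p)) :
    ∃ c r : ℝ, 0 < c ∧ 0 < r ∧ ∀ w : V →L[ℝ] ℝ, ∃ qs : V, ∀ q ∈ Metric.closedBall p r,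
      c * ‖q - qs‖ ≤ ‖fderiv ℝ φ q + w‖ := by
  have hfφ : ContDiff ℝ (⊤ : ℕ∞) (fderiv ℝ φ) := hφ.fderiv_right (by simp)
  set A := fderiv ℝ (fderiv ℝ φ) p with hA
  have hs : HasStrictFDerivAt (fderiv ℝ φ) A p :=
    hfφ.contDiffAt.hasStrictFDerivAt (by simp)
  obtain ⟨K, hK, hanti⟩ := (A : V →ₗ[ℝ] (V →L[ℝ] ℝ)).exists_antilipschitzWith
    (LinearMap.ker_eq_bot.2 hinj)
  have hK' : (0 : ℝ) < K := by exact_mod_cast hK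
  have hlow : ∀ x : V, (K : ℝ)⁻¹ * ‖x‖ ≤ ‖A x‖ := by
    intro x
    have := hanti.le_mul_dist x 0
    simp only [dist_zero_right, map_zero] at this
    rw [inv_mul_le_iff₀ hK']
    exact this
  have hlo := hs.isLittleO.def (c := (K : ℝ)⁻¹ / 2) (by positivity)
  obtain ⟨r, hr, hball⟩ := Metric.eventually_nhds_iff_ball.1 hlo
  have hpair : ∀ x ∈ Metric.closedBall p (r / 2), ∀ y ∈ Metric.closedBall p (r / 2),
      (K : ℝ)⁻¹ / 2 * ‖x - y‖ ≤ ‖fderiv ℝ φ x - fderiv ℝ φ y‖ := by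
    intro x hx y hy
    have h1 := hball (x, y) (by
      rw [← ball_prod_same]
      rw [Metric.mem_closedBall] at hx hy
      exact ⟨by rw [Metric.mem_ball]; linarith, by rw [Metric.mem_ball]; linarith⟩)
    simp only at h1
    have h2 := hlow (x - y)
    have h3 : ‖A (x - y)‖ ≤ ‖fderiv ℝ φ x - fderiv ℝ φ y‖
        + ‖fderiv ℝ φ x - fderiv ℝ φ y - A (x - y)‖ := by
      have := norm_sub_le (fderiv ℝ φ x - fderiv ℝ φ y)
        (fderiv ℝ φ x - fderiv ℝ φ y - A (x - y))
      simpa using this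
    linarith
  refine ⟨(K : ℝ)⁻¹ / 2 / 2, r / 2, by positivity, by positivity, fun w => ?_⟩
  obtain ⟨qs, hqs, hmin⟩ := (isCompact_closedBall p (r / 2)).exists_isMinOn
    ⟨p, Metric.mem_closedBall_self (by positivity)⟩
    (f := fun q => ‖fderiv ℝ φ q + w‖)
    ((hfφ.continuous.add continuous_const).norm.continuousOn)
  refine ⟨qs, fun q hq => ?_⟩
  have h1 := hpair q hq qs hqs
  have h2 : ‖fderiv ℝ φ qs + w‖ ≤ ‖fderiv ℝ φ q + w‖ := hmin hq
  have h3 := norm_sub_le (fderiv ℝ φ q + w) (fderiv ℝ φ qs + w)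
  rw [add_sub_add_right_eq_sub] at h3
  linarith

theorem bracket {V : Type*} [NormedAddCommGroup V] [NormedSpace ℝ V]
    [FiniteDimensional ℝ V] [MeasurableSpace V] [BorelSpace V] (μ : Measure V)
    [μ.IsAddHaarMeasure] (M : ℝ) (hM : 0 < M) (qs : V) :
    Integrable (fun q => ((1 + M * ‖q - qs‖) ^ (Module.finrank ℝ V + 1))⁻¹) μ ∧
    ∫ q, ((1 + M * ‖q - qs‖) ^ (Module.finrank ℝ V + 1))⁻¹ ∂μ =
      (M ^ Module.finrank ℝ V)⁻¹ * ∫ q, ((1 + ‖q‖) ^ (Module.finrank ℝ V + 1))⁻¹ ∂μ := by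
  have h0 : Integrable (fun q : V => ((1 + ‖q‖) ^ (Module.finrank ℝ V + 1))⁻¹) μ := by
    have := integrable_one_add_norm (E := V) (μ := μ) (r := (Module.finrank ℝ V + 1 : ℕ))
      (by push_cast; linarith)
    refine this.congr (Eventually.of_forall fun q => ?_)
    simp only
    rw [Real.rpow_neg (by positivity), Real.rpow_natCast]
  have e : ∀ q : V, ((1 + M * ‖q‖) ^ (Module.finrank ℝ V + 1))⁻¹
      = (fun q : V => ((1 + ‖q‖) ^ (Module.finrank ℝ V + 1))⁻¹) (M • q) := by
    intro q
    simp only [norm_smul, Real.norm_eq_abs, abs_of_pos hM]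
  constructor
  · have := ((integrable_comp_smul_iff μ _ hM.ne').2 h0).comp_sub_right qs
    refine this.congr (Eventually.of_forall fun q => ?_)
    simp only [norm_smul, Real.norm_eq_abs, abs_of_pos hM]
  · rw [integral_sub_right_eq_self (fun q => ((1 + M * ‖q‖) ^ (Module.finrank ℝ V + 1))⁻¹) qs]
    simp_rw [e]
    rw [Measure.integral_comp_smul μ (fun q : V => ((1 + ‖q‖) ^ (Module.finrank ℝ V + 1))⁻¹) M, smul_eq_mul, abs_of_pos (by positivity)]

theorem average {V : Type*} [NormedAddCommGroup V] [NormedSpace ℝ V]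
    [FiniteDimensional ℝ V] [MeasurableSpace V] [BorelSpace V] (μ : Measure V)
    [μ.IsAddHaarMeasure] (η : V → ℝ) (hη : Continuous η) (hηi : Integrable η μ)
    (hη1 : ∫ z, η z ∂μ = 1) (H : V → ℂ) (hHm : Measurable H) (hH : Integrable H μ) (δ : ℝ) :
    ∫ p, H p ∂μ = ∫ q, ∫ z, (η z : ℂ) * H (q + δ • z) ∂μ ∂μ := by
  have hint : Integrable (Function.uncurry fun q z => (η z : ℂ) * H (q + δ • z)) (μ.prod μ) := by
    have hmeas : Measurable (Function.uncurry fun q z => (η z : ℂ) * H (q + δ • z)) := by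
      have h1 : Measurable fun x : V × V => x.1 + δ • x.2 := by fun_prop
      have h2 : Measurable fun x : V × V => ((η x.2 : ℝ) : ℂ) :=
        Complex.measurable_ofReal.comp (hη.measurable.comp measurable_snd)
      exact h2.mul (hHm.comp h1)
    rw [integrable_prod_iff' hmeas.aestronglyMeasurable]
    constructor
    · refine Eventually.of_forall fun z => ?_
      exact (hH.comp_add_right (δ • z)).const_mul (η z : ℂ)
    · have : (fun y => ∫ x, ‖Function.uncurry (fun q z => (η z : ℂ) * H (q + δ • z)) (x, y)‖ ∂μ)
          = fun y => ‖η y‖ * ∫ x, ‖H x‖ ∂μ := by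
        ext y
        simp only [Function.uncurry, norm_mul, Complex.norm_real]
        rw [integral_const_mul, integral_add_right_eq_self (fun x => ‖H x‖)]
      rw [this]
      exact hηi.norm.mul_const _
  rw [integral_integral_swap hint]
  have : ∀ z, ∫ q, (η z : ℂ) * H (q + δ • z) ∂μ = (η z : ℂ) * ∫ p, H p ∂μ := by
    intro z
    rw [integral_const_mul, integral_add_right_eq_self H]
  simp_rw [this]
  rw [integral_mul_const, integral_complex_ofReal, hη1]
  simp

theorem osc {V : Type*} [NormedAddCommGroup V] [NormedSpace ℝ V]
    [FiniteDimensional ℝ V] [MeasurableSpace V] [BorelSpace V] (μ : Measure V)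
    [μ.IsAddHaarMeasure]
    (m : V → ℂ) (hm : ContDiffOn ℝ (⊤ : ℕ∞) m {p | p ≠ 0})
    (hmb : ∀ i : ℕ, ∃ C : ℝ, ∀ p ≠ 0, ‖iteratedFDeriv ℝ i m p‖ ≤ C * (‖p‖ ^ i)⁻¹)
    (hmm : Measurable m) (hmi : Integrable m μ) (Bm : ℝ) (hBm : ∀ p, ‖m p‖ ≤ Bm)
    (hmc : HasCompactSupport m)
    (φ : V → ℝ) (hφ : ContDiff ℝ (⊤ : ℕ∞) φ)
    (hH : ∀ p ∈ tsupport m, Function.Injective (fderiv ℝ (fderiv ℝ φ) p)) :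
    ∃ C : ℝ, 0 ≤ C ∧ ∀ (δ lam : ℝ) (ℓ : V →L[ℝ] ℝ), 0 < δ → |lam| * δ ^ 2 = 1 →
      ‖∫ p, Complex.exp (I * ((ℓ p + lam * φ p : ℝ) : ℂ)) * m p ∂μ‖
        ≤ C * δ ^ Module.finrank ℝ V := by
  set n := Module.finrank ℝ V with hn
  have hBm0 : 0 ≤ Bm := (norm_nonneg _).trans (hBm 0)
  -- the bump
  let b : ContDiffBump (0 : V) := ⟨1 / 2, 1, by norm_num, by norm_num⟩
  let η : V → ℝ := b.normed μ
  have hηs : ContDiff ℝ (⊤ : ℕ∞) η := b.contDiff_normed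
  have hη0 : ∀ z, 1 < ‖z‖ → η z = 0 := by
    intro z hz
    by_contra h
    have : z ∈ Function.support (b.normed μ) := h
    rw [b.support_normed_eq] at this
    have h2 : ‖z‖ < 1 := by simpa [b] using this
    linarith
  have hη1 : ∫ z, η z ∂μ = 1 := b.integral_normed
  have hηi : Integrable η μ := b.integrable_normed
  have hηn : ∀ z, 0 ≤ η z := b.nonneg_normed
  -- geometry of the support
  set K := tsupport m with hK
  have hKc : IsCompact K := hmc
  obtain ⟨ρ, hρ⟩ := hKc.isBounded.subset_closedBall (0 : V)
  obtain ⟨C1, hC1, hamp⟩ := amp_bound μ (n + 1) η hηs hη0 m hm hmb φ hφ (ρ + 1)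
  have hloc := fun p : K => local_antilip φ hφ p (hH p p.2)
  choose c r hc hr hqs using hloc
  obtain ⟨t, ht⟩ := hKc.elim_finite_subcover (fun p : K => Metric.ball (p : V) (r p))
    (fun _ => Metric.isOpen_ball)
    (fun x hx => Set.mem_iUnion.2 ⟨⟨x, hx⟩, Metric.mem_ball_self (hr _)⟩)
  obtain ⟨ε, hε, hεsub⟩ := hKc.exists_cthickening_subset_open
    (isOpen_biUnion fun p _ => Metric.isOpen_ball) ht
  set J := ∫ q : V, ((1 + ‖q‖) ^ (n + 1))⁻¹ ∂μ with hJ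
  have hJ0 : 0 ≤ J := integral_nonneg fun q => by positivity
  set M0 := μ.real (Metric.closedBall (0 : V) 2) with hM0
  have hM00 : 0 ≤ M0 := measureReal_nonneg
  set A := ∫ p, ‖m p‖ ∂μ with hA
  have hA0 : 0 ≤ A := integral_nonneg fun _ => norm_nonneg _
  set ε' := min ε 1 with hε'
  have hε'0 : 0 < ε' := lt_min hε one_pos
  set Csum := ∑ p ∈ t, C1 * ((c p ^ n)⁻¹ * J) with hCsum
  have hCsum0 : 0 ≤ Csum := Finset.sum_nonneg fun p _ => by have := hc p; positivity
  refine ⟨A * (ε' ^ n)⁻¹ + (Bm * M0 + Csum), by positivity, ?_⟩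
  intro δ lam ℓ hδ hlam
  have hnormexp : ∀ x : ℝ, ‖Complex.exp (I * (x : ℂ))‖ = 1 := by
    intro x; rw [mul_comm]; exact Complex.norm_exp_ofReal_mul_I x
  by_cases hδε : ε' < δ
  · have h1 : ‖∫ p, Complex.exp (I * ((ℓ p + lam * φ p : ℝ) : ℂ)) * m p ∂μ‖ ≤ A := by
      refine (norm_integral_le_integral_norm _).trans (le_of_eq ?_)
      simp only [norm_mul, hnormexp, one_mul, hA]
    refine h1.trans ?_
    have h2 : A ≤ A * (ε' ^ n)⁻¹ * δ ^ n := by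
      rw [mul_assoc]
      apply le_mul_of_one_le_right hA0
      rw [← div_eq_inv_mul, one_le_div (by positivity)]
      gcongr
    have h3 : 0 ≤ (Bm * M0 + Csum) * δ ^ n := by positivity
    linarith
  push Not at hδε
  have hδ1 : δ ≤ 1 := hδε.trans (min_le_right _ _)
  set H : V → ℂ := fun p => Complex.exp (I * ((ℓ p + lam * φ p : ℝ) : ℂ)) * m p with hHdef
  have hexpc : Continuous fun p : V => Complex.exp (I * ((ℓ p + lam * φ p : ℝ) : ℂ)) := by
    have := hφ.continuous
    fun_prop
  have hHm : Measurable H := hexpc.measurable.mul hmm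
  have hHi : Integrable H μ := by
    refine hmi.mono hHm.aestronglyMeasurable (Eventually.of_forall fun p => ?_)
    simp only [hHdef, norm_mul, hnormexp, one_mul, le_refl]
  rw [average μ η hηs.continuous hηi hη1 H hHm hHi δ]
  set G : V → ℂ := fun q => ∫ z, (η z : ℂ) * H (q + δ • z) ∂μ with hG
  have hGtriv : ∀ q, ‖G q‖ ≤ Bm := by
    intro q
    refine (norm_integral_le_of_norm_le (hηi.mul_const Bm) (Eventually.of_forall fun z => ?_)).trans
      (le_of_eq ?_)
    · rw [norm_mul, Complex.norm_real, Real.norm_eq_abs, abs_of_nonneg (hηn z)]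
      have : ‖H (q + δ • z)‖ ≤ Bm := by
        simp only [hHdef, norm_mul, hnormexp, one_mul]; exact hBm _
      have := hηn z
      gcongr
    · rw [integral_mul_const, hη1, one_mul]
  choose qs hqs' using fun p => hqs p (lam⁻¹ • ℓ)
  set bd : V → ℝ := fun q => (Metric.closedBall (0 : V) (2 * δ)).indicator (fun _ => Bm) q
    + ∑ p ∈ t, C1 * ((1 + δ⁻¹ * c p * ‖q - qs p‖) ^ (n + 1))⁻¹ with hbd
  have hterm : ∀ p q, 0 ≤ C1 * ((1 + δ⁻¹ * c p * ‖q - qs p‖) ^ (n + 1))⁻¹ := by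
    intro p q; have := hc p; positivity
  have hGbd : ∀ q, ‖G q‖ ≤ bd q := by
    intro q
    have hs0 : 0 ≤ ∑ p ∈ t, C1 * ((1 + δ⁻¹ * c p * ‖q - qs p‖) ^ (n + 1))⁻¹ :=
      Finset.sum_nonneg fun p _ => hterm p q
    have hi0 : 0 ≤ (Metric.closedBall (0 : V) (2 * δ)).indicator (fun _ => Bm) q :=
      Set.indicator_nonneg (fun _ _ => hBm0) q
    by_cases hq2 : ‖q‖ ≤ 2 * δ
    · have : (Metric.closedBall (0 : V) (2 * δ)).indicator (fun _ => Bm) q = Bm :=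
        Set.indicator_of_mem (by simpa using hq2) _
      have h2 := hGtriv q
      simp only [hbd]
      linarith
    push Not at hq2
    by_cases hqK : ∃ z, ‖z‖ ≤ 1 ∧ q + δ • z ∈ K
    · obtain ⟨z, hz, hzK⟩ := hqK
      have hdz : ‖δ • z‖ ≤ δ := by
        rw [norm_smul, Real.norm_eq_abs, abs_of_pos hδ]
        nlinarith
      have hqth : q ∈ Metric.cthickening ε K := by
        refine Metric.mem_cthickening_of_dist_le q (q + δ • z) ε K hzK ?_
        rw [dist_eq_norm]
        have : q - (q + δ • z) = -(δ • z) := by abel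
        rw [this, norm_neg]
        exact hdz.trans (hδε.trans (min_le_left _ _))
      obtain ⟨p, hpt, hpq⟩ := Set.mem_iUnion₂.1 (hεsub hqth)
      have hqρ : ‖q‖ ≤ ρ + 1 := by
        have h1 : ‖q + δ • z‖ ≤ ρ := by simpa using hρ hzK
        have h2 := norm_sub_le (q + δ • z) (δ • z)
        rw [add_sub_cancel_right] at h2
        linarith
      have ha := hamp q δ lam ℓ hδ hδ1 hlam hqρ hq2
      have hcl := hqs' p q (Metric.ball_subset_closedBall hpq)
      have hcp := hc p
      have hb : (1 + δ⁻¹ * c p * ‖q - qs p‖) ^ (n + 1) * ‖G q‖ ≤ C1 := by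
        refine le_trans ?_ ha
        have : δ⁻¹ * c p * ‖q - qs p‖ ≤ δ⁻¹ * ‖fderiv ℝ φ q + lam⁻¹ • ℓ‖ := by
          rw [mul_assoc]; gcongr
        gcongr
      have hsingle := Finset.single_le_sum
        (f := fun p => C1 * ((1 + δ⁻¹ * c p * ‖q - qs p‖) ^ (n + 1))⁻¹)
        (fun p _ => hterm p q) hpt
      have : ‖G q‖ ≤ C1 * ((1 + δ⁻¹ * c p * ‖q - qs p‖) ^ (n + 1))⁻¹ := by
        rw [← div_eq_mul_inv, le_div_iff₀ (by positivity), mul_comm]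
        exact hb
      simp only [hbd]
      linarith
    · push Not at hqK
      have : G q = 0 := by
        simp only [hG]
        rw [← integral_zero V ℂ (μ := μ)]
        congr 1
        ext z
        by_cases hz : ‖z‖ ≤ 1
        · have : m (q + δ • z) = 0 := image_eq_zero_of_notMem_tsupport (hqK z hz)
          simp [hHdef, this]
        · simp [hη0 z (not_le.1 hz)]
      rw [this, norm_zero]
      simp only [hbd]
      linarith
  have hI1 : Integrable ((Metric.closedBall (0 : V) (2 * δ)).indicator (fun _ => Bm)) μ := by
    rw [integrable_indicator_iff Metric.isClosed_closedBall.measurableSet]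
    exact (continuous_const.locallyIntegrable).integrableOn_isCompact (isCompact_closedBall _ _)
  have hI2 : ∀ p ∈ t, Integrable (fun q => C1 * ((1 + δ⁻¹ * c p * ‖q - qs p‖) ^ (n + 1))⁻¹) μ :=
    fun p _ => ((bracket μ (δ⁻¹ * c p) (by have := hc p; positivity) (qs p)).1).const_mul C1
  refine (norm_integral_le_of_norm_le (hI1.add (integrable_finsetSum _ hI2))
    (Eventually.of_forall hGbd)).trans ?_
  have hbdint : ∫ q, bd q ∂μ = (Bm * M0 + Csum) * δ ^ n := by
    simp only [hbd]
    rw [integral_add hI1 (integrable_finsetSum _ hI2), integral_finsetSum _ hI2,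
      integral_indicator Metric.isClosed_closedBall.measurableSet, setIntegral_const, add_mul]
    congr 1
    · rw [Measure.real, mul_comm 2 δ, Measure.addHaar_closedBall_mul _ _ hδ.le,
        ENNReal.toReal_mul, ENNReal.toReal_ofReal (by positivity)]
      simp only [hM0, Measure.real, smul_eq_mul]
      ring
      norm_num
    · rw [hCsum, Finset.sum_mul]
      refine Finset.sum_congr rfl fun p hp => ?_
      have hcp := hc p
      rw [integral_const_mul, (bracket μ (δ⁻¹ * c p) (by positivity) (qs p)).2]
      rw [← hn, ← hJ, mul_pow, inv_pow, mul_inv, inv_inv]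
      ring
  have h3 : 0 ≤ A * (ε' ^ n)⁻¹ * δ ^ n := by positivity
  rw [add_mul]
  refine hbdint.le.trans ?_
  linarith

theorem hess_injective {d : ℕ} (φ : E d × E d → ℝ) (hφ : ContDiff ℝ (⊤ : ℕ∞) φ) (p : E d × E d)
    (h : (hessMat φ p).det ≠ 0) : Function.Injective (fderiv ℝ (fderiv ℝ φ) p) := by
  have hfφ : ContDiff ℝ (⊤ : ℕ∞) (fderiv ℝ φ) := hφ.fderiv_right (by simp)
  set A := fderiv ℝ (fderiv ℝ φ) p with hA
  have hent : ∀ i j, hessMat φ p i j = A (Sum.elim etaV xiV i) (Sum.elim etaV xiV j) := by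
    intro i j
    simp only [hessMat, Matrix.of_apply, D2]
    have h1 : HasFDerivAt (fderiv ℝ φ) A p := (hfφ.differentiable (by simp) p).hasFDerivAt
    have h2 := h1.clm_apply (hasFDerivAt_const (Sum.elim etaV xiV j : E d × E d) p)
    rw [h2.fderiv]
    simp
  rw [injective_iff_map_eq_zero]
  intro v hv
  let w : Fin d ⊕ Fin d → ℝ := Sum.elim (fun i => v.1 i) (fun i => v.2 i)
  have hsum1 : ∀ x : E d, x = ∑ i, x i • (ev i : E d) := by
    intro x
    ext k
    simp [ev, Finset.sum_apply, Pi.single_apply]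
  have hdecomp : v = ∑ i, w i • (Sum.elim etaV xiV i : E d × E d) := by
    rw [Fintype.sum_sum_type]
    simp only [w, Sum.elim_inl, Sum.elim_inr, etaV, xiV]
    apply Prod.ext
    · simp only [Prod.fst_add, Prod.fst_sum, Prod.smul_mk, smul_zero, Finset.sum_const_zero,
        add_zero]
      exact hsum1 v.1
    · simp only [Prod.snd_add, Prod.snd_sum, Prod.smul_mk, smul_zero, Finset.sum_const_zero,
        zero_add]
      exact hsum1 v.2
  have hw : Matrix.vecMul w (hessMat φ p) = 0 := by
    ext j
    simp only [Matrix.vecMul, dotProduct, hent, Pi.zero_apply]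
    have : (A v) (Sum.elim etaV xiV j) = 0 := by rw [hv]; simp
    rw [hdecomp] at this
    simpa [map_sum, -Fintype.sum_sum_type] using this
  have hw0 := Matrix.eq_zero_of_vecMul_eq_zero h hw
  rw [hdecomp, hw0]
  simp

/-- The linear functional given by pairing with `(a, b)`. -/
def pairL {d : ℕ} (a b : E d) : E d × E d →L[ℝ] ℝ :=
  (innerSL ℝ a).comp (ContinuousLinearMap.fst ℝ (E d) (E d)) +
    (innerSL ℝ b).comp (ContinuousLinearMap.snd ℝ (E d) (E d))

theorem pairL_apply {d : ℕ} (a b : E d) (p : E d × E d) :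
    pairL a b p = (⟪a, p.1⟫ : ℝ) + (⟪b, p.2⟫ : ℝ) := by
  simp [pairL]

theorem Bop_kernel {d : ℕ} (m : E d × E d → ℂ) (hmm : Measurable m) (hmi : Integrable m)
    (φ : E d × E d → ℝ) (hφ : Continuous φ) (lam : ℝ) (f g : 𝓢(E d, ℂ)) (x : E d) :
    Bop m φ lam f g x = (((2 * Real.pi) ^ (-(d : ℝ) / 2) : ℝ) : ℂ) ^ 3 *
      ∫ u : E d × E d, (f u.1 * g u.2) *
        ∫ p, Complex.exp (I * ((pairL (x - u.1) (x - u.2) p + lam * φ p : ℝ) : ℂ)) * m p := by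
  set c : ℂ := (((2 * Real.pi) ^ (-(d : ℝ) / 2) : ℝ) : ℂ) with hc
  have hfg : Integrable (fun u : E d × E d => f u.1 * g u.2) :=
    f.integrable.mul_prod g.integrable
  have hnormexp : ∀ x : ℝ, ‖Complex.exp (I * (x : ℂ))‖ = 1 := by
    intro x; rw [mul_comm]; exact Complex.norm_exp_ofReal_mul_I x
  have hint : Integrable (Function.uncurry fun (p u : E d × E d) => (f u.1 * g u.2) *
      (Complex.exp (I * ((pairL (x - u.1) (x - u.2) p + lam * φ p : ℝ) : ℂ)) * m p))
      ((volume : Measure (E d × E d)).prod (volume : Measure (E d × E d))) := by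
    have h0 : Integrable (fun z : (E d × E d) × (E d × E d) => m z.1 * (f z.2.1 * g z.2.2))
      ((volume : Measure (E d × E d)).prod (volume : Measure (E d × E d))) := hmi.mul_prod hfg
    refine h0.mono ?_ (Eventually.of_forall fun z => ?_)
    · have e1 : Continuous fun z : (E d × E d) × (E d × E d) => f z.2.1 * g z.2.2 := by
        have := f.continuous
        have := g.continuous
        fun_prop
      have e2 : Continuous fun z : (E d × E d) × (E d × E d) =>
          Complex.exp (I * ((pairL (x - z.2.1) (x - z.2.2) z.1 + lam * φ z.1 : ℝ) : ℂ)) := by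
        simp only [pairL_apply]
        fun_prop
      exact (e1.measurable.mul (e2.measurable.mul
        (hmm.comp measurable_fst))).aestronglyMeasurable
    · simp only [Function.uncurry, norm_mul, hnormexp, one_mul]
      apply le_of_eq; ring
  have hswap := integral_integral_swap hint
  have e3 : ∀ u : E d × E d, ∫ p, (f u.1 * g u.2) *
      (Complex.exp (I * ((pairL (x - u.1) (x - u.2) p + lam * φ p : ℝ) : ℂ)) * m p)
      = (f u.1 * g u.2) *
        ∫ p, Complex.exp (I * ((pairL (x - u.1) (x - u.2) p + lam * φ p : ℝ) : ℂ)) * m p :=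
    fun u => integral_const_mul _ _
  simp_rw [e3] at hswap
  rw [← hswap, Bop, ← hc, pow_succ' c 2, mul_assoc, ← integral_const_mul (c ^ 2)]
  congr 2
  ext p
  simp only [FT, ← hc]
  have e4 : ∀ u : E d × E d, (f u.1 * g u.2) *
      (Complex.exp (I * ((pairL (x - u.1) (x - u.2) p + lam * φ p : ℝ) : ℂ)) * m p)
      = (Complex.exp (I * ((⟪x, p.1 + p.2⟫ + lam * φ p : ℝ) : ℂ)) * m p) *
        ((Complex.exp (-(I * ((⟪u.1, p.1⟫ : ℝ) : ℂ))) * f u.1) *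
          (Complex.exp (-(I * ((⟪u.2, p.2⟫ : ℝ) : ℂ))) * g u.2)) := by
    intro u
    have : Complex.exp (I * ((pairL (x - u.1) (x - u.2) p + lam * φ p : ℝ) : ℂ))
        = Complex.exp (I * ((⟪x, p.1 + p.2⟫ + lam * φ p : ℝ) : ℂ)) *
          (Complex.exp (-(I * ((⟪u.1, p.1⟫ : ℝ) : ℂ))) *
          Complex.exp (-(I * ((⟪u.2, p.2⟫ : ℝ) : ℂ)))) := by
      rw [← Complex.exp_add, ← Complex.exp_add]
      congr 1
      rw [pairL_apply, inner_sub_left, inner_sub_left, inner_add_right]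
      push_cast
      ring
    rw [this]
    ring
  simp_rw [e4]
  rw [integral_const_mul]
  have e5 := integral_prod_mul (μ := (volume : Measure (E d))) (ν := (volume : Measure (E d)))
    (fun y : E d => Complex.exp (-(I * ((⟪y, p.1⟫ : ℝ) : ℂ))) * f y)
    (fun y : E d => Complex.exp (-(I * ((⟪y, p.2⟫ : ℝ) : ℂ))) * g y)
  rw [Measure.volume_eq_prod, e5]
  ring

theorem statement10 {d : ℕ} (m : E d × E d → ℂ)
    (hmCM : CoifmanMeyer m) (hmc : HasCompactSupport m)
    (φ : E d × E d → ℝ) (hφs : ContDiff ℝ (⊤ : ℕ∞) φ)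
    (hHess : ∀ p ∈ tsupport m, (hessMat φ p).det ≠ 0) :
    ∃ C : ℝ, ∀ lam : ℝ, lam ≠ 0 → ∀ f g : 𝓢(E d, ℂ),
      eLpNorm (Bop m φ lam f g) ⊤ volume ≤
        ENNReal.ofReal (C * |lam| ^ (-(d : ℝ))) *
          (eLpNorm (⇑f) 1 volume * eLpNorm (⇑g) 1 volume) := by
  obtain ⟨hm, hmb⟩ := hmCM
  have hopen : IsOpen {q : E d × E d | q ≠ 0} := isOpen_ne
  have hmb' : ∀ i : ℕ, ∃ C : ℝ, ∀ p : E d × E d, p ≠ 0 →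
      ‖iteratedFDeriv ℝ i m p‖ ≤ C * (‖p‖ ^ i)⁻¹ := by
    intro i
    obtain ⟨C, hC, hb⟩ := hmb i
    refine ⟨C, fun p hp => ?_⟩
    have h1 := hb p hp
    rw [iteratedFDerivWithin_of_isOpen i hopen hp] at h1
    refine h1.trans ?_
    have hp0 : 0 < ‖p‖ := norm_pos_iff.2 hp
    have hle : ‖p‖ ≤ ‖p.1‖ + ‖p.2‖ := by
      rw [Prod.norm_def]
      exact max_le (by linarith [norm_nonneg p.2]) (by linarith [norm_nonneg p.1])
    rw [Real.rpow_neg (by positivity), Real.rpow_natCast]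
    gcongr
  have hmm : Measurable m :=
    measurable_of_continuousOn_compl_singleton 0 (by
      have := hm.continuousOn
      exact this)
  obtain ⟨C0, hC0⟩ := hmb' 0
  have hBm : ∀ p, ‖m p‖ ≤ max C0 ‖m 0‖ := by
    intro p
    by_cases hp : p = 0
    · rw [hp]; exact le_max_right _ _
    · have := hC0 p hp
      simp only [norm_iteratedFDeriv_zero, pow_zero, inv_one, mul_one] at this
      exact this.trans (le_max_left _ _)
  have hmi : Integrable m := by
    have h1 : IntegrableOn m (tsupport m) :=
      Measure.integrableOn_of_bounded (IsCompact.measure_lt_top hmc).ne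
        hmm.aestronglyMeasurable (Eventually.of_forall hBm)
    rwa [integrableOn_iff_integrable_of_support_subset (subset_tsupport m)] at h1
  have : (volume : Measure (E d × E d)).IsAddHaarMeasure :=
    inferInstanceAs ((volume : Measure (E d)).prod (volume : Measure (E d))).IsAddHaarMeasure
  obtain ⟨C, hC, hosc⟩ := osc (volume : Measure (E d × E d)) m hm hmb' hmm hmi _ hBm hmc φ hφs
    (fun p hp => hess_injective φ hφs p (hHess p hp))
  set c : ℝ := (2 * Real.pi) ^ (-(d : ℝ) / 2) with hc
  have hc0 : 0 ≤ c := by positivity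
  refine ⟨c ^ 3 * C, ?_⟩
  intro lam hlam f g
  have hl : 0 < |lam| := abs_pos.2 hlam
  have hδ : 0 < (Real.sqrt |lam|)⁻¹ := by positivity
  have hδ2 : |lam| * ((Real.sqrt |lam|)⁻¹) ^ 2 = 1 := by
    rw [inv_pow, Real.sq_sqrt hl.le]; field_simp
  have hfr : ((Real.sqrt |lam|)⁻¹) ^ Module.finrank ℝ (E d × E d) = |lam| ^ (-(d : ℝ)) := by
    have : Module.finrank ℝ (E d × E d) = 2 * d := by
      rw [Module.finrank_prod, finrank_euclideanSpace_fin]; ring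
    rw [this, pow_mul, inv_pow, Real.sq_sqrt hl.le, Real.rpow_neg hl.le, Real.rpow_natCast, inv_pow]
  have hf1 : eLpNorm (⇑f) 1 volume = ENNReal.ofReal (∫ y, ‖f y‖) := by
    rw [eLpNorm_one_eq_lintegral_enorm, ofReal_integral_norm_eq_lintegral_enorm f.integrable]
  have hg1 : eLpNorm (⇑g) 1 volume = ENNReal.ofReal (∫ y, ‖g y‖) := by
    rw [eLpNorm_one_eq_lintegral_enorm, ofReal_integral_norm_eq_lintegral_enorm g.integrable]
  have hbound : ∀ x, ‖Bop m φ lam f g x‖ ≤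
      c ^ 3 * C * |lam| ^ (-(d : ℝ)) * ((∫ y, ‖f y‖) * ∫ y, ‖g y‖) := by
    intro x
    rw [Bop_kernel m hmm hmi φ hφs.continuous lam f g x, ← hc, norm_mul, norm_pow,
      Complex.norm_real, Real.norm_eq_abs, abs_of_nonneg hc0, mul_assoc, mul_assoc]
    gcongr
    have hfg : Integrable (fun u : E d × E d => ‖f u.1‖ * ‖g u.2‖) :=
      f.integrable.norm.mul_prod g.integrable.norm
    refine (norm_integral_le_of_norm_le (hfg.mul_const (C * |lam| ^ (-(d : ℝ))))
      (Eventually.of_forall fun u => ?_)).trans (le_of_eq ?_)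
    · rw [norm_mul, norm_mul]
      have := hosc _ lam (pairL (x - u.1) (x - u.2)) hδ hδ2
      rw [hfr] at this
      gcongr
    · rw [integral_mul_const]
      have e5 := integral_prod_mul (μ := (volume : Measure (E d)))
        (ν := (volume : Measure (E d))) (fun y : E d => ‖f y‖) (fun y : E d => ‖g y‖)
      rw [Measure.volume_eq_prod, e5]
      ring
  rw [hf1, hg1, ← ENNReal.ofReal_mul (by positivity), ← ENNReal.ofReal_mul (by positivity),
    eLpNorm_exponent_top]
  exact eLpNormEssSup_le_of_ae_bound (Eventually.of_forall hbound)
end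
end
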